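/- Let μ ≥ 0 and let u be a viscosity solution in B₁(0) ⊂ ℝⁿ of the one-phase free boundary problem |∇u|^μ Δu = f in B₁⁺(u), |∇u| = Q on F(u), where f is bounded and continuous, Q is α-Hölder continuous and nonnegative, 0 ∈ F(u), and Q(0) = 1. Then there exist constants ε̃ > 0 and β ∈ (0,1), depending only on n, μ and α, such that: if (xₙ − ε̃)⁺ ≤ u(x) ≤ (xₙ + ε̃)⁺ for all x ∈ B₁(0), ‖f‖_{L^∞(B₁(0))} ≤ ε̃, and the α-Hölder seminorm of Q on B₁(0) is at most ε̃, then F(u) is a C^{1,β} graph in the ball B_{1/2}(0). -/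

import Mathlib

open Metric Set Filter
open scoped RealInnerProductSpace Topology

noncomputable section

abbrev E (n : ℕ) : Type := EuclideanSpace ℝ (Fin n)

/-- Laplacian: trace of the second derivative. -/
def lap {n : ℕ} (φ : E n → ℝ) (x : E n) : ℝ :=
  ∑ i : Fin n, iteratedFDeriv ℝ 2 φ x ![EuclideanSpace.single i 1, EuclideanSpace.single i 1]

def TouchesBelow {n : ℕ} (u φ : E n → ℝ) (x₀ : E n) : Prop :=
  u x₀ = φ x₀ ∧ ∀ᶠ x in 𝓝 x₀, φ x ≤ u x

def TouchesAbove {n : ℕ} (u φ : E n → ℝ) (x₀ : E n) : Prop :=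
  u x₀ = φ x₀ ∧ ∀ᶠ x in 𝓝 x₀, u x ≤ φ x

def posSet {n : ℕ} (Ω : Set (E n)) (u : E n → ℝ) : Set (E n) := {x ∈ Ω | 0 < u x}

def freeBdry {n : ℕ} (Ω : Set (E n)) (u : E n → ℝ) : Set (E n) := frontier (posSet Ω u) ∩ Ω

/-- Viscosity solution of `|∇u|^μ Δu = f` in `Ω⁺(u)`, `|∇u| = Q` on `F(u)`. -/
def ViscSol {n : ℕ} (μ : ℝ) (Ω : Set (E n)) (f Q u : E n → ℝ) : Prop :=
  (∀ φ : E n → ℝ, ContDiff ℝ 2 φ → ∀ x₀ ∈ posSet Ω u,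
      (TouchesBelow u φ x₀ → ‖gradient φ x₀‖ ^ μ * lap φ x₀ ≤ f x₀) ∧
      (TouchesAbove u φ x₀ → f x₀ ≤ ‖gradient φ x₀‖ ^ μ * lap φ x₀)) ∧
  (∀ φ : E n → ℝ, ContDiff ℝ 2 φ → ∀ x₀ ∈ freeBdry Ω u, gradient φ x₀ ≠ 0 →
      (TouchesBelow u (fun x => max (φ x) 0) x₀ → ‖gradient φ x₀‖ ≤ Q x₀) ∧
      (TouchesAbove u (fun x => max (φ x) 0) x₀ → Q x₀ ≤ ‖gradient φ x₀‖))

/-- `S` is a `C^{1,β}` graph in `B`. -/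
def IsC1GraphIn {n : ℕ} (β : ℝ) (S B : Set (E n)) : Prop :=
  ∃ ν : E n, ‖ν‖ = 1 ∧
    ∃ g : ((ℝ ∙ ν)ᗮ : Submodule ℝ (E n)) → ℝ,
      Differentiable ℝ g ∧
      (∃ K : ℝ, ∀ y z : ((ℝ ∙ ν)ᗮ : Submodule ℝ (E n)),
        ‖gradient g y - gradient g z‖ ≤ K * ‖(y : E n) - (z : E n)‖ ^ β) ∧
      S ∩ B = {x ∈ B | ⟪x, ν⟫ = g (Submodule.orthogonalProjectionOnto (ℝ ∙ ν)ᗮ x)}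


set_option linter.all false
section Lap
variable {N : ℕ}

lemma lap_eq (φ : E N → ℝ) (x : E N) : lap φ x = Laplacian.laplacian φ x := by
  rw [InnerProductSpace.laplacian_eq_iteratedFDeriv_orthonormalBasis φ
    (EuclideanSpace.basisFun (Fin N) ℝ)]
  simp [lap]

lemma lap_add {φ ψ : E N → ℝ} (h1 : ContDiff ℝ 2 φ) (h2 : ContDiff ℝ 2 ψ) (x : E N) :
    lap (fun y => φ y + ψ y) x = lap φ x + lap ψ x := by
  simp only [lap_eq]; exact h1.contDiffAt.laplacian_add h2.contDiffAt

lemma lap_smul {φ : E N → ℝ} (c : ℝ) (h1 : ContDiff ℝ 2 φ) (x : E N) :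
    lap (fun y => c * φ y) x = c * lap φ x := by
  simp only [lap_eq]; exact InnerProductSpace.laplacian_smul c h1.contDiffAt

lemma lap_const (c : ℝ) (x : E N) : lap (fun _ => c) x = 0 := by
  simp only [lap_eq, InnerProductSpace.laplacian_const]; rfl

lemma lap_sum {ι : Type*} (s : Finset ι) {φ : ι → E N → ℝ} (h : ∀ i, ContDiff ℝ 2 (φ i)) (x : E N) :
    lap (fun y => ∑ i ∈ s, φ i y) x = ∑ i ∈ s, lap (φ i) x := by
  classical
  induction s using Finset.induction_on with
  | empty => simp [lap_const]
  | insert a s ha ih =>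
    simp only [Finset.sum_insert ha]
    rw [lap_add (h a) (ContDiff.sum fun i _ => h i), ih]

lemma lap_comp {φ : E N → ℝ} (h : ContDiff ℝ 2 φ) (c : E N) (r : ℝ) (R : E N ≃ₗᵢ[ℝ] E N) (x : E N) :
    lap (fun y => φ (c + r • R y)) x = r ^ 2 * lap φ (c + r • R x) := by
  have e1 : (fun y => φ (c + r • R y)) =
      (fun z => φ (c + z)) ∘ (r • (R.toContinuousLinearEquiv : E N →L[ℝ] E N)) := by
    ext y; simp
  rw [lap_eq φ, InnerProductSpace.laplacian_eq_iteratedFDeriv_orthonormalBasis φ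
    ((EuclideanSpace.basisFun (Fin N) ℝ).map R), e1]
  have h2 : ContDiff ℝ 2 (fun z => φ (c + z)) := h.comp (contDiff_const.add contDiff_id)
  simp only [lap]
  rw [Finset.mul_sum]
  refine Finset.sum_congr rfl fun i _ => ?_
  rw [ContinuousLinearMap.iteratedFDeriv_comp_right _ h2 x (i := 2) le_rfl,
    iteratedFDeriv_comp_add_left, iteratedFDeriv_two_apply]
  simp [iteratedFDeriv_two_apply]
  ring

lemma lap_comp' {φ : E N → ℝ} (h : ContDiff ℝ 2 φ) (c : E N) (r : ℝ) (x : E N) :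
    lap (fun y => φ (c + r • y)) x = r ^ 2 * lap φ (c + r • x) :=
  lap_comp h c r (LinearIsometryEquiv.refl ℝ _) x

lemma cd_comp {φ : E N → ℝ} (h : ContDiff ℝ 2 φ) (c : E N) (r : ℝ) :
    ContDiff ℝ 2 (fun y => φ (c + r • y)) := by fun_prop

lemma hasGrad {φ : E N → ℝ} (h : ContDiff ℝ 2 φ) (x : E N) : HasGradientAt φ (gradient φ x) x :=
  (h.differentiable (by norm_num) x).hasGradientAt

lemma hg_add {φ ψ : E N → ℝ} {a b x : E N} (h1 : HasGradientAt φ a x) (h2 : HasGradientAt ψ b x) :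
    HasGradientAt (fun y => φ y + ψ y) (a + b) x := by
  rw [hasGradientAt_iff_hasFDerivAt] at *
  rw [map_add]; exact h1.add h2

lemma hg_smul {φ : E N → ℝ} {a x : E N} (c : ℝ) (h1 : HasGradientAt φ a x) :
    HasGradientAt (fun y => c * φ y) (c • a) x := by
  rw [hasGradientAt_iff_hasFDerivAt] at *
  rw [map_smulₛₗ]; simpa using h1.const_mul c

lemma hg_const (c : ℝ) (x : E N) : HasGradientAt (fun _ : E N => c) 0 x := hasGradientAt_const x c

lemma hg_inner (v x : E N) : HasGradientAt (fun y : E N => ⟪y, v⟫) v x := by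
  rw [hasGradientAt_iff_hasFDerivAt]
  have := (InnerProductSpace.toDual ℝ (E N) v).hasFDerivAt (x := x)
  refine this.congr_of_eventuallyEq (Eventually.of_forall fun y => ?_)
  simp [real_inner_comm]

lemma hg_comp {φ : E N → ℝ} {a : E N} (c : E N) (r : ℝ) (R : E N ≃ₗᵢ[ℝ] E N) (x : E N)
    (h : HasGradientAt φ a (c + r • R x)) :
    HasGradientAt (fun y => φ (c + r • R y)) (r • R.symm a) x := by
  rw [hasGradientAt_iff_hasFDerivAt] at *
  have h1 : HasFDerivAt (fun y : E N => c + r • R y)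
      (r • (R.toContinuousLinearEquiv : E N →L[ℝ] E N)) x :=
    ((r • (R.toContinuousLinearEquiv : E N →L[ℝ] E N)).hasFDerivAt).const_add c
  refine (HasFDerivAt.comp x h h1).congr_fderiv ?_
  ext v
  simp only [InnerProductSpace.toDual_apply_apply, ContinuousLinearMap.comp_apply, ContinuousLinearMap.coe_smul', Pi.smul_apply,
    inner_smul_left, inner_smul_right]
  have : ⟪R.symm a, v⟫ = ⟪a, R v⟫ := by
    rw [← R.inner_map_map]; simp
  simp [this]

lemma hg_comp' {φ : E N → ℝ} {a : E N} (c : E N) (r : ℝ) (x : E N)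
    (h : HasGradientAt φ a (c + r • x)) : HasGradientAt (fun y => φ (c + r • y)) (r • a) x :=
  hg_comp c r (LinearIsometryEquiv.refl ℝ _) x h

lemma hg_sq (c x : E N) : HasGradientAt (fun y : E N => ‖y - c‖ ^ 2) ((2:ℝ) • (x - c)) x := by
  rw [hasGradientAt_iff_hasFDerivAt]
  have h : HasFDerivAt (fun y : E N => ‖y - c‖ ^ 2) _ x := ((hasFDerivAt_id x).sub_const c).norm_sq
  refine h.congr_fderiv ?_
  ext v
  simp [inner_smul_left]

lemma hg_exp (A : ℝ) (c x : E N) : HasGradientAt (fun y : E N => Real.exp (-A * ‖y - c‖ ^ 2))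
    ((-2 * A * Real.exp (-A * ‖x - c‖ ^ 2)) • (x - c)) x := by
  have h := hg_smul (-A) (hg_sq c x)
  rw [hasGradientAt_iff_hasFDerivAt] at *
  refine h.exp.congr_fderiv ?_
  ext v
  simp [inner_smul_left]
  ring

lemma lap_of_grad {φ : E N → ℝ} {G : E N → E N} {A : E N →L[ℝ] E N} {x : E N}
    (hG : ∀ y, HasGradientAt φ (G y) y) (hA : HasFDerivAt G A x) :
    lap φ x = ∑ i, ⟪A (EuclideanSpace.single i 1), EuclideanSpace.single i 1⟫ := by
  have h1 : fderiv ℝ φ = fun y => InnerProductSpace.toDual ℝ (E N) (G y) := by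
    ext1 y; exact (hasGradientAt_iff_hasFDerivAt.1 (hG y)).fderiv
  unfold lap
  refine Finset.sum_congr rfl fun i _ => ?_
  rw [iteratedFDeriv_two_apply, h1]
  have h2 := ((InnerProductSpace.toDual ℝ (E N)).toContinuousLinearEquiv.toContinuousLinearMap.hasFDerivAt
    (x := G x)).comp x hA
  have h3 : fderiv ℝ (fun y => InnerProductSpace.toDual ℝ (E N) (G y)) x = _ := h2.fderiv
  rw [h3]
  simp

lemma lap_sq (c x : E N) : lap (fun y : E N => ‖y - c‖ ^ 2) x = 2 * N := by
  rw [lap_of_grad (hg_sq c) (((hasFDerivAt_id x).sub_const c).const_smul (2:ℝ))]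
  simp [inner_smul_left, mul_comm]

lemma lap_inner (v x : E N) : lap (fun y : E N => ⟪y, v⟫) x = 0 := by
  rw [lap_of_grad (hg_inner v) (hasFDerivAt_const v x)]
  simp

lemma lap_inner_sq (v x : E N) : lap (fun y : E N => ⟪y, v⟫ ^ 2) x = 2 * ‖v‖ ^ 2 := by
  have h : ∀ y : E N, HasGradientAt (fun y : E N => ⟪y, v⟫ ^ 2) ((2 * ⟪y, v⟫) • v) y := fun y => by
    have h := hg_inner v y
    rw [hasGradientAt_iff_hasFDerivAt] at *
    refine (h.pow 2).congr_fderiv ?_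
    ext w; simp [inner_smul_left]
  have h2 : HasFDerivAt (fun y : E N => (2 * ⟪y, v⟫) • v) _ x :=
    (((hasGradientAt_iff_hasFDerivAt.1 (hg_inner v x)).const_mul 2).smul_const v)
  rw [lap_of_grad h h2, EuclideanSpace.norm_sq_eq, Finset.mul_sum]
  refine Finset.sum_congr rfl fun i _ => ?_
  simp [inner_smul_left, EuclideanSpace.inner_single_right]; ring

lemma lap_exp (A : ℝ) (c x : E N) : lap (fun y : E N => Real.exp (-A * ‖y - c‖ ^ 2)) x =
    (4 * A ^ 2 * ‖x - c‖ ^ 2 - 2 * A * N) * Real.exp (-A * ‖x - c‖ ^ 2) := by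
  have h2 : HasFDerivAt (fun y : E N => (-2 * A * Real.exp (-A * ‖y - c‖ ^ 2)) • (y - c)) _ x :=
    (((hasGradientAt_iff_hasFDerivAt.1 (hg_exp A c x)).const_mul (-2 * A)).smul
      ((hasFDerivAt_id x).sub_const c))
  rw [lap_of_grad (hg_exp A c) h2]
  generalize Real.exp (-A * ‖x - c‖ ^ 2) = X
  rw [EuclideanSpace.norm_sq_eq]
  have : ((4 * A ^ 2 * ∑ i, ‖(x - c) i‖ ^ 2 - 2 * A * N) * X) =
      ∑ i : Fin N, (4 * A ^ 2 * ((x - c) i) ^ 2 - 2 * A) * X := by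
    rw [← Finset.sum_mul, Finset.sum_sub_distrib, ← Finset.mul_sum]
    simp [mul_comm]
  rw [this]
  refine Finset.sum_congr rfl fun i _ => ?_
  simp [inner_smul_left, inner_add_left, EuclideanSpace.inner_single_right]
  ring

lemma cd_sq (c : E N) : ContDiff ℝ 2 (fun y : E N => ‖y - c‖ ^ 2) :=
  (contDiff_id.sub contDiff_const).norm_sq ℝ
lemma cd_inner (v : E N) : ContDiff ℝ 2 (fun y : E N => ⟪y, v⟫) := contDiff_id.inner ℝ contDiff_const
lemma cd_exp (A : ℝ) (c : E N) : ContDiff ℝ 2 (fun y : E N => Real.exp (-A * ‖y - c‖ ^ 2)) :=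
  (contDiff_const.mul (cd_sq c)).exp

lemma lap_nonpos_of_max {φ : E N → ℝ} (h : ContDiff ℝ 2 φ) {x : E N} (hx : IsLocalMax φ x) :
    lap φ x ≤ 0 := by
  refine Finset.sum_nonpos fun i _ => ?_
  set e : E N := EuclideanSpace.single i 1
  by_contra hpos
  push Not at hpos
  let g : ℝ → ℝ := fun t => φ (x + t • e)
  have hl : ∀ t : ℝ, HasDerivAt (fun t : ℝ => x + t • e) e t := fun t => by
    simpa using ((hasDerivAt_id t).smul_const e).const_add x
  have hg : ∀ t, HasDerivAt g (fderiv ℝ φ (x + t • e) e) t := fun t =>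
    (h.differentiable (by norm_num) _).hasFDerivAt.comp_hasDerivAt t (hl t)
  have hd : deriv g = fun t => fderiv ℝ φ (x + t • e) e := funext fun t => (hg t).deriv
  have hf2 : Differentiable ℝ (fderiv ℝ φ) := (h.fderiv_right (m := 1) (by norm_num)).differentiable (by norm_num)
  have hdd : deriv (deriv g) 0 = fderiv ℝ (fderiv ℝ φ) x e e := by
    rw [hd]
    have h1 : HasDerivAt (fun t : ℝ => fderiv ℝ φ (x + t • e)) (fderiv ℝ (fderiv ℝ φ) (x + (0:ℝ) • e) e) 0 :=
      (hf2 (x + (0:ℝ) • e)).hasFDerivAt.comp_hasDerivAt (0:ℝ) (hl 0)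
    have h2 : HasDerivAt (fun t : ℝ => fderiv ℝ φ (x + t • e) e) (fderiv ℝ (fderiv ℝ φ) (x + (0:ℝ) • e) e e) 0 :=
      (ContinuousLinearMap.apply ℝ ℝ e).hasFDerivAt.comp_hasDerivAt (0:ℝ) h1
    rw [h2.deriv]; simp
  have hlm : IsLocalMax g 0 := by
    have hc : ContinuousAt (fun t : ℝ => x + t • e) 0 := (hl 0).continuousAt
    have : Tendsto (fun t : ℝ => x + t • e) (𝓝 0) (𝓝 x) := by simpa [ContinuousAt] using hc
    filter_upwards [this.eventually hx] with t ht
    simpa [g] using ht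
  rw [iteratedFDeriv_two_apply] at hpos
  have hmin := isLocalMin_of_deriv_deriv_pos (f := g) (x₀ := 0) (by rw [hdd]; simpa using hpos)
    hlm.deriv_eq_zero (hg 0).continuousAt
  have hc : g =ᶠ[𝓝 0] fun _ => g 0 := by
    filter_upwards [hlm, hmin] with t h1 h2 using le_antisymm h1 h2
  have : deriv (deriv g) 0 = 0 := by
    rw [hc.deriv.deriv_eq]; simp
  rw [hdd] at this
  simp at hpos
  linarith

/-- Classical maximum principle on a ball. -/
lemma max_princ {φ : E N → ℝ} (h : ContDiff ℝ 2 φ) {c : E N} {r m : ℝ}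
    (hl : ∀ x ∈ ball c r, 0 < lap φ x) (hb : ∀ x ∈ sphere c r, φ x ≤ m) :
    ∀ x ∈ closedBall c r, φ x ≤ m := by
  intro x hx
  obtain ⟨z, hz, hmax⟩ := (isCompact_closedBall c r).exists_isMaxOn ⟨x, hx⟩ h.continuous.continuousOn
  refine (hmax hx).trans ?_
  rcases (mem_closedBall.1 hz).lt_or_eq with h1 | h1
  · exact absurd (lap_nonpos_of_max h (hmax.isLocalMax (closedBall_mem_nhds_of_mem h1)))
      (not_le.2 (hl z h1))
  · exact hb z h1

lemma max_princ' {φ : E N → ℝ} (h : ContDiff ℝ 2 φ) {c : E N} {r m : ℝ}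
    (hl : ∀ x ∈ ball c r, 0 ≤ lap φ x) (hb : ∀ x ∈ sphere c r, φ x ≤ m) (hN : 0 < N) :
    ∀ x ∈ closedBall c r, φ x ≤ m := by
  intro x hx
  refine le_of_forall_pos_le_add fun δ hδ => ?_
  have hN' : (0:ℝ) < N := by exact_mod_cast hN
  set k := δ / (r ^ 2 + 1)
  have hk : 0 < k := by positivity
  have := max_princ (φ := fun y => φ y + k * ‖y - c‖ ^ 2) (c := c) (r := r) (m := m + δ) (h.add (contDiff_const.mul (cd_sq c)))
    (fun y hy => by
      rw [lap_add h (contDiff_const.mul (cd_sq c)), lap_smul _ (cd_sq c), lap_sq]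
      have := hl y hy
      positivity) (fun y hy => by
      rw [mem_sphere_iff_norm.1 hy]
      have h2 : k * r ^ 2 ≤ δ := by
        rw [div_mul_eq_mul_div, div_le_iff₀ (by positivity)]; nlinarith [sq_nonneg r]
      linarith [hb y hy]) x hx
  have : 0 ≤ k * ‖x - c‖ ^ 2 := by positivity
  linarith
end Lap

section Harm
variable {N : ℕ}
open MvPolynomial

lemma totalDegree_pd (i : Fin N) (p : MvPolynomial (Fin N) ℝ) {m : ℕ} (h : p.totalDegree ≤ m + 1) :
    (pderiv i p).totalDegree ≤ m := by
  rw [totalDegree, Finset.sup_le_iff]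
  intro s hs
  have h1 : s + Finsupp.single i 1 ∈ p.support := by
    rw [mem_support_iff, coeff_pderiv] at hs
    rw [mem_support_iff]
    exact fun h => hs (by simp [h])
  have h2 := (le_totalDegree h1).trans h
  rw [Finsupp.sum_add_index' (by simp) (by simp)] at h2
  simpa using h2

abbrev pev (p : MvPolynomial (Fin N) ℝ) (x : E N) : ℝ := eval x.ofLp p

lemma cd_pev (p : MvPolynomial (Fin N) ℝ) : ContDiff ℝ 2 (pev p) := by
  induction p using MvPolynomial.induction_on with
  | C a =>
    have e : pev (C a) = fun _ : E N => a := by ext; simp [pev]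
    rw [e]; exact contDiff_const
  | add p q hp hq =>
    have e : pev (p + q) = fun x : E N => pev p x + pev q x := by ext; simp [pev]
    rw [e]; exact hp.add hq
  | mul_X p i hp =>
    have : ContDiff ℝ 2 (fun x : E N => x i) := by fun_prop
    have e : pev (p * X i) = fun x : E N => pev p x * x i := by ext; simp [pev]
    rw [e]; exact hp.mul this

lemma fd_pev (p : MvPolynomial (Fin N) ℝ) (x : E N) (i : Fin N) :
    fderiv ℝ (pev p) x (EuclideanSpace.single i 1) = pev (pderiv i p) x := by
  induction p using MvPolynomial.induction_on with
  | C a =>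
    have : pev (C a) = fun _ : E N => a := by ext; simp [pev]
    rw [this]; simp [pev]
  | add p q hp hq =>
    have : pev (p + q) = pev p + pev q := by ext; simp [pev]
    rw [this, fderiv_add ((cd_pev p).differentiable (by norm_num) x) ((cd_pev q).differentiable (by norm_num) x)]
    simp [hp, hq, pev]
  | mul_X p j hp =>
    have : pev (p * X j) = pev p * (fun x : E N => x j) := by ext; simp [pev]
    have hj : HasFDerivAt (fun x : E N => x j) (EuclideanSpace.proj j : E N →L[ℝ] ℝ) x :=
      (EuclideanSpace.proj j : E N →L[ℝ] ℝ).hasFDerivAt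
    rw [this, (((cd_pev p).differentiable (by norm_num) x).hasFDerivAt.mul hj).fderiv]
    simp [hp, pev, pderiv_mul, pderiv_X, Pi.single_apply]
    split_ifs with h1 h2 h2 <;> simp_all

lemma fd2 {φ : E N → ℝ} (h : ContDiff ℝ 2 φ) (x v : E N) :
    iteratedFDeriv ℝ 2 φ x ![v, v] = fderiv ℝ (fun y => fderiv ℝ φ y v) x v := by
  rw [iteratedFDeriv_two_apply]
  have hf2 : Differentiable ℝ (fderiv ℝ φ) := (h.fderiv_right (m := 1) (by norm_num)).differentiable (by norm_num)
  have h2 : HasFDerivAt (fun y => fderiv ℝ φ y v) _ x :=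
    (ContinuousLinearMap.apply ℝ ℝ v).hasFDerivAt.comp x (hf2 x).hasFDerivAt
  rw [h2.fderiv]
  simp

def plap (p : MvPolynomial (Fin N) ℝ) : MvPolynomial (Fin N) ℝ := ∑ i, pderiv i (pderiv i p)

lemma lap_pev (p : MvPolynomial (Fin N) ℝ) (x : E N) : lap (pev p) x = pev (plap p) x := by
  simp only [lap, plap, pev, map_sum]
  refine Finset.sum_congr rfl fun i _ => ?_
  have h := fd2 (cd_pev p) x (EuclideanSpace.single i 1)
  simp only [fd_pev] at h
  exact h

def pS : MvPolynomial (Fin N) ℝ := 1 - ∑ i, X i ^ 2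

lemma pev_pS (x : E N) : pev pS x = 1 - ‖x‖ ^ 2 := by
  simp [pev, pS, EuclideanSpace.norm_sq_eq]

lemma plap_add (p q : MvPolynomial (Fin N) ℝ) : plap (p + q) = plap p + plap q := by
  simp [plap, Finset.sum_add_distrib]
lemma plap_smul (c : ℝ) (p : MvPolynomial (Fin N) ℝ) : plap (c • p) = c • plap p := by
  simp [plap, Finset.smul_sum]

lemma plap_deg (p : MvPolynomial (Fin N) ℝ) {m : ℕ} (h : p.totalDegree ≤ m + 2) :
    (plap p).totalDegree ≤ m :=
  (totalDegree_finsetSum _ _).trans (Finset.sup_le fun i _ => totalDegree_pd i _ (totalDegree_pd i _ h))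

lemma pS_deg : (pS : MvPolynomial (Fin N) ℝ).totalDegree ≤ 2 := by
  refine (totalDegree_sub _ _).trans (max_le (by simp) ?_)
  refine (totalDegree_finsetSum _ _).trans (Finset.sup_le fun i _ => ?_)
  exact (totalDegree_pow _ _).trans (by simp)

lemma harm_zero (hN : 0 < N) (q : MvPolynomial (Fin N) ℝ) (h : plap (pS * q) = 0) : q = 0 := by
  have hl : ∀ x, lap (pev (pS * q)) x = 0 := fun x => by rw [lap_pev, h]; simp [pev]
  have hs : ∀ x ∈ sphere (0 : E N) 1, pev (pS * q) x = 0 := fun x hx => by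
    have := pev_pS x
    rw [mem_sphere_zero_iff_norm.1 hx] at this
    simp only [pev] at *
    rw [map_mul, this]; simp
  have h1 := max_princ' (cd_pev (pS * q)) (fun x _ => (hl x).ge) (fun x hx => (hs x hx).le) hN
  have h2 := max_princ' (φ := fun y => (-1) * pev (pS * q) y) (contDiff_const.mul (cd_pev (pS * q)))
    (fun x _ => by rw [lap_smul _ (cd_pev _), hl]; simp) (fun x hx => (by rw [hs x hx]; simp : _ ≤ (0:ℝ))) hN
  have h3 : ∀ x ∈ ball (0 : E N) 1, pev q x = 0 := fun x hx => by
    have a := h1 x (ball_subset_closedBall hx)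
    have b := h2 x (ball_subset_closedBall hx)
    have c : pev (pS * q) x = 0 := by linarith
    have d : pev (pS * q) x = pev pS x * pev q x := by simp [pev]
    rw [d, pev_pS] at c
    have : ‖x‖ < 1 := by simpa using hx
    rcases mul_eq_zero.1 c with e | e
    · nlinarith [norm_nonneg x]
    · exact e
  have hNN : (0:ℝ) < N := by exact_mod_cast hN
  refine MvPolynomial.funext_set (fun _ : Fin N => Icc (0:ℝ) (1 / (N + 1))) (fun i => Icc_infinite (by positivity)) ?_
  intro x hx
  have := h3 (WithLp.toLp 2 x) ?_
  · simpa [pev] using this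
  · rw [mem_ball_zero_iff, ← sq_lt_one_iff₀ (norm_nonneg _), EuclideanSpace.norm_sq_eq]
    calc ∑ i, ‖x i‖ ^ 2 ≤ ∑ i : Fin N, (1 / ((N:ℝ) + 1)) ^ 2 := by
          refine Finset.sum_le_sum fun i _ => ?_
          have := hx i (mem_univ i)
          rw [Real.norm_of_nonneg this.1]
          exact pow_le_pow_left₀ this.1 this.2 2
      _ = N * (1 / ((N:ℝ) + 1)) ^ 2 := by simp
      _ < 1 := by
          rw [div_pow, one_pow, mul_one_div, div_lt_one (by positivity)]
          nlinarith

lemma harm_of_poly (hN : 0 < N) (p : MvPolynomial (Fin N) ℝ) :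
    ∃ h : MvPolynomial (Fin N) ℝ, plap h = 0 ∧ ∀ x ∈ sphere (0 : E N) 1, pev h x = pev p x := by
  set m := p.totalDegree
  let T : restrictTotalDegree (Fin N) ℝ m →ₗ[ℝ] restrictTotalDegree (Fin N) ℝ m :=
    { toFun := fun q => ⟨plap (pS * q.1), by
        rw [mem_restrictTotalDegree]
        refine plap_deg _ ((totalDegree_mul _ _).trans ?_)
        have := (mem_restrictTotalDegree _ _ _).1 q.2
        have := pS_deg (N := N)
        omega⟩
      map_add' := fun a b => by ext1; simp [mul_add, plap_add]
      map_smul' := fun a b => by ext1; simp [plap_smul] }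
  have hT : Function.Injective T := by
    rw [← LinearMap.ker_eq_bot, LinearMap.ker_eq_bot']
    intro q hq
    exact Subtype.ext (harm_zero hN q.1 (congrArg Subtype.val hq))
  obtain ⟨q, hq⟩ := (LinearMap.injective_iff_surjective.1 hT) ⟨plap p, by
    rw [mem_restrictTotalDegree]
    exact plap_deg _ (by omega)⟩
  have hq' : plap (pS * q.1) = plap p := congrArg Subtype.val hq
  refine ⟨p + (-1 : ℝ) • (pS * q.1), by rw [plap_add, plap_smul, hq']; simp, fun x hx => ?_⟩
  have := pev_pS x
  rw [mem_sphere_zero_iff_norm.1 hx] at this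
  simp only [pev] at *
  simp [this]

lemma harm_approx1 (hN : 0 < N) {g : E N → ℝ} (hg : ContinuousOn g (sphere 0 1)) {δ : ℝ} (hδ : 0 < δ) :
    ∃ h : E N → ℝ, ContDiff ℝ 2 h ∧ (∀ x, lap h x = 0) ∧ ∀ x ∈ sphere (0 : E N) 1, |h x - g x| ≤ δ := by
  let Φ : MvPolynomial (Fin N) ℝ →ₐ[ℝ] C(sphere (0 : E N) 1, ℝ) :=
    aeval (fun i => ⟨fun x => x.1 i, by fun_prop⟩)
  have hΦ : ∀ p x, Φ p x = pev p x.1 := fun p x => by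
    induction p using MvPolynomial.induction_on with
    | C a => simp [pev, Φ]
    | add p q hp hq => simp [pev, hp, hq]
    | mul_X p i hp => simp [pev, hp]; simp [Φ]
  obtain ⟨⟨f, hf⟩, hfg⟩ := ContinuousMap.exists_mem_subalgebra_near_continuous_of_separatesPoints Φ.range
    (by
      intro x y hxy
      have : ∃ i, x.1 i ≠ y.1 i := by
        by_contra hcon
        push Not at hcon
        exact hxy (Subtype.ext (by ext i; exact hcon i))
      obtain ⟨i, hi⟩ := this
      exact ⟨Φ (X i), ⟨Φ (X i), ⟨X i, rfl⟩, rfl⟩, by simpa [hΦ, pev] using hi⟩)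
    (fun x => g x.1) (continuousOn_iff_continuous_domRestrict.1 hg) δ hδ
  obtain ⟨p, rfl⟩ := hf
  obtain ⟨h, h0, hh⟩ := harm_of_poly hN p
  refine ⟨pev h, cd_pev h, fun x => by rw [lap_pev, h0]; simp [pev], fun x hx => ?_⟩
  have := hfg ⟨x, hx⟩
  rw [hh x hx, ← hΦ p ⟨x, hx⟩]
  exact this.le

lemma harm_approx (hN : 0 < N) {ρ : ℝ} (hρ : 0 < ρ) {g : E N → ℝ} (hg : ContinuousOn g (sphere 0 ρ))
    {δ : ℝ} (hδ : 0 < δ) :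
    ∃ h : E N → ℝ, ContDiff ℝ 2 h ∧ (∀ x, lap h x = 0) ∧ ∀ x ∈ sphere (0 : E N) ρ, |h x - g x| ≤ δ := by
  obtain ⟨h, h1, h2, h3⟩ := harm_approx1 hN (g := fun x => g (ρ • x)) (hg.comp (by fun_prop) (fun x hx => by
    rw [mem_sphere_zero_iff_norm] at *
    rw [norm_smul, hx, Real.norm_of_nonneg hρ.le, mul_one])) hδ
  refine ⟨fun x => h (0 + ρ⁻¹ • x), cd_comp h1 _ _, fun x => by rw [lap_comp' h1, h2]; simp, fun x hx => ?_⟩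
  rw [mem_sphere_zero_iff_norm] at hx
  have := h3 (ρ⁻¹ • x) (by rw [mem_sphere_zero_iff_norm, norm_smul, hx, norm_inv, Real.norm_of_nonneg hρ.le, inv_mul_cancel₀ hρ.ne'])
  simpa [smul_smul, hρ.ne'] using this
end Harm

section IL
variable {N : ℕ}

/-- `a` is a (viscosity) solution of `lap a ≥ -1` on `S`. -/
def SubV (a : E N → ℝ) (S : Set (E N)) : Prop :=
  ∀ φ : E N → ℝ, ContDiff ℝ 2 φ → ∀ x ∈ S, TouchesAbove a φ x → -1 ≤ lap φ x

lemma subV_le {A : E N → ℝ} {ρ δ : ℝ} (hN : 0 < N) (hρ : 0 < ρ) (hδ : 0 < δ)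
    (hc : ContinuousOn A (closedBall 0 ρ)) (hA : SubV A (ball 0 ρ)) :
    ∃ h : E N → ℝ, ContDiff ℝ 2 h ∧ (∀ x, lap h x = 0) ∧ (∀ x ∈ sphere (0 : E N) ρ, h x ≤ A x + δ) ∧
      ∀ x ∈ closedBall (0 : E N) ρ, A x ≤ h x + δ + (1 / N) * (ρ ^ 2 - ‖x‖ ^ 2) := by
  obtain ⟨h, h1, h2, h3⟩ := harm_approx hN hρ (hc.mono sphere_subset_closedBall) hδ
  refine ⟨h, h1, h2, fun x hx => by have := abs_le.1 (h3 x hx); linarith, fun x hx => ?_⟩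
  have hN' : (0:ℝ) < N := by exact_mod_cast hN
  set T : E N → ℝ := fun y => (h y + (δ + (1 / N) * ρ ^ 2)) + (-(1 / N)) * ‖y - 0‖ ^ 2 with hT
  have hT2 : ContDiff ℝ 2 T := (h1.add contDiff_const).add (contDiff_const.mul (cd_sq 0))
  have hTl : ∀ y, lap T y = -2 := fun y => by
    rw [hT, lap_add (h1.add contDiff_const) (contDiff_const.mul (cd_sq 0)), lap_add h1 contDiff_const,
      lap_smul _ (cd_sq 0), lap_sq, lap_const, h2]
    field_simp; ring
  suffices A x ≤ T x by simp only [hT, sub_zero] at this; linarith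
  obtain ⟨z, hz, hmax⟩ := (isCompact_closedBall (0 : E N) ρ).exists_isMaxOn ⟨x, hx⟩
    (hc.sub hT2.continuous.continuousOn)
  have hxz : A x - T x ≤ A z - T z := hmax hx
  rcases (mem_closedBall.1 hz).lt_or_eq with h5 | h5
  · exfalso
    have := hA (fun y => T y + (A z - T z)) (hT2.add contDiff_const) z h5 ⟨by ring, by
      filter_upwards [closedBall_mem_nhds_of_mem h5] with y hy
      have : A y - T y ≤ A z - T z := hmax hy
      linarith⟩
    rw [lap_add hT2 contDiff_const, hTl, lap_const] at this
    linarith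
  · have h6 := abs_le.1 (h3 z h5)
    have h7 : ‖z‖ = ρ := by simpa using h5
    have : A z ≤ T z := by
      simp only [hT, sub_zero, h7]; nlinarith
    linarith

lemma sums_lemma {A B P : E N → ℝ} {ρ : ℝ} (hN : 0 < N) (hρ : 0 < ρ)
    (hAc : ContinuousOn A (closedBall 0 ρ)) (hA : SubV A (ball 0 ρ))
    (hBc : ContinuousOn B (closedBall 0 ρ)) (hB : SubV B (ball 0 ρ))
    (hP : ContDiff ℝ 2 P) (hPl : ∀ x, lap P x ≤ -5)
    (hmax : ∀ x ∈ closedBall (0 : E N) ρ, A x + B x - P x ≤ A 0 + B 0 - P 0) : False := by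
  have hN' : (0:ℝ) < N := by exact_mod_cast hN
  have hδ : 0 < ρ ^ 2 / (32 * N) := by positivity
  obtain ⟨h, h1, h2, h3, h4⟩ := subV_le hN hρ hδ hAc hA
  obtain ⟨k, k1, k2, k3, k4⟩ := subV_le hN hρ hδ hBc hB
  set δ := ρ ^ 2 / (32 * N) with hδe
  have hk : ContDiff ℝ 2 (fun y => h y + k y) := h1.add k1
  have hP' : ContDiff ℝ 2 (fun y => (-1) * P y) := contDiff_const.mul hP
  have hs : ContDiff ℝ 2 (fun y : E N => (-(9 / (4 * N) : ℝ)) * ‖y - 0‖ ^ 2) := contDiff_const.mul (cd_sq 0)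
  have key := max_princ (φ := fun y => ((h y + k y) + (-1) * P y) + (-(9 / (4 * N) : ℝ)) * ‖y - 0‖ ^ 2)
    (c := 0) (r := ρ) (m := A 0 + B 0 - P 0 + 2 * δ - 9 / (4 * N) * ρ ^ 2)
    ((hk.add hP').add hs) (fun x _ => by
      rw [lap_add (hk.add hP') hs, lap_add hk hP', lap_add h1 k1, lap_smul _ hP, lap_smul _ (cd_sq 0), h2, k2, lap_sq]
      have := hPl x
      have e : -(9 / (4 * N) : ℝ) * (2 * N) = -(9/2) := by field_simp; ring
      rw [e]; linarith) (fun x hx => by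
      have a := h3 x hx
      have b := k3 x hx
      have c := hmax x (sphere_subset_closedBall hx)
      rw [sub_zero, mem_sphere_zero_iff_norm.1 hx]
      linarith) 0 (mem_closedBall_self hρ.le)
  have a := h4 0 (mem_closedBall_self hρ.le)
  have b := k4 0 (mem_closedBall_self hρ.le)
  simp only [sub_self, norm_zero] at key a b
  have e1 : ρ ^ 2 = 32 * N * δ := by rw [hδe]; field_simp
  rw [e1] at key a b
  have e2 : 9 / (4 * (N:ℝ)) * (32 * N * δ) = 72 * δ := by field_simp; ring
  have e3 : (1 / (N:ℝ)) * (32 * N * δ - 0 ^ 2) = 32 * δ := by field_simp; ring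
  rw [e2] at key
  rw [e3] at a b
  have : 0 < δ := hδ
  linarith

lemma subV_comp {a : E N → ℝ} {S T : Set (E N)} (h : SubV a S) (c : E N) (R : E N ≃ₗᵢ[ℝ] E N)
    (hT : ∀ ξ ∈ T, c + R ξ ∈ S) : SubV (fun ξ => a (c + R ξ)) T := by
  intro φ hφ ξ hξ ht
  have e : ∀ y, -R.symm c + (1:ℝ) • R.symm y = R.symm (y - c) := fun y => by
    rw [one_smul, map_sub]; abel
  have e0 : R.symm (c + R ξ - c) = ξ := by simp
  have hcd : ContDiff ℝ 2 (fun y => φ (-R.symm c + (1:ℝ) • R.symm y)) := by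
    have : ContDiff ℝ 2 (fun y => -R.symm c + (1:ℝ) • R.symm y) :=
      contDiff_const.add (R.symm.contDiff.const_smul (1:ℝ))
    exact hφ.comp this
  have := h _ hcd (c + R ξ) (hT ξ hξ) ⟨by
    beta_reduce; rw [e, e0]; exact ht.1, by
    have hc : Tendsto (fun y => R.symm (y - c)) (𝓝 (c + R ξ)) (𝓝 ξ) := by
      have : ContinuousAt (fun y => R.symm (y - c)) (c + R ξ) := by fun_prop
      unfold ContinuousAt at this
      beta_reduce at this
      rwa [e0] at this
    filter_upwards [hc.eventually ht.2] with y hy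
    rw [e]; simpa using hy⟩
  rw [lap_comp hφ, e, e0] at this
  simpa using this

lemma exists_refl (e : E N) (he : ‖e‖ = 1) :
    ∃ R : E N ≃ₗᵢ[ℝ] E N, ∀ ξ, R ξ = ξ - (2 * ⟪ξ, e⟫) • e := by
  refine ⟨(ℝ ∙ e)ᗮ.reflection, fun ξ => ?_⟩
  rw [Submodule.reflection_orthogonal_apply, Submodule.reflection_singleton_apply]
  simp [he, real_inner_comm, mul_smul, two_smul]

lemma supconv_sub {c x0 : E N} {w a p : E N → ℝ} {l M G : ℝ} (hl : 0 < l) (hM : 0 < M) (hG : 2 * M < G)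
    (hlG : l * G ≤ 1 / 16)
    (ha : ∀ x, ∀ z ∈ closedBall c 1, w z - ‖x - z‖ ^ 2 / (2 * l) ≤ a x)
    (ha' : ∀ x, ∃ z ∈ closedBall c 1, a x = w z - ‖x - z‖ ^ 2 / (2 * l))
    (hac : ∀ x ∈ closedBall c 1, ∀ y ∈ closedBall c 1, |a x - a y| ≤ 2 / l * ‖x - y‖)
    (hw : ∀ φ : E N → ℝ, ContDiff ℝ 2 φ → ∀ x ∈ ball c 1, ‖gradient φ x‖ ≤ G →
      TouchesAbove w φ x → -1 ≤ lap φ x)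
    (hp : ∀ x ∈ closedBall c 1, ∀ y ∈ closedBall c 1, p x - p y ≤ M * ‖x - y‖)
    (hx0 : ‖x0 - c‖ < 15 / 16) (hmax : ∀ x ∈ closedBall c 1, a x - p x ≤ a x0 - p x0) :
    ∃ ρ > 0, ball x0 ρ ⊆ closedBall c 1 ∧ SubV a (ball x0 ρ) := by
  have hG0 : 0 < G := by linarith
  set D := (4 + 2 * l * M) with hD
  have hD0 : 0 < D := by positivity
  set s := min (15 / 16 - ‖x0 - c‖) ((G - 2 * M) * l * (G * l) / D) with hs
  have hs0 : 0 < s := lt_min (by linarith) (by have : 0 < G - 2 * M := by linarith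
                                               positivity)
  have hs1 : s ≤ 15 / 16 - ‖x0 - c‖ := min_le_left _ _
  have hs2 : D * s ≤ (G - 2 * M) * l * (G * l) := by
    have := min_le_right (15 / 16 - ‖x0 - c‖) ((G - 2 * M) * l * (G * l) / D)
    rw [← hs, le_div_iff₀ hD0] at this; linarith
  have hx0K : x0 ∈ closedBall c 1 := by rw [mem_closedBall_iff_norm]; linarith
  have hb : ∀ x, ‖x - x0‖ < s → ‖x - c‖ < 15 / 16 := fun x hx => by
    have := norm_add_le (x - x0) (x0 - c)
    rw [sub_add_sub_cancel] at this; linarith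
  have hbK : ∀ x, ‖x - x0‖ < s → x ∈ closedBall c 1 := fun x hx => by
    rw [mem_closedBall_iff_norm]; have := hb x hx; linarith
  refine ⟨s, hs0, fun x hx => hbK x (mem_ball_iff_norm.1 hx), ?_⟩
  intro φ hφ x hx ht
  rw [mem_ball_iff_norm] at hx
  obtain ⟨z, hz, hzx⟩ := ha' x
  have hzb : ‖x - z‖ ≤ l * G := by
    by_contra hcon
    push Not at hcon
    have h1 := hmax z hz
    have h2 := ha z z hz
    rw [sub_self, norm_zero] at h2
    have h3 := (abs_le.1 (hac x (hbK x hx) x0 hx0K)).1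
    have h4 := hp z hz x0 hx0K
    have h5 : ‖z - x0‖ ≤ ‖x - z‖ + ‖x - x0‖ := by
      rw [norm_sub_rev x z]; simpa using norm_add_le (z - x) (x - x0)
    have h6 : M * ‖z - x0‖ ≤ M * (‖x - z‖ + s) := mul_le_mul_of_nonneg_left (by linarith) hM.le
    have h7 : 2 / l * ‖x - x0‖ ≤ 2 / l * s := mul_le_mul_of_nonneg_left hx.le (by positivity)
    have h8 : ‖x - z‖ ^ 2 / (2 * l) ≤ 2 / l * s + M * (‖x - z‖ + s) := by
      have : (0:ℝ) ^ 2 / (2 * l) = 0 := by simp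
      linarith
    rw [div_le_iff₀ (by positivity)] at h8
    have h9 : (2 / l * s + M * (‖x - z‖ + s)) * (2 * l) = D * s + 2 * l * M * ‖x - z‖ := by
      rw [hD]; field_simp; ring
    rw [h9] at h8
    have h10 : (l * G) * ‖x - z‖ < ‖x - z‖ ^ 2 := by
      rw [sq]; exact mul_lt_mul_of_pos_right hcon (lt_of_le_of_lt (by positivity) hcon)
    have h11 : (G - 2 * M) * l * (G * l) ≤ (G - 2 * M) * l * ‖x - z‖ :=
      mul_le_mul_of_nonneg_left (by linarith) (by have : 0 < G - 2 * M := by linarith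
                                                  positivity)
    nlinarith
  have hzc : z ∈ ball c 1 := by
    rw [mem_ball_iff_norm]
    have h1 := norm_add_le (z - x) (x - c)
    rw [sub_add_sub_cancel, norm_sub_rev z x] at h1
    have := hb x hx
    linarith
  -- gradient
  have hgr : ‖gradient φ x‖ ≤ G := by
    have h1 : IsLocalMin (fun y => φ y + (1 / (2 * l)) * ‖y - z‖ ^ 2) x := by
      filter_upwards [ht.2] with y hy
      have := ha y z hz
      have h2 := ht.1
      rw [← h2, hzx]
      have e : ∀ t : ℝ, 1 / (2 * l) * t = t / (2 * l) := fun t => by ring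
      rw [e, e]; linarith
    have h2 := hg_add (hasGrad hφ x) (hg_smul (1 / (2 * l)) (hg_sq z x))
    have h3 := h1.hasFDerivAt_eq_zero (hasGradientAt_iff_hasFDerivAt.1 h2)
    rw [LinearIsometryEquiv.map_eq_zero_iff] at h3
    have h4 : gradient φ x = -((1 / l) • (x - z)) := by
      rw [eq_neg_iff_add_eq_zero, ← h3, smul_smul]; congr 2; field_simp
    rw [h4, norm_neg, norm_smul, Real.norm_of_nonneg (by positivity), one_div, inv_mul_le_iff₀ hl]
    exact hzb
  have e : ∀ y, (x - z) + (1:ℝ) • y = y - (z - x) := fun y => by rw [one_smul]; abel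
  have e0 : z - (z - x) = x := by abel
  have hg2 : gradient (fun y => φ ((x - z) + (1:ℝ) • y) + ‖x - z‖ ^ 2 / (2 * l)) z = gradient φ x := by
    have h1 := hg_add (hg_comp' (φ := φ) (a := gradient φ x) (x - z) 1 z (by rw [e, e0]; exact hasGrad hφ x))
      (hg_const (‖x - z‖ ^ 2 / (2 * l)) z)
    rw [h1.gradient]; simp
  have := hw (fun y => φ ((x - z) + (1:ℝ) • y) + ‖x - z‖ ^ 2 / (2 * l)) ((cd_comp hφ _ _).add contDiff_const)
    z hzc (by rw [hg2]; exact hgr) ⟨by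
      beta_reduce; rw [e, e0, ← ht.1, hzx]; ring, by
      have hc : Tendsto (fun y => y - (z - x)) (𝓝 z) (𝓝 x) := by
        have : ContinuousAt (fun y => y - (z - x)) z := by fun_prop
        unfold ContinuousAt at this
        beta_reduce at this
        rwa [e0] at this
      filter_upwards [hc.eventually ht.2, isOpen_ball.mem_nhds hzc] with y hy hy2
      have := ha (y - (z - x)) y (ball_subset_closedBall hy2)
      rw [e]
      have e3 : y - (z - x) - y = x - z := by abel
      rw [e3] at this
      linarith⟩
  rw [lap_add (cd_comp hφ _ _) contDiff_const, lap_comp' hφ, lap_const, e, e0] at this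
  linarith
end IL

section IL2
variable {N : ℕ}

lemma sqdiff {x y z c : E N} (hx : x ∈ closedBall c 1) (hy : y ∈ closedBall c 1) (hz : z ∈ closedBall c 1) :
    ‖x - z‖ ^ 2 - ‖y - z‖ ^ 2 ≤ 4 * ‖x - y‖ := by
  rw [mem_closedBall_iff_norm] at *
  have h1 : ‖x - z‖ ≤ 2 := by
    have := norm_sub_le (x - c) (z - c); rw [sub_sub_sub_cancel_right] at this; linarith
  have h2 : ‖y - z‖ ≤ 2 := by
    have := norm_sub_le (y - c) (z - c); rw [sub_sub_sub_cancel_right] at this; linarith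
  have h3 : ‖x - z‖ ≤ ‖x - y‖ + ‖y - z‖ := norm_sub_le_norm_sub_add_norm_sub x y z
  nlinarith [norm_nonneg (x - z), norm_nonneg (y - z), norm_nonneg (x - y)]

lemma exists_supconv {c : E N} {w : E N → ℝ} (hw : ContinuousOn w (closedBall c 1)) {l : ℝ} (hl : 0 < l) :
    ∃ a : E N → ℝ, (∀ x, ∀ z ∈ closedBall c 1, w z - ‖x - z‖ ^ 2 / (2 * l) ≤ a x) ∧
    (∀ x, ∃ z ∈ closedBall c 1, a x = w z - ‖x - z‖ ^ 2 / (2 * l)) ∧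
    (∀ x ∈ closedBall c 1, ∀ y ∈ closedBall c 1, |a x - a y| ≤ 2 / l * ‖x - y‖) := by
  have : ∀ x, ∃ z ∈ closedBall c 1, ∀ z' ∈ closedBall c 1,
      w z' - ‖x - z'‖ ^ 2 / (2 * l) ≤ w z - ‖x - z‖ ^ 2 / (2 * l) := fun x => by
    obtain ⟨z, hz, h⟩ := (isCompact_closedBall c 1).exists_isMaxOn ⟨c, mem_closedBall_self zero_le_one⟩
      (hw.sub (f := w) (g := fun z => ‖x - z‖ ^ 2 / (2 * l)) (by fun_prop))
    exact ⟨z, hz, fun z' hz' => h hz'⟩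
  choose Z hZ hZ2 using this
  have key : ∀ x ∈ closedBall c 1, ∀ y ∈ closedBall c 1,
      (w (Z x) - ‖x - Z x‖ ^ 2 / (2 * l)) - (w (Z y) - ‖y - Z y‖ ^ 2 / (2 * l)) ≤ 2 / l * ‖x - y‖ := by
    intro x hx y hy
    have h1 := hZ2 y (Z x) (hZ x)
    have h2 := sqdiff hy hx (hZ x)
    have h3 : (‖y - Z x‖ ^ 2 - ‖x - Z x‖ ^ 2) / (2 * l) ≤ 4 * ‖y - x‖ / (2 * l) := by gcongr
    rw [norm_sub_rev y x] at h3
    have e : 4 * ‖x - y‖ / (2 * l) = 2 / l * ‖x - y‖ := by field_simp; ring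
    rw [e, sub_div] at h3
    linarith
  refine ⟨fun x => w (Z x) - ‖x - Z x‖ ^ 2 / (2 * l), fun x z hz => hZ2 x z hz, fun x => ⟨Z x, hZ x, rfl⟩, ?_⟩
  intro x hx y hy
  rw [abs_le]
  have h1 := key x hx y hy
  have h2 := key y hy x hx
  rw [norm_sub_rev y x] at h2
  constructor <;> simp only <;> linarith

lemma om_lip {r s d : ℝ} (hr : 0 ≤ r) (hs : 0 ≤ s) (hr2 : r ≤ 2) (hs2 : s ≤ 2) (hd : r - s ≤ d) (hd0 : 0 ≤ d) :
    (r - r ^ 2 / 8) - (s - s ^ 2 / 8) ≤ d := by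
  have e : (r - r ^ 2 / 8) - (s - s ^ 2 / 8) = (r - s) * (1 - (r + s) / 8) := by ring
  rw [e]
  rcases le_total s r with h | h <;> nlinarith

set_option maxHeartbeats 2000000 in
lemma IL_one (hN : 0 < N) {L : ℝ} (hL : L = 64 * N + 100) {c : E N} {w : E N → ℝ}
    (hwc : ContinuousOn w (closedBall c 1)) (hw1 : ∀ x ∈ closedBall c 1, |w x| ≤ 1)
    (hwa : ∀ φ : E N → ℝ, ContDiff ℝ 2 φ → ∀ x ∈ ball c 1, ‖gradient φ x‖ ≤ 4 * L →
      TouchesAbove w φ x → -1 ≤ lap φ x)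
    (hwb : ∀ φ : E N → ℝ, ContDiff ℝ 2 φ → ∀ x ∈ ball c 1, ‖gradient φ x‖ ≤ 4 * L →
      TouchesAbove (fun y => - w y) φ x → -1 ≤ lap φ x)
    {x0 y0 : E N} (hx0 : x0 ∈ closedBall c (1/2)) (hy0 : y0 ∈ closedBall c 1) :
    w x0 - w y0 ≤ L * ‖x0 - y0‖ := by
  have hN' : (1:ℝ) ≤ N := by exact_mod_cast hN
  have hL0 : 164 ≤ L := by rw [hL]; linarith
  by_contra hcon
  push Not at hcon
  set m := w x0 - w y0 - L * (‖x0 - y0‖ - ‖x0 - y0‖ ^ 2 / 8) with hm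
  have hm0 : 0 < m := by
    have : 0 ≤ L * (‖x0 - y0‖ ^ 2 / 8) := by positivity
    rw [hm]; linarith
  have hK := isCompact_closedBall c (1:ℝ)
  have hx0K : x0 ∈ closedBall c 1 := closedBall_subset_closedBall (by norm_num) hx0
  obtain ⟨η, hη, huc⟩ := Metric.uniformContinuousOn_iff.1 (hK.uniformContinuousOn_of_continuous hwc) (m / 4) (by positivity)
  set l := min (η ^ 2 / 8) (1 / (16 * (4 * L))) with hl
  have hl0 : 0 < l := lt_min (by positivity) (by positivity)
  have hl1 : l ≤ η ^ 2 / 8 := min_le_left _ _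
  have hl2 : l * (4 * L) ≤ 1 / 16 := by
    have : l ≤ 1 / (16 * (4 * L)) := min_le_right _ _
    rw [le_div_iff₀ (by positivity)] at this
    linarith
  obtain ⟨a, a1, a2, a3⟩ := exists_supconv hwc hl0
  obtain ⟨b, b1, b2, b3⟩ := exists_supconv hwc.neg hl0
  have cont : ∀ {f : E N → ℝ}, (∀ x ∈ closedBall c 1, ∀ y ∈ closedBall c 1, |f x - f y| ≤ 2 / l * ‖x - y‖) →
      ContinuousOn f (closedBall c 1) := fun {f} h => by
    refine LipschitzOnWith.continuousOn (K := ⟨2 / l, by positivity⟩) (LipschitzOnWith.of_dist_le_mul fun x hx y hy => ?_)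
    rw [Real.dist_eq, dist_eq_norm]; exact h x hx y hy
  have hac := cont a3
  have hbc := cont b3
  have ha1 : ∀ x ∈ closedBall c 1, a x ≤ 1 := fun x _ => by
    obtain ⟨z, hz, h⟩ := a2 x
    have := (abs_le.1 (hw1 z hz)).2
    have h3 : 0 ≤ ‖x - z‖ ^ 2 / (2 * l) := by positivity
    linarith
  have hb1 : ∀ x ∈ closedBall c 1, b x ≤ 1 := fun x _ => by
    obtain ⟨z, hz, h⟩ := b2 x
    have := (abs_le.1 (hw1 z hz)).1
    have h3 : 0 ≤ ‖x - z‖ ^ 2 / (2 * l) := by positivity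
    simp only [Pi.neg_apply] at h
    linarith
  have haw : w x0 ≤ a x0 := by simpa using a1 x0 x0 hx0K
  have hbw : - w y0 ≤ b y0 := by simpa using b1 y0 y0 hy0
  -- maximise
  let pen : E N × E N → ℝ := fun q => L * (‖q.1 - q.2‖ - ‖q.1 - q.2‖ ^ 2 / 8) + 32 * ‖q.1 - x0‖ ^ 2
  obtain ⟨⟨X, Y⟩, hXY, hmax⟩ := (hK.prod hK).exists_isMaxOn ⟨(x0, y0), hx0K, hy0⟩
    (f := fun q : E N × E N => a q.1 + b q.2 - pen q)
    (((hac.comp continuousOn_fst fun q hq => hq.1).add (hbc.comp continuousOn_snd fun q hq => hq.2)).sub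
      (by simp only [pen]; fun_prop))
  obtain ⟨hX, hY⟩ : X ∈ closedBall c 1 ∧ Y ∈ closedBall c 1 := hXY
  have hmax' : ∀ x ∈ closedBall c 1, ∀ y ∈ closedBall c 1,
      a x + b y - (L * (‖x - y‖ - ‖x - y‖ ^ 2 / 8) + 32 * ‖x - x0‖ ^ 2) ≤
      a X + b Y - (L * (‖X - Y‖ - ‖X - Y‖ ^ 2 / 8) + 32 * ‖X - x0‖ ^ 2) := fun x hx y hy => hmax (mk_mem_prod hx hy)
  have h2 : ∀ x ∈ closedBall c 1, ∀ y ∈ closedBall c 1, ‖x - y‖ ≤ 2 := fun x hx y hy => by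
    rw [mem_closedBall_iff_norm] at *
    have := norm_sub_le (x - c) (y - c); rw [sub_sub_sub_cancel_right] at this; linarith
  set r := ‖X - Y‖ with hr
  have hr2 : r ≤ 2 := h2 X hX Y hY
  have hr0 : 0 ≤ r := norm_nonneg _
  have hval := hmax' x0 hx0K y0 hy0
  rw [sub_self, norm_zero] at hval
  have hval' : m ≤ a X + b Y - (L * (r - r ^ 2 / 8) + 32 * ‖X - x0‖ ^ 2) := by linarith
  have hom : 3 / 4 * r ≤ r - r ^ 2 / 8 := by
    have : r ^ 2 ≤ 2 * r := by rw [sq]; exact mul_le_mul_of_nonneg_right hr2 hr0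
    linarith
  have hom' : L * (3 / 4 * r) ≤ L * (r - r ^ 2 / 8) := mul_le_mul_of_nonneg_left hom (by linarith)
  have haX := ha1 X hX
  have hbY := hb1 Y hY
  have hXx0 : ‖X - x0‖ < 1 / 4 := by
    have : 0 ≤ L * (3 / 4 * r) := by positivity
    exact lt_of_pow_lt_pow_left₀ 2 (by norm_num) (by norm_num; linarith)
  have hrs : r < 1 / 16 := by
    have : 164 * (3 / 4 * r) ≤ L * (3 / 4 * r) := mul_le_mul_of_nonneg_right hL0 (by positivity)
    have := sq_nonneg ‖X - x0‖
    linarith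
  have hXc : ‖X - c‖ < 3 / 4 := by
    have := norm_add_le (X - x0) (x0 - c)
    rw [sub_add_sub_cancel] at this
    have := mem_closedBall_iff_norm.1 hx0
    linarith
  have hYc : ‖Y - c‖ < 15 / 16 := by
    have := norm_add_le (Y - X) (X - c)
    rw [sub_add_sub_cancel, norm_sub_rev Y X] at this
    linarith
  have hrpos : 0 < r := by
    rcases hr0.lt_or_eq with h | h
    · exact h
    exfalso
    have hXY' : X = Y := by rw [← sub_eq_zero, ← norm_eq_zero, ← hr, ← h]
    obtain ⟨z, hz, hz1⟩ := a2 X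
    obtain ⟨z', hz', hz1'⟩ := b2 X
    have hq : ∀ z : E N, ‖X - z‖ ^ 2 / (2 * l) ≤ 2 → dist z X < η := fun z hz => by
      rw [div_le_iff₀ (by positivity)] at hz
      rw [dist_eq_norm, norm_sub_rev]
      have : 0 < η ^ 2 := by positivity
      exact lt_of_pow_lt_pow_left₀ 2 hη.le (by linarith)
    have k1 := a1 X X hX
    have k2 := b1 X X hX
    have k3 := abs_le.1 (hw1 X hX)
    have k4 := abs_le.1 (hw1 z hz)
    have k5 := abs_le.1 (hw1 z' hz')
    simp only [Pi.neg_apply, sub_self, norm_zero] at *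
    have e0 : (0:ℝ) ^ 2 / (2 * l) = 0 := by simp
    rw [e0] at k1 k2
    have k6 := huc z hz X hX (hq z (by linarith))
    have k7 := huc z' hz' X hX (hq z' (by linarith))
    rw [Real.dist_eq, abs_lt] at k6 k7
    have k8 : 0 ≤ ‖X - z‖ ^ 2 / (2 * l) := by positivity
    have k9 : 0 ≤ ‖X - z'‖ ^ 2 / (2 * l) := by positivity
    rw [← hXY', ← h] at hval'
    have k10 := sq_nonneg ‖X - x0‖
    have k11 : L * ((0:ℝ) - 0 ^ 2 / 8) = 0 := by ring
    linarith
  set e := (1 / r) • (X - Y) with he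
  have hen : ‖e‖ = 1 := by
    rw [he, norm_smul, ← hr, Real.norm_of_nonneg (by positivity)]; field_simp
  have hre : X - Y = r • e := by rw [he, smul_smul]; field_simp; simp
  obtain ⟨R, hR⟩ := exists_refl e hen
  obtain ⟨ρ1, hρ1, hs1, hA⟩ := supconv_sub (x0 := X) (p := fun x => L * (‖x - Y‖ - ‖x - Y‖ ^ 2 / 8) + 32 * ‖x - x0‖ ^ 2)
    (M := L + 128) (G := 4 * L) hl0 (by linarith) (by linarith) hl2 a1 a2 a3 hwa
    (fun x hx y hy => by
      have h1 := sqdiff hx hy hx0K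
      have h3 := om_lip (norm_nonneg (x - Y)) (norm_nonneg (y - Y)) (h2 x hx Y hY) (h2 y hy Y hY)
        (d := ‖x - y‖) (by have := norm_sub_le_norm_sub_add_norm_sub x y Y; linarith) (norm_nonneg _)
      have := mul_le_mul_of_nonneg_left h3 (by linarith : 0 ≤ L)
      linarith)
    (by linarith)
    (fun x hx => by have := hmax' x hx Y hY; simp only [← hr]; linarith)
  obtain ⟨ρ2, hρ2, hs2, hB⟩ := supconv_sub (x0 := Y) (p := fun y => L * (‖X - y‖ - ‖X - y‖ ^ 2 / 8))
    (M := L + 128) (G := 4 * L) hl0 (by linarith) (by linarith) hl2 b1 b2 b3 hwb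
    (fun x hx y hy => by
      have h3 := om_lip (norm_nonneg (X - x)) (norm_nonneg (X - y)) (h2 X hX x hx) (h2 X hX y hy)
        (d := ‖x - y‖) (by have := norm_sub_le_norm_sub_add_norm_sub X y x; rw [norm_sub_rev y x] at this; linarith) (norm_nonneg _)
      have := mul_le_mul_of_nonneg_left h3 (by linarith : 0 ≤ L)
      have := norm_nonneg (x - y)
      linarith)
    (by linarith)
    (fun x hx => by have := hmax' X hX x hx; simp only [← hr]; linarith)
  set ρ := min (min ρ1 ρ2) r / 4 with hρ
  have hρ0 : 0 < ρ := by positivity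
  have hρr : ρ ≤ r / 4 := by rw [hρ]; gcongr; exact min_le_right _ _
  have hρr1 : ρ < ρ1 := by
    have : ρ ≤ ρ1 / 4 := by rw [hρ]; gcongr; exact (min_le_left _ _).trans (min_le_left _ _)
    linarith
  have hρr2 : ρ < ρ2 := by
    have : ρ ≤ ρ2 / 4 := by rw [hρ]; gcongr; exact (min_le_left _ _).trans (min_le_right _ _)
    linarith
  have mX : ∀ ξ ∈ closedBall (0 : E N) ρ, X + ξ ∈ ball X ρ1 := fun ξ hξ => by
    rw [mem_closedBall_zero_iff] at hξ; simpa using lt_of_le_of_lt hξ hρr1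
  have mY : ∀ ξ ∈ closedBall (0 : E N) ρ, Y + R ξ ∈ ball Y ρ2 := fun ξ hξ => by
    rw [mem_closedBall_zero_iff] at hξ; simpa using lt_of_le_of_lt hξ hρr2
  set P : E N → ℝ := fun ξ => (L * (r - r ^ 2 / 8) + ((L * (2 - r / 2)) * ⟪ξ, e⟫ + (-(L / 2)) * ⟪ξ, e⟫ ^ 2)) +
    32 * ‖ξ - (x0 - X)‖ ^ 2 with hP
  have c1 : ContDiff ℝ 2 (fun ξ : E N => ⟪ξ, e⟫ ^ 2) := (cd_inner e).pow 2
  have c2 : ContDiff ℝ 2 (fun ξ : E N => (L * (2 - r / 2)) * ⟪ξ, e⟫) := contDiff_const.mul (cd_inner e)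
  have c3 : ContDiff ℝ 2 (fun ξ : E N => (-(L / 2)) * ⟪ξ, e⟫ ^ 2) := contDiff_const.mul c1
  have c4 : ContDiff ℝ 2 (fun ξ : E N => (L * (2 - r / 2)) * ⟪ξ, e⟫ + (-(L / 2)) * ⟪ξ, e⟫ ^ 2) := c2.add c3
  have c5 : ContDiff ℝ 2 (fun ξ : E N => L * (r - r ^ 2 / 8) + ((L * (2 - r / 2)) * ⟪ξ, e⟫ + (-(L / 2)) * ⟪ξ, e⟫ ^ 2)) :=
    contDiff_const.add c4
  have c6 : ContDiff ℝ 2 (fun ξ : E N => 32 * ‖ξ - (x0 - X)‖ ^ 2) := contDiff_const.mul (cd_sq _)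
  refine sums_lemma (A := fun ξ => a (X + ξ)) (B := fun ξ => b (Y + R ξ)) (P := P) (ρ := ρ) hN hρ0
    (hac.comp (by fun_prop) fun ξ hξ => hs1 (mX ξ hξ))
    (subV_comp hA X (LinearIsometryEquiv.refl ℝ _) fun ξ hξ => mX ξ (ball_subset_closedBall hξ))
    (hbc.comp (by fun_prop) fun ξ hξ => hs2 (mY ξ hξ))
    (subV_comp hB Y R fun ξ hξ => mY ξ (ball_subset_closedBall hξ))
    (c5.add c6) (fun ξ => ?_) (fun ξ hξ => ?_)
  · rw [hP, lap_add c5 c6, lap_add contDiff_const c4, lap_add c2 c3, lap_smul _ (cd_inner e), lap_smul _ c1,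
      lap_smul _ (cd_sq _), lap_sq, lap_inner, lap_inner_sq, lap_const, hen, hL]
    linarith
  · have k := hmax' (X + ξ) (hs1 (mX ξ hξ)) (Y + R ξ) (hs2 (mY ξ hξ))
    have hin : |⟪ξ, e⟫| ≤ ρ := by
      have := abs_real_inner_le_norm ξ e
      rw [hen, mul_one] at this
      exact this.trans (mem_closedBall_zero_iff.1 hξ)
    have e1 : ‖X + ξ - (Y + R ξ)‖ = r + 2 * ⟪ξ, e⟫ := by
      have : X + ξ - (Y + R ξ) = (r + 2 * ⟪ξ, e⟫) • e := by
        rw [hR, add_smul, ← hre]; abel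
      rw [this, norm_smul, hen, mul_one, Real.norm_of_nonneg]
      have := (abs_le.1 hin).1
      linarith
    rw [e1] at k
    have e2 : ‖X + ξ - x0‖ = ‖ξ - (x0 - X)‖ := by congr 1; abel
    have e3 : ‖X - x0‖ = ‖0 - (x0 - X)‖ := by congr 1; abel
    rw [e2, e3] at k
    simp only [hP, add_zero, map_zero, inner_zero_left]
    linarith

/-- Interior Lipschitz estimate. -/
lemma IL (hN : 0 < N) {L : ℝ} (hL : L = 64 * N + 100) {c : E N} {w : E N → ℝ}
    (hwc : ContinuousOn w (closedBall c 1)) (hw1 : ∀ x ∈ closedBall c 1, |w x| ≤ 1)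
    (hwa : ∀ φ : E N → ℝ, ContDiff ℝ 2 φ → ∀ x ∈ ball c 1, ‖gradient φ x‖ ≤ 4 * L →
      (TouchesAbove w φ x → -1 ≤ lap φ x) ∧ (TouchesBelow w φ x → lap φ x ≤ 1))
    {x0 y0 : E N} (hx0 : x0 ∈ closedBall c (1/2)) (hy0 : y0 ∈ closedBall c 1) :
    |w x0 - w y0| ≤ L * ‖x0 - y0‖ := by
  have h1 : ∀ φ : E N → ℝ, ContDiff ℝ 2 φ → ∀ x ∈ ball c 1, ‖gradient φ x‖ ≤ 4 * L →
      TouchesAbove w φ x → -1 ≤ lap φ x := fun φ hφ x hx hg => (hwa φ hφ x hx hg).1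
  have h2 : ∀ φ : E N → ℝ, ContDiff ℝ 2 φ → ∀ x ∈ ball c 1, ‖gradient φ x‖ ≤ 4 * L →
      TouchesAbove (fun y => - w y) φ x → -1 ≤ lap φ x := fun φ hφ x hx hg ht => by
    have g := (hg_smul (-1) (hasGrad hφ x)).gradient
    have := (hwa (fun y => (-1) * φ y) (contDiff_const.mul hφ) x hx (by rw [g, norm_smul]; simpa using hg)).2
      ⟨by have := ht.1; linarith, by filter_upwards [ht.2] with y hy; linarith⟩
    rw [lap_smul _ hφ] at this; linarith
  have a := IL_one hN hL hwc hw1 h1 h2 hx0 hy0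
  have b := IL_one (w := fun y => - w y) hN hL hwc.neg (fun x hx => by rw [abs_neg]; exact hw1 x hx) h2
    (by simpa using h1) hx0 hy0
  rw [abs_le]; constructor <;> linarith
end IL2

section HE
variable {N : ℕ}

lemma lap_mono_touch {g φ : E N → ℝ} (hg : ContDiff ℝ 2 g) (hφ : ContDiff ℝ 2 φ) {x : E N} (h : TouchesAbove g φ x) :
    lap g x ≤ lap φ x := by
  have h1 : ContDiff ℝ 2 (fun y => (-1) * φ y) := contDiff_const.mul hφ
  have := lap_nonpos_of_max (hg.add h1) (x := x) (by
    filter_upwards [h.2] with y hy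
    have := h.1
    linarith)
  have e : lap (fun y => g y + (-1) * φ y) x = lap g x + (-1) * lap φ x := by
    rw [lap_add hg h1, lap_smul _ hφ]
  rw [e] at this
  linarith

lemma harm_lip (hN : 0 < N) {L : ℝ} (hL : L = 64 * N + 100) {c : E N} {g : E N → ℝ}
    (hg : ContDiff ℝ 2 g) (hl : ∀ x, lap g x = 0) (hb : ∀ x ∈ closedBall c 1, |g x| ≤ 1)
    {y : E N} (hy : y ∈ closedBall c 1) : |g y - g c| ≤ L * ‖y - c‖ := by
  rw [abs_sub_comm, norm_sub_rev]
  refine IL hN hL hg.continuous.continuousOn hb (fun φ hφ x hx _ => ⟨fun ht => ?_, fun ht => ?_⟩)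
    (mem_closedBall_self (by norm_num)) hy
  · have := lap_mono_touch hg hφ ht
    rw [hl] at this; linarith
  · have := lap_mono_touch hφ hg ⟨ht.1.symm, ht.2⟩
    rw [hl] at this; linarith

lemma HE (hN : 0 < N) {L : ℝ} (hL : L = 64 * N + 100) {h : E N → ℝ}
    (hh : ContDiff ℝ 2 h) (hl : ∀ x, lap h x = 0) (hb : ∀ x ∈ closedBall (0 : E N) 4, |h x| ≤ 1) :
    ‖gradient h 0‖ ≤ L ∧ ∀ x ∈ closedBall (0 : E N) 1, |h x - h 0 - ⟪gradient h 0, x⟫| ≤ L ^ 2 * ‖x‖ ^ 2 := by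
  have hL0 : 0 < L := by rw [hL]; positivity
  have s1 : ∀ c ∈ closedBall (0 : E N) 3, ∀ y ∈ closedBall c 1, |h y - h c| ≤ L * ‖y - c‖ := by
    intro c hc y hy
    refine harm_lip hN hL hh hl (fun x hx => hb x ?_) hy
    rw [mem_closedBall_zero_iff] at *
    rw [mem_closedBall_iff_norm] at hx
    have := norm_add_le (x - c) c
    rw [sub_add_cancel] at this; linarith
  have hder : ∀ x v : E N, Tendsto (fun t : ℝ => t⁻¹ * (h (x + t • v) - h x)) (𝓝[>] 0) (𝓝 ⟪gradient h x, v⟫) := by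
    intro x v
    have h1 := (hasGradientAt_iff_hasFDerivAt.1 (hasGrad hh x)).hasLineDerivAt v
    have h2 := h1.tendsto_slope_zero_right
    simpa using h2
  have s2 : ∀ x ∈ closedBall (0 : E N) 1, ∀ v : E N, ‖v‖ = 1 → |⟪gradient h x, v⟫ - ⟪gradient h 0, v⟫| ≤ L ^ 2 * ‖x‖ := by
    intro x hx v hv
    refine le_of_tendsto ((hder x v).sub (hder 0 v)).abs ?_
    filter_upwards [Ioc_mem_nhdsGT (zero_lt_one' ℝ)] with t ht
    have c1 : ContDiff ℝ 2 (fun y => h (t • v + (1:ℝ) • y)) := cd_comp hh _ _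
    have c2 : ContDiff ℝ 2 (fun y => (-1) * h y) := contDiff_const.mul hh
    have key := harm_lip hN hL (c := 0) (g := fun y => (t * L)⁻¹ * (h (t • v + (1:ℝ) • y) + (-1) * h y))
      (contDiff_const.mul (c1.add c2)) (fun y => by
        rw [lap_smul _ (c1.add c2), lap_add c1 c2, lap_comp' hh, lap_smul _ hh, hl, hl]; simp)
      (fun y hy => by
        have := s1 y (closedBall_subset_closedBall (by norm_num) hy) (y + t • v) (by
          rw [mem_closedBall_iff_norm, add_sub_cancel_left, norm_smul, hv, Real.norm_of_nonneg ht.1.le]; linarith [ht.2])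
        rw [add_sub_cancel_left, norm_smul, hv, Real.norm_of_nonneg ht.1.le, mul_one] at this
        rw [abs_mul, abs_of_pos (inv_pos.2 (mul_pos ht.1 hL0)), inv_mul_le_iff₀ (mul_pos ht.1 hL0), one_smul, add_comm (t • v),
          neg_one_mul, ← sub_eq_add_neg]
        linarith) hx
    simp only [one_smul, sub_zero, neg_one_mul, ← sub_eq_add_neg, ← mul_sub, add_zero] at key
    rw [abs_mul, abs_of_pos (inv_pos.2 (mul_pos ht.1 hL0)), inv_mul_le_iff₀ (mul_pos ht.1 hL0)] at key
    rw [← mul_sub, abs_mul, abs_of_pos (inv_pos.2 ht.1), inv_mul_le_iff₀ ht.1, add_comm x, zero_add]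
    calc _ ≤ _ := key
      _ = _ := by ring
  have s3 : ∀ x ∈ closedBall (0 : E N) 1, ‖gradient h x - gradient h 0‖ ≤ L ^ 2 * ‖x‖ := by
    intro x hx
    by_cases h0 : gradient h x - gradient h 0 = 0
    · rw [h0, norm_zero]; positivity
    have hn : 0 < ‖gradient h x - gradient h 0‖ := norm_pos_iff.2 h0
    set d := gradient h x - gradient h 0 with hd
    have := s2 x hx (‖d‖⁻¹ • d) (by rw [norm_smul, norm_inv, norm_norm, inv_mul_cancel₀ hn.ne'])
    rw [← inner_sub_left, ← hd, inner_smul_right, real_inner_self_eq_norm_sq] at this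
    refine le_trans (le_of_eq ?_) ((le_abs_self _).trans this)
    field_simp
  refine ⟨?_, fun x hx => ?_⟩
  · by_cases h0 : gradient h 0 = 0
    · rw [h0, norm_zero]; positivity
    have hn : 0 < ‖gradient h 0‖ := norm_pos_iff.2 h0
    set d := gradient h 0 with hd
    have hv : ‖(‖d‖⁻¹ • d)‖ = 1 := by rw [norm_smul, norm_inv, norm_norm, inv_mul_cancel₀ hn.ne']
    have h1 : |⟪gradient h 0, ‖d‖⁻¹ • d⟫| ≤ L := by
      refine le_of_tendsto (hder 0 (‖d‖⁻¹ • d)).abs ?_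
      filter_upwards [Ioc_mem_nhdsGT (zero_lt_one' ℝ)] with t ht
      have := s1 0 (by simp) (0 + t • ‖d‖⁻¹ • d) (by
          rw [mem_closedBall_iff_norm, add_sub_cancel_left, norm_smul, hv, Real.norm_of_nonneg ht.1.le]; linarith [ht.2])
      rw [add_sub_cancel_left, norm_smul, hv, Real.norm_of_nonneg ht.1.le] at this
      rw [abs_mul, abs_of_pos (inv_pos.2 ht.1), inv_mul_le_iff₀ ht.1]
      linarith
    rw [← hd, inner_smul_right, real_inner_self_eq_norm_sq] at h1
    refine le_trans (le_of_eq ?_) ((le_abs_self _).trans h1)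
    field_simp
  · have h1 : ∀ y, HasGradientAt (fun y => h y + (-1) * ⟪y, gradient h 0⟫) (gradient h y + (-1:ℝ) • gradient h 0) y :=
      fun y => hg_add (hasGrad hh y) (hg_smul (-1) (hg_inner _ y))
    have h2 := (convex_closedBall (0 : E N) ‖x‖).norm_image_sub_le_of_norm_hasFDerivWithin_le (C := L ^ 2 * ‖x‖)
      (fun y _ => (hasGradientAt_iff_hasFDerivAt.1 (h1 y)).hasFDerivWithinAt) (fun y hy => by
        rw [LinearIsometryEquiv.norm_map, neg_one_smul, ← sub_eq_add_neg]
        rw [mem_closedBall_zero_iff] at hx hy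
        refine (s3 y (by rw [mem_closedBall_zero_iff]; linarith)).trans ?_
        gcongr) (mem_closedBall_self (norm_nonneg x)) (by simp : x ∈ closedBall (0 : E N) ‖x‖)
    rw [Real.norm_eq_abs, inner_zero_left, sub_zero, real_inner_comm] at h2
    calc _ = _ := by congr 1; ring
      _ ≤ _ := h2
      _ = _ := by ring
end HE

section WSsec
variable {N : ℕ}

def Fpt (u : E N → ℝ) (x : E N) : Prop := u x = 0 ∧ ∃ᶠ y in 𝓝 x, 0 < u y

structure WS (μ κ lo hi : ℝ) (x0 : E N) (r : ℝ) (u : E N → ℝ) : Prop where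
  cont : ContinuousOn u (ball x0 r)
  nn : ∀ x ∈ ball x0 r, 0 ≤ u x
  below : ∀ φ : E N → ℝ, ContDiff ℝ 2 φ → ∀ x ∈ ball x0 r, 0 < u x → TouchesBelow u φ x →
    ‖gradient φ x‖ ^ μ * lap φ x ≤ κ
  above : ∀ φ : E N → ℝ, ContDiff ℝ 2 φ → ∀ x ∈ ball x0 r, 0 < u x → TouchesAbove u φ x →
    -κ ≤ ‖gradient φ x‖ ^ μ * lap φ x
  fbelow : ∀ φ : E N → ℝ, ContDiff ℝ 2 φ → ∀ x ∈ ball x0 r, Fpt u x → gradient φ x ≠ 0 →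
    TouchesBelow u (fun y => max (φ y) 0) x → ‖gradient φ x‖ ≤ hi
  fabove : ∀ φ : E N → ℝ, ContDiff ℝ 2 φ → ∀ x ∈ ball x0 r, Fpt u x → gradient φ x ≠ 0 →
    TouchesAbove u (fun y => max (φ y) 0) x → lo ≤ ‖gradient φ x‖

def Flat (ν : E N) (a b : ℝ) (x0 : E N) (r : ℝ) (u : E N → ℝ) : Prop :=
  ∀ x ∈ ball x0 r, max (⟪x, ν⟫ + a) 0 ≤ u x ∧ u x ≤ max (⟪x, ν⟫ + b) 0

lemma WS.mono {μ κ lo hi κ' lo' hi' : ℝ} {x0 x1 : E N} {r r' : ℝ} {u : E N → ℝ} (h : WS μ κ lo hi x0 r u)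
    (hb : ball x1 r' ⊆ ball x0 r) (h1 : κ ≤ κ') (h2 : lo' ≤ lo) (h3 : hi ≤ hi') : WS μ κ' lo' hi' x1 r' u where
  cont := h.cont.mono hb
  nn := fun x hx => h.nn x (hb hx)
  below := fun φ hφ x hx hu ht => (h.below φ hφ x (hb hx) hu ht).trans h1
  above := fun φ hφ x hx hu ht => (neg_le_neg h1).trans (h.above φ hφ x (hb hx) hu ht)
  fbelow := fun φ hφ x hx hu hg ht => (h.fbelow φ hφ x (hb hx) hu hg ht).trans h3
  fabove := fun φ hφ x hx hu hg ht => h2.trans (h.fabove φ hφ x (hb hx) hu hg ht)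

lemma grad_add_const {v : E N → ℝ} (hv : ContDiff ℝ 2 v) (M : ℝ) (z : E N) :
    gradient (fun y => v y + M) z = gradient v z := by
  rw [(hg_add (hasGrad hv z) (hg_const M z)).gradient, add_zero]

lemma lap_add_const {v : E N → ℝ} (hv : ContDiff ℝ 2 v) (M : ℝ) (z : E N) :
    lap (fun y => v y + M) z = lap v z := by
  rw [lap_add hv contDiff_const, lap_const, add_zero]

lemma cmp_below {μ κ lo hi : ℝ} {x0 : E N} {r : ℝ} {u v : E N → ℝ} (h : WS μ κ lo hi x0 r u) (hκ : 0 ≤ κ)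
    (hhi : 0 ≤ hi) {K : Set (E N)} (hK : IsCompact K) (hKb : K ⊆ ball x0 r) (hv : ContDiff ℝ 2 v)
    (h1 : ∀ x ∈ interior K, κ < ‖gradient v x‖ ^ μ * lap v x)
    (h2 : ∀ x ∈ interior K, Fpt u x → hi < ‖gradient v x‖)
    (h3 : ∀ x ∈ K, x ∉ interior K → v x ≤ u x) : ∀ x ∈ K, v x ≤ u x := by
  intro x hx
  obtain ⟨z, hz, hmax⟩ := hK.exists_isMaxOn ⟨x, hx⟩ (hv.continuous.continuousOn.sub (h.cont.mono hKb))
  have hxz : v x - u x ≤ v z - u z := hmax hx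
  by_cases hzi : z ∈ interior K
  swap
  · have := h3 z hz hzi; linarith
  by_contra hcon
  push Not at hcon
  have hM : 0 < v z - u z := by linarith
  have hKn : K ∈ 𝓝 z := mem_interior_iff_mem_nhds.1 hzi
  have hev : ∀ᶠ y in 𝓝 z, v y + (-(v z - u z)) ≤ u y := by
    filter_upwards [hKn] with y hy
    have : v y - u y ≤ v z - u z := hmax hy
    linarith
  have hφ : ContDiff ℝ 2 (fun y => v y + (-(v z - u z))) := hv.add contDiff_const
  have hzb := hKb hz
  rcases (h.nn z hzb).lt_or_eq with hp | hp
  · have := h.below _ hφ z hzb hp ⟨by ring, hev⟩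
    rw [grad_add_const hv, lap_add_const hv] at this
    linarith [h1 z hzi]
  · by_cases hF : ∃ᶠ y in 𝓝 z, 0 < u y
    · have hF' : Fpt u z := ⟨hp.symm, hF⟩
      have k := h2 z hzi hF'
      have := h.fbelow _ hφ z hzb hF' (by rw [grad_add_const hv]; intro h0; rw [h0, norm_zero] at k; linarith)
        ⟨by rw [← hp]; simp, by
          filter_upwards [hev, mem_of_superset hKn hKb] with y hy hy2
          exact max_le hy (h.nn y hy2)⟩
      rw [grad_add_const hv] at this
      linarith
    · rw [not_frequently] at hF
      have hlm : IsLocalMax v z := by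
        filter_upwards [hF, hev] with y hy hy2
        linarith
      have k1 := lap_nonpos_of_max hv hlm
      have k2 := h1 z hzi
      have : ‖gradient v z‖ ^ μ * lap v z ≤ 0 := mul_nonpos_of_nonneg_of_nonpos (Real.rpow_nonneg (norm_nonneg _) _) k1
      linarith

lemma cmp_above {μ κ lo hi : ℝ} {x0 : E N} {r : ℝ} {u v : E N → ℝ} (h : WS μ κ lo hi x0 r u)
    {K : Set (E N)} (hK : IsCompact K) (hKb : K ⊆ ball x0 r) (hv : ContDiff ℝ 2 v)
    (h1 : ∀ x ∈ interior K, 0 < u x → ‖gradient v x‖ ^ μ * lap v x < -κ)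
    (h2 : ∀ x ∈ interior K, Fpt u x → gradient v x ≠ 0 ∧ ‖gradient v x‖ < lo)
    (h3 : ∀ x ∈ K, x ∉ interior K → (0 < u x ∨ Fpt u x) → u x ≤ v x) :
    ∀ x ∈ K, 0 < u x → u x ≤ v x := by
  intro x hx hux
  set K' := closure {y ∈ K | 0 < u y} with hK'
  have hK's : K' ⊆ K := closure_minimal (fun y hy => hy.1) hK.isClosed
  have hK'c : IsCompact K' := hK.of_isClosed_subset isClosed_closure hK's
  have hxK' : x ∈ K' := subset_closure ⟨hx, hux⟩
  obtain ⟨z, hz, hmax⟩ := hK'c.exists_isMaxOn ⟨x, hxK'⟩ (((h.cont.mono hKb).mono hK's).sub hv.continuous.continuousOn)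
  have hxz : u x - v x ≤ u z - v z := hmax hxK'
  have hzK := hK's hz
  have hzb := hKb hzK
  have hzF : 0 < u z ∨ Fpt u z := by
    rcases (h.nn z hzb).lt_or_eq with hp | hp
    · exact Or.inl hp
    · right
      refine ⟨hp.symm, ?_⟩
      rw [hK', mem_closure_iff_frequently] at hz
      exact hz.mono fun y hy => hy.2
  by_cases hzi : z ∈ interior K
  swap
  · have := h3 z hzK hzi hzF; linarith
  by_contra hcon
  push Not at hcon
  have hM : 0 < u z - v z := by linarith
  have hKn : K ∈ 𝓝 z := mem_interior_iff_mem_nhds.1 hzi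
  have hev : ∀ᶠ y in 𝓝 z, 0 < u y → u y ≤ v y + (u z - v z) := by
    filter_upwards [hKn] with y hy hy2
    have : u y - v y ≤ u z - v z := hmax (subset_closure ⟨hy, hy2⟩)
    linarith
  have hφ : ContDiff ℝ 2 (fun y => v y + (u z - v z)) := hv.add contDiff_const
  rcases hzF with hp | hF
  · have hpos : ∀ᶠ y in 𝓝 z, 0 < u y :=
      (h.cont.continuousAt (isOpen_ball.mem_nhds hzb)).eventually_const_lt hp
    have := h.above _ hφ z hzb hp ⟨by ring, by filter_upwards [hev, hpos] with y a b using a b⟩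
    rw [grad_add_const hv, lap_add_const hv] at this
    linarith [h1 z hzi hp]
  · obtain ⟨k1, k2⟩ := h2 z hzi hF
    have := h.fabove _ hφ z hzb hF (by rwa [grad_add_const hv])
        ⟨by simp [hF.1], by
          filter_upwards [hev, mem_of_superset hKn hKb] with y hy hy2
          rcases (h.nn y hy2).lt_or_eq with hp | hp
          · exact (hy hp).trans (le_max_left _ _)
          · rw [← hp]; exact le_max_right _ _⟩
    rw [grad_add_const hv] at this
    linarith

lemma Fpt_comp {u : E N → ℝ} {x1 : E N} {s k : ℝ} (hs : 0 < s) (hk : 0 < k) (y : E N) :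
    Fpt (fun y => u (x1 + s • y) / k) y ↔ Fpt u (x1 + s • y) := by
  unfold Fpt
  have e : Filter.map (fun y => x1 + s • y) (𝓝 y) = 𝓝 (x1 + s • y) := by
    have := ((Homeomorph.smulOfNeZero s hs.ne').trans (Homeomorph.addLeft x1)).map_nhds_eq y
    exact this
  rw [← e, frequently_map]
  simp [hk.ne', hk]

lemma WS.scale {μ κ lo hi : ℝ} {x0 x1 : E N} {r r' s q : ℝ} {u : E N → ℝ} (h : WS μ κ lo hi x0 r' u)
    (hs : 0 < s) (hq : 0 < q) (hb : ∀ y ∈ ball (0 : E N) r, x1 + s • y ∈ ball x0 r') :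
    WS μ (κ * s / q ^ (μ + 1)) (lo / q) (hi / q) 0 r (fun y => u (x1 + s • y) / (q * s)) := by
  have hqs : 0 < q * s := mul_pos hq hs
  have hqm : 0 < q ^ (μ + 1) := Real.rpow_pos_of_pos hq _
  have e : ∀ y, -(s⁻¹ • x1) + s⁻¹ • (x1 + s • y) = y := fun y => by
    rw [smul_add, smul_smul, inv_mul_cancel₀ hs.ne', one_smul]; abel
  have ts : ∀ y, Tendsto (fun x => -(s⁻¹ • x1) + s⁻¹ • x) (𝓝 (x1 + s • y)) (𝓝 y) := fun y => by
    have : ContinuousAt (fun x => -(s⁻¹ • x1) + s⁻¹ • x) (x1 + s • y) := by fun_prop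
    unfold ContinuousAt at this
    beta_reduce at this
    rwa [e] at this
  have e' : ∀ x, x1 + s • (-(s⁻¹ • x1) + s⁻¹ • x) = x := fun x => by
    rw [smul_add, smul_neg, smul_smul, smul_smul, mul_inv_cancel₀ hs.ne', one_smul, one_smul]; abel
  -- test function
  have T2 : ∀ {φ : E N → ℝ}, ContDiff ℝ 2 φ → ContDiff ℝ 2 (fun x => (q * s) * φ (-(s⁻¹ • x1) + s⁻¹ • x)) :=
    fun hφ => contDiff_const.mul (cd_comp hφ _ _)
  have Tg : ∀ {φ : E N → ℝ}, ContDiff ℝ 2 φ → ∀ y,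
      gradient (fun x => (q * s) * φ (-(s⁻¹ • x1) + s⁻¹ • x)) (x1 + s • y) = q • gradient φ y := fun {φ} hφ y => by
    rw [(hg_smul (q * s) (hg_comp' (φ := φ) (a := gradient φ y) (-(s⁻¹ • x1)) s⁻¹ (x1 + s • y)
      (by rw [e]; exact hasGrad hφ y))).gradient, smul_smul]
    congr 1; field_simp
  have Tl : ∀ {φ : E N → ℝ}, ContDiff ℝ 2 φ → ∀ y,
      lap (fun x => (q * s) * φ (-(s⁻¹ • x1) + s⁻¹ • x)) (x1 + s • y) = q / s * lap φ y := fun {φ} hφ y => by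
    rw [lap_smul _ (cd_comp hφ _ _), lap_comp' hφ, e]; field_simp
  have Te : ∀ {φ : E N → ℝ}, ContDiff ℝ 2 φ → ∀ y,
      ‖q • gradient φ y‖ ^ μ * (q / s * lap φ y) = q ^ (μ + 1) / s * (‖gradient φ y‖ ^ μ * lap φ y) := fun {φ} hφ y => by
    rw [norm_smul, Real.norm_of_nonneg hq.le, Real.mul_rpow hq.le (norm_nonneg _), Real.rpow_add hq, Real.rpow_one]; ring
  constructor
  · exact (h.cont.comp (by fun_prop) hb).div_const _
  · exact fun y hy => div_nonneg (h.nn _ (hb y hy)) hqs.le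
  · intro φ hφ y hy hu ht
    have hu' : 0 < u (x1 + s • y) := by
      have := mul_pos hu hqs; rwa [div_mul_cancel₀ _ hqs.ne'] at this
    have := h.below _ (T2 hφ) _ (hb y hy) hu' ⟨by
      beta_reduce; rw [e, ← ht.1]; field_simp, by
      filter_upwards [(ts y).eventually ht.2] with x hx
      rw [e', le_div_iff₀ hqs] at hx; linarith⟩
    rw [Tg hφ, Tl hφ, Te hφ] at this
    rw [le_div_iff₀ hqm]
    rw [div_mul_eq_mul_div, div_le_iff₀ hs] at this
    linarith
  · intro φ hφ y hy hu ht
    have hu' : 0 < u (x1 + s • y) := by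
      have := mul_pos hu hqs; rwa [div_mul_cancel₀ _ hqs.ne'] at this
    have := h.above _ (T2 hφ) _ (hb y hy) hu' ⟨by
      beta_reduce; rw [e, ← ht.1]; field_simp, by
      filter_upwards [(ts y).eventually ht.2] with x hx
      rw [e', div_le_iff₀ hqs] at hx; linarith⟩
    rw [Tg hφ, Tl hφ, Te hφ] at this
    rw [← neg_div, div_le_iff₀ hqm]
    rw [div_mul_eq_mul_div, le_div_iff₀ hs] at this
    linarith
  · intro φ hφ y hy hu hg ht
    have := h.fbelow _ (T2 hφ) _ (hb y hy) ((Fpt_comp hs hqs y).1 hu) (by rw [Tg hφ]; exact smul_ne_zero hq.ne' hg) ⟨by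
      have ht1 : u (x1 + s • y) / (q * s) = max (φ y) 0 := ht.1
      beta_reduce; rw [e, ← mul_zero (q * s), ← mul_max_of_nonneg _ _ hqs.le, ← ht1]; field_simp, by
      filter_upwards [(ts y).eventually ht.2] with x hx
      rw [e', le_div_iff₀ hqs] at hx
      rw [← mul_zero (q * s), ← mul_max_of_nonneg _ _ hqs.le]
      linarith⟩
    rw [Tg hφ, norm_smul, Real.norm_of_nonneg hq.le] at this
    rw [le_div_iff₀ hq]; linarith
  · intro φ hφ y hy hu hg ht
    have := h.fabove _ (T2 hφ) _ (hb y hy) ((Fpt_comp hs hqs y).1 hu) (by rw [Tg hφ]; exact smul_ne_zero hq.ne' hg) ⟨by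
      have ht1 : u (x1 + s • y) / (q * s) = max (φ y) 0 := ht.1
      beta_reduce; rw [e, ← mul_zero (q * s), ← mul_max_of_nonneg _ _ hqs.le, ← ht1]; field_simp, by
      filter_upwards [(ts y).eventually ht.2] with x hx
      rw [e', div_le_iff₀ hqs] at hx
      rw [← mul_zero (q * s), ← mul_max_of_nonneg _ _ hqs.le]
      linarith⟩
    rw [Tg hφ, norm_smul, Real.norm_of_nonneg hq.le] at this
    rw [div_le_iff₀ hq]; linarith

/-- flatness at free boundary points -/
lemma Flat.fpt {ν : E N} {a b : ℝ} {x0 : E N} {r : ℝ} {u : E N → ℝ} (h : Flat ν a b x0 r u) {x : E N}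
    (hx : x ∈ ball x0 r) (hF : Fpt u x) : ⟪x, ν⟫ + a ≤ 0 ∧ 0 ≤ ⟪x, ν⟫ + b := by
  refine ⟨?_, ?_⟩
  · have := (h x hx).1; rw [hF.1] at this; exact (le_max_left _ _).trans this
  · by_contra hcon
    push Not at hcon
    have hc : ContinuousAt (fun y : E N => ⟪y, ν⟫ + b) x := by
      have : Continuous (fun y : E N => ⟪y, ν⟫ + b) := (cd_inner ν).continuous.add continuous_const
      exact this.continuousAt
    obtain ⟨y, hy, h1, h2⟩ := (hF.2.and_eventually ((hc.eventually_lt_const hcon).and (isOpen_ball.mem_nhds hx))).exists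
    have := (h y h2).2
    rw [max_eq_right h1.le] at this
    linarith

lemma Flat.pos {ν : E N} {a b : ℝ} {x0 : E N} {r : ℝ} {u : E N → ℝ} (h : Flat ν a b x0 r u) {x : E N}
    (hx : x ∈ ball x0 r) (hp : 0 < u x) : u x ≤ ⟪x, ν⟫ + b := by
  rcases le_max_iff.1 ((h x hx).2) with h1 | h1
  · exact h1
  · linarith

lemma Flat.lo {ν : E N} {a b : ℝ} {x0 : E N} {r : ℝ} {u : E N → ℝ} (h : Flat ν a b x0 r u) {x : E N}
    (hx : x ∈ ball x0 r) : ⟪x, ν⟫ + a ≤ u x := (le_max_left _ _).trans (h x hx).1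
end WSsec

section PHsec
variable {N : ℕ}

lemma bump_data (ν c : E N) (k t A : ℝ) :
    ContDiff ℝ 2 (fun y : E N => (⟪y, ν⟫ + k) + t * Real.exp (-A * ‖y - c‖ ^ 2)) ∧
    (∀ x, gradient (fun y : E N => (⟪y, ν⟫ + k) + t * Real.exp (-A * ‖y - c‖ ^ 2)) x =
      ν - (2 * t * A * Real.exp (-A * ‖x - c‖ ^ 2)) • (x - c)) ∧
    ∀ x, lap (fun y : E N => (⟪y, ν⟫ + k) + t * Real.exp (-A * ‖y - c‖ ^ 2)) x =
      t * ((4 * A ^ 2 * ‖x - c‖ ^ 2 - 2 * A * N) * Real.exp (-A * ‖x - c‖ ^ 2)) := by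
  have c1 : ContDiff ℝ 2 (fun y : E N => ⟪y, ν⟫ + k) := (cd_inner ν).add contDiff_const
  have c2 : ContDiff ℝ 2 (fun y : E N => t * Real.exp (-A * ‖y - c‖ ^ 2)) := contDiff_const.mul (cd_exp A c)
  refine ⟨c1.add c2, fun x => ?_, fun x => ?_⟩
  · rw [(hg_add (hg_add (hg_inner ν x) (hg_const k x)) (hg_smul t (hg_exp A c x))).gradient]
    module
  · rw [lap_add c1 c2, lap_add (cd_inner ν) contDiff_const, lap_inner, lap_const, lap_smul t (cd_exp A c), lap_exp]
    ring

lemma PH_IL (hN : 0 < N) {μ : ℝ} (hμ : 0 ≤ μ) {L : ℝ} (hL : L = 64 * N + 100) {κ lo hi a ε r : ℝ} {ν c x0 : E N}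
    {u : E N → ℝ} (h : WS μ κ lo hi x0 r u) (hν : ‖ν‖ = 1) (hc : closedBall c 1 ⊆ ball x0 r)
    (hε : 0 < ε) (hκ : κ ≤ ε ^ 2) (h1 : ε ≤ 1 / (8 * L)) (h2 : ε ≤ (1 / 2) ^ μ)
    (hp : ∀ x ∈ closedBall c 1, 0 < u x) (hf : ∀ x ∈ closedBall c 1, ⟪x, ν⟫ + a ≤ u x ∧ u x ≤ ⟪x, ν⟫ + a + ε)
    {x y : E N} (hx : x ∈ closedBall c (1/2)) (hy : y ∈ closedBall c 1) :
    |(u x - ⟪x, ν⟫ - a) / ε - (u y - ⟪y, ν⟫ - a) / ε| ≤ L * ‖x - y‖ := by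
  have hL0 : 0 < L := by rw [hL]; positivity
  have hinn : Continuous (fun y : E N => ⟪y, ν⟫) := (cd_inner ν).continuous
  refine IL hN hL (w := fun x => (u x - ⟪x, ν⟫ - a) / ε) ?_ ?_ ?_ hx hy
  · exact (((h.cont.mono hc).sub hinn.continuousOn).sub continuousOn_const).div_const ε
  · intro x hx
    obtain ⟨k1, k2⟩ := hf x hx
    rw [abs_le]
    constructor
    · rw [le_div_iff₀ hε]; linarith
    · rw [div_le_one hε]; linarith
  · intro φ hφ z hz hg
    have hz' := ball_subset_closedBall hz
    have c1 : ContDiff ℝ 2 (fun y : E N => ⟪y, ν⟫ + a) := (cd_inner ν).add contDiff_const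
    have c2 : ContDiff ℝ 2 (fun y : E N => (⟪y, ν⟫ + a) + ε * φ y) := c1.add (contDiff_const.mul hφ)
    have g : gradient (fun y : E N => (⟪y, ν⟫ + a) + ε * φ y) z = ν + ε • gradient φ z := by
      rw [(hg_add (hg_add (hg_inner ν z) (hg_const a z)) (hg_smul ε (hasGrad hφ z))).gradient, add_zero]
    have l : lap (fun y : E N => (⟪y, ν⟫ + a) + ε * φ y) z = ε * lap φ z := by
      rw [lap_add c1 (contDiff_const.mul hφ), lap_add (cd_inner ν) contDiff_const, lap_inner, lap_const, lap_smul ε hφ]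
      ring
    have hg2 : (1:ℝ) / 2 ≤ ‖ν + ε • gradient φ z‖ := by
      have k1 : ‖ν‖ ≤ ‖ν + ε • gradient φ z‖ + ‖ε • gradient φ z‖ := by
        have := norm_sub_le (ν + ε • gradient φ z) (ε • gradient φ z)
        rwa [add_sub_cancel_right] at this
      rw [norm_smul, Real.norm_of_nonneg hε.le, hν] at k1
      have k2 : ε * ‖gradient φ z‖ ≤ 1 / (8 * L) * (4 * L) := by gcongr
      have k3 : 1 / (8 * L) * (4 * L) = 1 / 2 := by field_simp; norm_num
      linarith
    have hm : (1 / 2 : ℝ) ^ μ ≤ ‖ν + ε • gradient φ z‖ ^ μ := Real.rpow_le_rpow (by norm_num) hg2 hμ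
    set m := ‖ν + ε • gradient φ z‖ ^ μ
    have hmε : ε ≤ m := h2.trans hm
    refine ⟨fun ht => ?_, fun ht => ?_⟩
    · have := h.above _ c2 z (hc hz') (hp z hz') ⟨by
        have h0 : (u z - ⟪z, ν⟫ - a) / ε = φ z := ht.1
        rw [div_eq_iff hε.ne'] at h0; linarith, by
        filter_upwards [ht.2] with y hy
        rw [div_le_iff₀ hε] at hy; linarith⟩
      rw [g, l] at this
      by_contra hcon
      push Not at hcon
      have : m * (ε * lap φ z) < m * (ε * (-1)) := by
        have : 0 < m := by linarith
        gcongr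
      have : ε * ε ≤ m * ε := by gcongr
      nlinarith
    · have := h.below _ c2 z (hc hz') (hp z hz') ⟨by
        have h0 : (u z - ⟪z, ν⟫ - a) / ε = φ z := ht.1
        rw [div_eq_iff hε.ne'] at h0; linarith, by
        filter_upwards [ht.2] with y hy
        rw [le_div_iff₀ hε] at hy; linarith⟩
      rw [g, l] at this
      by_contra hcon
      push Not at hcon
      have : m * (ε * 1) < m * (ε * lap φ z) := by
        have : 0 < m := by linarith
        gcongr
      have : ε * ε ≤ m * ε := by gcongr
      nlinarith

lemma interior_annulus (c : E N) (r R : ℝ) {x : E N} (h : x ∈ closedBall c R \ ball c r)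
    (hi : x ∉ interior (closedBall c R \ ball c r)) : ‖x - c‖ = r ∨ ‖x - c‖ = R := by
  by_contra hcon
  push Not at hcon
  rw [mem_diff, mem_closedBall, mem_ball, dist_eq_norm, not_lt] at h
  apply hi
  have hs : ball c R \ closedBall c r ⊆ closedBall c R \ ball c r :=
    diff_subset_diff ball_subset_closedBall ball_subset_closedBall
  refine interior_mono hs ?_
  rw [(isOpen_ball.sdiff isClosed_closedBall).interior_eq, mem_diff, mem_ball, mem_closedBall, dist_eq_norm, not_le]
  exact ⟨lt_of_le_of_ne h.1 hcon.2, lt_of_le_of_ne h.2 (Ne.symm hcon.1)⟩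

set_option maxHeartbeats 1600000 in
lemma PH (hN : 0 < N) {μ : ℝ} (hμ : 0 ≤ μ) : ∃ εb c : ℝ, 0 < εb ∧ εb ≤ 1 ∧ 0 < c ∧ c < 1 / 4 ∧
    ∀ (ν : E N) (u : E N → ℝ) (a b κ : ℝ), ‖ν‖ = 1 → 0 ≤ κ → κ ≤ (b - a) ^ 2 → 0 < b - a → b - a ≤ εb →
    WS μ κ (1 - κ) (1 + κ) 0 13 u → Flat ν a b 0 13 u →
    ∃ a' b', a ≤ a' ∧ b' ≤ b ∧ b' - a' = (1 - c) * (b - a) ∧ Flat ν a' b' 0 1 u := by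
  obtain ⟨L, hL⟩ : ∃ L : ℝ, L = 64 * N + 100 := ⟨_, rfl⟩
  have hN1 : (1:ℝ) ≤ N := by exact_mod_cast hN
  have hL0 : 0 < L := by rw [hL]; positivity
  have hL1 : 100 ≤ L := by rw [hL]; linarith
  obtain ⟨r1, hr1⟩ : ∃ r1 : ℝ, r1 = 1 / (4 * L) := ⟨_, rfl⟩
  have hr0 : 0 < r1 := by rw [hr1]; positivity
  have hr2 : r1 ≤ 1/2 := by rw [hr1, div_le_div_iff₀ (by positivity) (by norm_num)]; linarith
  have hLr : L * r1 = 1/4 := by rw [hr1]; field_simp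
  obtain ⟨A, hA⟩ : ∃ A : ℝ, A = (N + 1) / r1 ^ 2 := ⟨_, rfl⟩
  have hA0 : 0 < A := by rw [hA]; positivity
  have hAr : A * r1 ^ 2 = N + 1 := by rw [hA]; field_simp
  have hA1 : 1 ≤ A := by
    by_contra hcon; push Not at hcon
    have : A * r1 ^ 2 ≤ 1 * (1/2) ^ 2 := by gcongr
    rw [hAr] at this; linarith
  obtain ⟨e, he⟩ : ∃ e : ℝ, e = Real.exp (-A * 7 ^ 2) := ⟨_, rfl⟩
  have he0 : 0 < e := by rw [he]; positivity
  have he1 : e ≤ 1 := by rw [he]; apply Real.exp_le_one_iff.2; nlinarith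
  obtain ⟨f, hf⟩ : ∃ f : ℝ, f = Real.exp (-A * 6 ^ 2) := ⟨_, rfl⟩
  have hf1 : f ≤ 1 := by rw [hf]; apply Real.exp_le_one_iff.2; nlinarith
  have hef : e < f := by rw [he, hf]; apply Real.exp_lt_exp.2; nlinarith
  obtain ⟨m, hm⟩ : ∃ m : ℝ, m = (1 / 2) ^ μ := ⟨_, rfl⟩
  have hm0 : 0 < m := by rw [hm]; positivity
  have hm1 : m ≤ 1 := by rw [hm]; exact Real.rpow_le_one (by norm_num) (by norm_num) hμ
  refine ⟨min (1 / (8 * L)) (min (m * e / 4) (1 / (49 * A))), (f - e) / 4, by positivity, ?_, by linarith, by linarith, ?_⟩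
  · refine (min_le_left _ _).trans ?_
    rw [div_le_one (by positivity)]; linarith
  intro ν u a b κ hν hκ0 hκ hε hεb hW hF
  obtain ⟨ε, hεe⟩ : ∃ ε : ℝ, ε = b - a := ⟨_, rfl⟩
  rw [← hεe] at hκ hε hεb ⊢
  have e1 : ε ≤ 1 / (8 * L) := hεb.trans (min_le_left _ _)
  have e2 : ε ≤ m * e / 4 := hεb.trans ((min_le_right _ _).trans (min_le_left _ _))
  have e3 : ε ≤ 1 / (49 * A) := hεb.trans ((min_le_right _ _).trans (min_le_right _ _))
  rw [le_div_iff₀ (by positivity)] at e3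
  have hme : m * e ≤ m * 1 := by gcongr
  have hme' : m * e ≤ 1 * e := by gcongr
  have e4 : ε ≤ m := by linarith
  have hκε : κ ≤ ε * (m * e / 4) := by
    refine hκ.trans ?_; rw [sq]; gcongr
  rcases lt_or_ge a (-2) with ha | ha
  · refine ⟨a, a + (1 - (f - e) / 4) * ε, le_rfl, by linarith [mul_nonneg (sub_nonneg.2 hef.le) hε.le], by ring, fun x hx => ?_⟩
    obtain ⟨k1, k2⟩ := hF x (ball_subset_ball (by norm_num) hx)
    have : ⟪x, ν⟫ ≤ 1 := by
      refine (real_inner_le_norm _ _).trans ?_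
      rw [hν, mul_one]; rw [mem_ball_zero_iff] at hx; exact hx.le
    rw [max_eq_right (by linarith)] at k2
    exact ⟨k1, k2.trans (le_max_right _ _)⟩
  obtain ⟨c, hc⟩ : ∃ c : E N, c = (5:ℝ) • ν := ⟨_, rfl⟩
  have hcn : ‖c‖ = 5 := by rw [hc, norm_smul, hν]; norm_num
  have hνν : ⟪ν, ν⟫ = 1 := by rw [real_inner_self_eq_norm_sq, hν]; norm_num
  have hcν : ⟪c, ν⟫ = 5 := by rw [hc, real_inner_smul_left, hνν]; norm_num
  have hsub : ∀ R : ℝ, R ≤ 7 → closedBall c R ⊆ ball (0 : E N) 13 := by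
    intro R hR x hx
    rw [mem_closedBall, dist_eq_norm] at hx
    rw [mem_ball_zero_iff]
    have := norm_add_le (x - c) c
    rw [sub_add_cancel] at this; linarith
  have hin : ∀ x, |⟪x - c, ν⟫| ≤ ‖x - c‖ := fun x => by
    have := abs_real_inner_le_norm (x - c) ν
    rwa [hν, mul_one] at this
  have hxc : ∀ x, ⟪x, ν⟫ = 5 + ⟪x - c, ν⟫ := fun x => by rw [inner_sub_left, hcν]; ring
  have hpos1 : ∀ x ∈ closedBall c 1, 2 ≤ ⟪x, ν⟫ + a := by
    intro x hx
    rw [mem_closedBall, dist_eq_norm] at hx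
    have := (abs_le.1 (hin x)).1
    have := hxc x
    linarith
  have hpos : ∀ x ∈ closedBall c 1, 0 < u x := fun x hx => by
    have := hF.lo (hsub 1 (by norm_num) hx); have := hpos1 x hx; linarith
  have hbd : ∀ x ∈ closedBall c 1, ⟪x, ν⟫ + a ≤ u x ∧ u x ≤ ⟪x, ν⟫ + a + ε := fun x hx => by
    have k1 := hF.lo (hsub 1 (by norm_num) hx)
    have k2 := hF.pos (hsub 1 (by norm_num) hx) (hpos x hx)
    exact ⟨k1, by linarith⟩
  have hil : ∀ y, ‖y - c‖ = r1 → |(u c - ⟪c, ν⟫ - a) / ε - (u y - ⟪y, ν⟫ - a) / ε| ≤ 1 / 4 := by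
    intro y hy
    have := PH_IL hN hμ hL hW hν (hsub 1 (by norm_num)) hε hκ e1 (hm ▸ e4) hpos hbd
      (x := c) (y := y) (mem_closedBall_self (by norm_num)) (by rw [mem_closedBall, dist_eq_norm]; linarith)
    rwa [norm_sub_rev, hy, hLr] at this
  have hKc : IsCompact (closedBall c 7 \ ball c r1) := (isCompact_closedBall c 7).diff isOpen_ball
  have hKs : closedBall c 7 \ ball c r1 ⊆ ball (0 : E N) 13 := diff_subset.trans (hsub 7 le_rfl)
  have hKm : ∀ x ∈ closedBall c 7 \ ball c r1, r1 ≤ ‖x - c‖ ∧ ‖x - c‖ ≤ 7 := fun x hx => by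
    rw [mem_diff, mem_closedBall, mem_ball, dist_eq_norm, not_lt] at hx; exact ⟨hx.2, hx.1⟩
  have hball : ∀ x ∈ ball (0 : E N) 1, x ∈ closedBall c 7 \ ball c r1 ∧ f ≤ Real.exp (-A * ‖x - c‖ ^ 2) := fun x hx => by
    rw [mem_ball_zero_iff] at hx
    have k1 := norm_sub_le x c
    have k2 := norm_sub_norm_le c x
    rw [norm_sub_rev] at k2
    rw [mem_diff, mem_closedBall, mem_ball, dist_eq_norm, not_lt]
    refine ⟨⟨by linarith, by linarith⟩, ?_⟩
    rw [hf]; apply Real.exp_le_exp.2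
    have : ‖x - c‖ ^ 2 ≤ 6 ^ 2 := by gcongr; linarith
    have := mul_le_mul_of_nonneg_left this hA0.le
    linarith
  -- data of the bump
  have hP : ∀ x ∈ closedBall c 7 \ ball c r1, e ≤ Real.exp (-A * ‖x - c‖ ^ 2) ∧ Real.exp (-A * ‖x - c‖ ^ 2) ≤ 1 := by
    intro x hx
    obtain ⟨k1, k2⟩ := hKm x hx
    rw [he]
    refine ⟨Real.exp_le_exp.2 ?_, Real.exp_le_one_iff.2 ?_⟩
    · have : ‖x - c‖ ^ 2 ≤ 7 ^ 2 := by gcongr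
      have := mul_le_mul_of_nonneg_left this hA0.le
      linarith
    · have : 0 ≤ A * ‖x - c‖ ^ 2 := by positivity
      linarith
  have hlapb : ∀ x ∈ closedBall c 7 \ ball c r1,
      2 * e ≤ (4 * A ^ 2 * ‖x - c‖ ^ 2 - 2 * A * N) * Real.exp (-A * ‖x - c‖ ^ 2) := by
    intro x hx
    obtain ⟨k1, k2⟩ := hKm x hx
    have k3 : A * r1 ^ 2 ≤ A * ‖x - c‖ ^ 2 := by gcongr
    rw [hAr] at k3
    have k4 : 2 ≤ 4 * A ^ 2 * ‖x - c‖ ^ 2 - 2 * A * N := by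
      have k5 : A * (N + 1) ≤ A * (A * ‖x - c‖ ^ 2) := by gcongr
      have k6 : A * (A * ‖x - c‖ ^ 2) = A ^ 2 * ‖x - c‖ ^ 2 := by ring
      have k7 : 0 ≤ A * N := by positivity
      linarith
    have := (hP x hx).1
    gcongr
  have hgr : ∀ p : ℝ, |p| ≤ ε * A / 2 → ∀ x ∈ closedBall c 7 \ ball c r1, (1:ℝ)/2 ≤ ‖ν - p • (x - c)‖ := by
    intro p hp x hx
    have k1 := norm_sub_norm_le ν (p • (x - c))
    rw [norm_smul, Real.norm_eq_abs, hν] at k1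
    have : |p| * ‖x - c‖ ≤ ε * A / 2 * 7 := mul_le_mul hp (hKm x hx).2 (norm_nonneg _) (by positivity)
    linarith
  have hmg : ∀ p : ℝ, |p| ≤ ε * A / 2 → ∀ x ∈ closedBall c 7 \ ball c r1, m ≤ ‖ν - p • (x - c)‖ ^ μ := by
    intro p hp x hx
    rw [hm]; exact Real.rpow_le_rpow (by norm_num) (hgr p hp x hx) hμ
  have hFp : ∀ x ∈ closedBall c 7 \ ball c r1, Fpt u x → ⟪x - c, ν⟫ ≤ -3 := by
    intro x hx hFx
    have := (hF.fpt (hKs hx) hFx).1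
    have := hxc x
    linarith
  have hpb : ∀ x ∈ closedBall c 7 \ ball c r1, ∃ p, p = ε * A / 2 * Real.exp (-A * ‖x - c‖ ^ 2) ∧
      ε * e / 2 ≤ p ∧ p ≤ ε * A / 2 := by
    intro x hx
    obtain ⟨k1, k2⟩ := hP x hx
    refine ⟨_, rfl, ?_, ?_⟩
    · calc ε * e / 2 = ε * 1 / 2 * e := by ring
        _ ≤ ε * A / 2 * Real.exp (-A * ‖x - c‖ ^ 2) := by gcongr
    · calc _ ≤ ε * A / 2 * 1 := by gcongr
        _ = _ := by ring
  rcases le_total (1/2) ((u c - ⟪c, ν⟫ - a) / ε) with hw | hw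
  · obtain ⟨d1, d2, d3⟩ := bump_data ν c (a - ε / 4 * e) (ε / 4) A
    have hcmp := cmp_below hW hκ0 (by linarith) hKc hKs d1 (fun x hx => by
        have hx' := interior_subset hx
        obtain ⟨p, hp, hp1, hp2⟩ := hpb x hx'
        have hp0 : 0 ≤ p := le_trans (by positivity) hp1
        rw [d2, d3, show 2 * (ε / 4) * A * Real.exp (-A * ‖x - c‖ ^ 2) = p by rw [hp]; ring]
        calc κ < m * (ε / 4 * (2 * e)) := by linarith [mul_pos hε (mul_pos hm0 he0)]
          _ ≤ _ := by
            have := hmg p (by rwa [abs_of_nonneg hp0]) x hx'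
            have := hlapb x hx'
            gcongr) (fun x hx hFx => by
        have hx' := interior_subset hx
        obtain ⟨p, hp, hp1, hp2⟩ := hpb x hx'
        have hp0 : 0 ≤ p := le_trans (by positivity) hp1
        rw [d2, show 2 * (ε / 4) * A * Real.exp (-A * ‖x - c‖ ^ 2) = p by rw [hp]; ring]
        have k := real_inner_le_norm (ν - p • (x - c)) ν
        rw [hν, mul_one, inner_sub_left, hνν, real_inner_smul_left] at k
        have := mul_le_mul_of_nonneg_left (hFp x hx' hFx) hp0
        have : ε * (m * e / 4) ≤ ε * e / 4 := by linarith [mul_le_mul_of_nonneg_left hme' hε.le]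
        have : 0 < ε * e := by positivity
        linarith) (fun x hx hxi => by
        have k1 := hF.lo (hKs hx)
        rcases interior_annulus c r1 7 hx hxi with k | k
        · have k2 := (abs_le.1 (hil x k)).2
          have k3 : 1 / 4 ≤ (u x - ⟪x, ν⟫ - a) / ε := by linarith
          rw [le_div_iff₀ hε] at k3
          have : ε / 4 * Real.exp (-A * ‖x - c‖ ^ 2) ≤ ε / 4 * 1 := by gcongr; exact (hP x hx).2
          have : 0 ≤ ε / 4 * e := by positivity
          linarith
        · rw [k, ← he]; linarith)
    refine ⟨a + (f - e) / 4 * ε, b, ?_, le_rfl, by rw [hεe]; ring, fun x hx => ⟨max_le ?_ ?_, ?_⟩⟩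
    · have : 0 ≤ (f - e) / 4 * ε := mul_nonneg (by linarith) hε.le
      linarith
    · have k1 := hcmp x (hball x hx).1
      have : ε / 4 * f ≤ ε / 4 * Real.exp (-A * ‖x - c‖ ^ 2) := by gcongr; exact (hball x hx).2
      linarith
    · exact hW.nn x (hKs (hball x hx).1)
    · exact (hF x (hKs (hball x hx).1)).2
  · obtain ⟨d1, d2, d3⟩ := bump_data ν c (b + ε / 4 * e) (-(ε / 4)) A
    have hcmp := cmp_above hW hKc hKs d1 (fun x hx _ => by
        have hx' := interior_subset hx
        obtain ⟨p, hp, hp1, hp2⟩ := hpb x hx'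
        have hp0 : 0 ≤ p := le_trans (by positivity) hp1
        rw [d2, d3, show 2 * (-(ε / 4)) * A * Real.exp (-A * ‖x - c‖ ^ 2) = -p by rw [hp]; ring]
        have : κ < m * (ε / 4 * (2 * e)) := by linarith [mul_pos hε (mul_pos hm0 he0)]
        have k2 : m * (ε / 4 * (2 * e)) ≤ ‖ν - (-p) • (x - c)‖ ^ μ * (ε / 4 * ((4 * A ^ 2 * ‖x - c‖ ^ 2 - 2 * A * N) * Real.exp (-A * ‖x - c‖ ^ 2))) := by
            have := hmg (-p) (by rwa [abs_neg, abs_of_nonneg hp0]) x hx'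
            have := hlapb x hx'
            gcongr
        rw [neg_mul, mul_neg]; linarith) (fun x hx hFx => by
        have hx' := interior_subset hx
        obtain ⟨p, hp, hp1, hp2⟩ := hpb x hx'
        have hp0 : 0 ≤ p := le_trans (by positivity) hp1
        rw [d2, show 2 * (-(ε / 4)) * A * Real.exp (-A * ‖x - c‖ ^ 2) = -p by rw [hp]; ring]
        have g1 := hgr (-p) (by rwa [abs_neg, abs_of_nonneg hp0]) x hx'
        refine ⟨fun h0 => by rw [h0, norm_zero] at g1; linarith, ?_⟩
        have : ε * (m * e / 4) ≤ ε * e / 4 := by linarith [mul_le_mul_of_nonneg_left hme' hε.le]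
        have hεe0 : 0 < ε * e := by positivity
        have k0 := hFp x hx' hFx
        have k1 : ‖ν - (-p) • (x - c)‖ ^ 2 = 1 + 2 * p * ⟪x - c, ν⟫ + p ^ 2 * ‖x - c‖ ^ 2 := by
          rw [norm_sub_sq_real, real_inner_smul_right, norm_smul, mul_pow, hν, Real.norm_eq_abs, sq_abs,
            real_inner_comm]; ring
        have k2 : ‖x - c‖ ^ 2 ≤ 7 ^ 2 := by have := (hKm x hx').2; gcongr
        have k3 : p ^ 2 * ‖x - c‖ ^ 2 ≤ p ^ 2 * 7 ^ 2 := by gcongr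
        have k4 : 49 * p ≤ 1 := by linarith
        have k5 : p * (49 * p) ≤ p * 1 := by gcongr
        have k6 : p * ⟪x - c, ν⟫ ≤ p * (-3) := by gcongr
        have hκ1 : κ ≤ 1 := by linarith [mul_le_mul_of_nonneg_left he1 hε.le]
        refine lt_of_pow_lt_pow_left₀ 2 (by linarith) ?_
        rw [k1]
        linarith [sq_nonneg κ]) (fun x hx hxi hpF => by
        have k1 : u x ≤ ⟪x, ν⟫ + b := by
          rcases hpF with hp | hp
          · exact hF.pos (hKs hx) hp
          · rw [hp.1]; exact (hF.fpt (hKs hx) hp).2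
        rcases interior_annulus c r1 7 hx hxi with k | k
        · have k2 := (abs_le.1 (hil x k)).1
          have k3 : (u x - ⟪x, ν⟫ - a) / ε ≤ 3 / 4 := by linarith
          rw [div_le_iff₀ hε] at k3
          have : ε / 4 * Real.exp (-A * ‖x - c‖ ^ 2) ≤ ε / 4 * 1 := by gcongr; exact (hP x hx).2
          have : 0 ≤ ε / 4 * e := by positivity
          linarith
        · rw [k, ← he]; linarith)
    refine ⟨a, b - (f - e) / 4 * ε, le_rfl, ?_, by rw [hεe]; ring, fun x hx => ⟨(hF x (hKs (hball x hx).1)).1, ?_⟩⟩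
    · have : 0 ≤ (f - e) / 4 * ε := mul_nonneg (by linarith) hε.le
      linarith
    · rcases (hW.nn x (hKs (hball x hx).1)).lt_or_eq with hp | hp
      · refine le_trans ?_ (le_max_left _ _)
        have k1 := hcmp x (hball x hx).1 hp
        have : ε / 4 * f ≤ ε / 4 * Real.exp (-A * ‖x - c‖ ^ 2) := by gcongr; exact (hball x hx).2
        linarith
      · rw [← hp]; exact le_max_right _ _
end PHsec

section ITsec
variable {N : ℕ}

lemma mem_scale {x1 y : E N} {s r : ℝ} (hs : 0 < s) : x1 + s • y ∈ ball x1 (r * s) ↔ y ∈ ball 0 r := by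
  rw [mem_ball, mem_ball_zero_iff, dist_eq_norm, add_sub_cancel_left, norm_smul, Real.norm_of_nonneg hs.le, mul_comm,
    mul_lt_mul_iff_left₀ hs]

lemma Flat.scale {ν : E N} {a b : ℝ} {x1 : E N} {r s : ℝ} {u : E N → ℝ} (hs : 0 < s) :
    Flat ν a b x1 (r * s) u ↔
      Flat ν ((⟪x1, ν⟫ + a) / s) ((⟪x1, ν⟫ + b) / s) 0 r (fun y => u (x1 + s • y) / (1 * s)) := by
  have key : ∀ (y : E N) (t : ℝ), max (⟪x1 + s • y, ν⟫ + t) 0 = s * max (⟪y, ν⟫ + (⟪x1, ν⟫ + t) / s) 0 := fun y t => by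
    rw [mul_max_of_nonneg _ _ hs.le, mul_zero, inner_add_left, real_inner_smul_left]
    congr 1; field_simp; ring
  constructor
  · intro h y hy
    obtain ⟨h1, h2⟩ := h _ ((mem_scale hs).2 hy)
    rw [key] at h1 h2
    rw [one_mul]
    exact ⟨by rw [le_div_iff₀ hs]; linarith, by rw [div_le_iff₀ hs]; linarith⟩
  · intro h x hx
    obtain ⟨y, rfl⟩ : ∃ y, x = x1 + s • y := ⟨s⁻¹ • (x - x1), by rw [smul_smul, mul_inv_cancel₀ hs.ne']; simp⟩
    obtain ⟨h1, h2⟩ := h _ ((mem_scale hs).1 hx)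
    rw [one_mul, le_div_iff₀ hs] at h1
    rw [one_mul, div_le_iff₀ hs] at h2
    rw [key, key]
    exact ⟨by linarith, by linarith⟩

lemma IT (hN : 0 < N) {μ : ℝ} (hμ : 0 ≤ μ) {δ : ℝ} (hδ : 0 < δ) : ∃ r ε1 : ℝ, 0 < r ∧ r ≤ 1 ∧ 0 < ε1 ∧ ε1 ≤ 1 ∧
    ∀ (ν x1 : E N) (u : E N → ℝ) (ε κ : ℝ), ‖ν‖ = 1 → 0 ≤ κ → κ ≤ ε ^ 2 → 0 < ε → ε ≤ ε1 →
    WS μ κ (1 - κ) (1 + κ) x1 1 u → Flat ν (-ε) ε x1 1 u →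
    ∃ a' b', -ε ≤ a' ∧ b' ≤ ε ∧ 0 ≤ b' - a' ∧ b' - a' ≤ 2 * δ * ε ∧ Flat ν a' b' x1 r u := by
  obtain ⟨εb, c, h1, h1', h2, h3, hPH⟩ := PH (N := N) hN hμ
  have main : ∀ k : ℕ, ∀ (ν x1 : E N) (u : E N → ℝ) (ε κ : ℝ), ‖ν‖ = 1 → 0 ≤ κ → κ ≤ ε ^ 2 → 0 < ε → 2 * ε * 13 ^ k ≤ εb →
    WS μ κ (1 - κ) (1 + κ) x1 1 u → Flat ν (-ε) ε x1 1 u →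
    ∃ a' b', -ε ≤ a' ∧ b' ≤ ε ∧ b' - a' = (1 - c) ^ k * (2 * ε) ∧ Flat ν a' b' x1 ((1 / 13) ^ k) u := by
    intro k
    induction k with
    | zero => intro ν x1 u ε κ _ _ _ _ _ _ hF; exact ⟨-ε, ε, le_rfl, le_rfl, by ring, by simpa using hF⟩
    | succ k ih =>
      intro ν x1 u ε κ hν hκ0 hκ hε hεb hW hF
      have hεb' : 2 * ε * 13 ^ k ≤ εb := le_trans (by gcongr <;> norm_num) hεb
      obtain ⟨a, b, ha, hb, hab, hF'⟩ := ih ν x1 u ε κ hν hκ0 hκ hε hεb' hW hF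
      obtain ⟨s, hs⟩ : ∃ s : ℝ, s = (1 / 13) ^ (k + 1) := ⟨_, rfl⟩
      have hs0 : 0 < s := by rw [hs]; positivity
      have hs1 : 13 * s = (1 / 13) ^ k := by rw [hs, pow_succ]; ring
      have hs1' : 13 * s ≤ 1 := by rw [hs1]; exact pow_le_one₀ (by norm_num) (by norm_num)
      have hsi : s * 13 ^ (k + 1) = 1 := by rw [hs, ← mul_pow]; norm_num
      rw [← hs1] at hF'
      have hF2 := (Flat.scale hs0).1 hF'
      have hW2 := (WS.scale (x1 := x1) (r := 13) hW hs0 one_pos (fun y hy =>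
        ball_subset_ball hs1' ((mem_scale hs0).2 hy))).mono (κ' := κ) (lo' := 1 - κ) (hi' := 1 + κ) subset_rfl
        (by rw [Real.one_rpow, div_one]; exact mul_le_of_le_one_right hκ0 (by linarith)) (by simp) (by simp)
      have e1 : (⟪x1, ν⟫ + b) / s - (⟪x1, ν⟫ + a) / s = (1 - c) ^ k * (2 * ε) / s := by rw [← hab]; ring
      have e2 : (1 - c) ^ k * (2 * ε) / s = (1 - c) ^ k * (2 * ε * 13 ^ (k + 1)) := by
        rw [div_eq_iff hs0.ne']; linear_combination (-(1 - c) ^ k * (2 * ε)) * hsi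
      have hc1 : (1 - c) ^ k ≤ 1 := pow_le_one₀ (by linarith) (by linarith)
      have hc0 : 0 < (1 - c) ^ k := pow_pos (by linarith) _
      have hlow : 1 ≤ (1 - c) ^ k * 13 ^ k := by
        rw [← mul_pow]; exact one_le_pow₀ (by linarith)
      have e3 : ε ≤ (1 - c) ^ k * (2 * ε * 13 ^ (k + 1)) := by
        rw [pow_succ]
        have := mul_le_mul_of_nonneg_left hlow hε.le
        linarith
      obtain ⟨a', b', h4, h5, h6, h7⟩ := hPH ν _ _ _ κ hν hκ0 (by rw [e1, e2]; exact hκ.trans (by gcongr))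
        (by rw [e1, e2]; linarith) (by
          rw [e1, e2]; refine le_trans ?_ hεb
          exact mul_le_of_le_one_left (by positivity) hc1) hW2 hF2
      refine ⟨s * a' - ⟪x1, ν⟫, s * b' - ⟪x1, ν⟫, ?_, ?_, ?_, ?_⟩
      · rw [div_le_iff₀ hs0] at h4; linarith
      · rw [le_div_iff₀ hs0] at h5; linarith
      · rw [e1] at h6
        calc _ = s * (b' - a') := by ring
          _ = _ := by rw [h6, pow_succ]; field_simp
      · rw [← hs, ← one_mul s, Flat.scale hs0]
        rw [show (⟪x1, ν⟫ + (1 * s * a' - ⟪x1, ν⟫)) / s = a' by field_simp; ring,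
          show (⟪x1, ν⟫ + (1 * s * b' - ⟪x1, ν⟫)) / s = b' by field_simp; ring]
        exact h7
  obtain ⟨k, hk⟩ := exists_pow_lt_of_lt_one hδ (show 1 - c < 1 by linarith)
  refine ⟨(1 / 13) ^ k, εb / (2 * 13 ^ k), by positivity, pow_le_one₀ (by norm_num) (by norm_num), by positivity, ?_, ?_⟩
  · rw [div_le_one (by positivity)]
    have : (1:ℝ) ≤ 13 ^ k := one_le_pow₀ (by norm_num)
    linarith
  intro ν x1 u ε κ hν hκ0 hκ hε hεb hW hF
  rw [le_div_iff₀ (by positivity)] at hεb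
  obtain ⟨a, b, h4, h5, h6, h7⟩ := main k ν x1 u ε κ hν hκ0 hκ hε (by linarith) hW hF
  have hc0 : 0 < (1 - c) ^ k := pow_pos (by linarith) _
  refine ⟨a, b, h4, h5, by rw [h6]; positivity, ?_, h7⟩
  rw [h6]
  have := mul_le_mul_of_nonneg_right hk.le hε.le
  linarith
end ITsec

section IFsec
variable {N : ℕ}

lemma vt_data {h : E N → ℝ} (hh : ContDiff ℝ 2 h) (hl : ∀ x, lap h x = 0) (ν : E N) (ε t k : ℝ) :
    ContDiff ℝ 2 (fun y : E N => (⟪y, ν⟫ + ε * h y) + (t * (‖y - 0‖ ^ 2 + ⟪y, ν⟫) + k)) ∧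
    (∀ x, gradient (fun y : E N => (⟪y, ν⟫ + ε * h y) + (t * (‖y - 0‖ ^ 2 + ⟪y, ν⟫) + k)) x =
      ν + (ε • gradient h x + t • ((2:ℝ) • x + ν))) ∧
    ∀ x, lap (fun y : E N => (⟪y, ν⟫ + ε * h y) + (t * (‖y - 0‖ ^ 2 + ⟪y, ν⟫) + k)) x = t * (2 * N) := by
  have c0 : ContDiff ℝ 2 (fun y : E N => ‖y - 0‖ ^ 2 + ⟪y, ν⟫) := (cd_sq 0).add (cd_inner ν)
  have c1 : ContDiff ℝ 2 (fun y : E N => ⟪y, ν⟫ + ε * h y) := (cd_inner ν).add (contDiff_const.mul hh)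
  have c2 : ContDiff ℝ 2 (fun y : E N => t * (‖y - 0‖ ^ 2 + ⟪y, ν⟫) + k) := (contDiff_const.mul c0).add contDiff_const
  refine ⟨c1.add c2, fun x => ?_, fun x => ?_⟩
  · rw [(hg_add (hg_add (hg_inner ν x) (hg_smul ε (hasGrad hh x))) (hg_add (hg_smul t (hg_add (hg_sq 0 x) (hg_inner ν x)))
      (hg_const k x))).gradient]
    rw [sub_zero]; module
  · rw [lap_add c1 c2, lap_add (cd_inner ν) (contDiff_const.mul hh), lap_inner, lap_smul ε hh, hl,
      lap_add (contDiff_const.mul c0) contDiff_const, lap_const, lap_smul t c0, lap_add (cd_sq 0) (cd_inner ν), lap_sq, lap_inner]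
    ring

lemma IF_cmp (hN : 0 < N) {μ : ℝ} (hμ : 0 ≤ μ) {m : ℝ} (hm : m = (1 / 2) ^ μ) {κ ε δ G : ℝ} {ν : E N} {u h : E N → ℝ}
    (hκ0 : 0 ≤ κ) (hκ : κ ≤ ε ^ 2) (hε : 0 < ε) (hδ : 0 < δ) (hδ1 : δ ≤ 1) (hG : 0 ≤ G) (hs : ε * (4 * (G + 12) ^ 2) ≤ m * δ)
    (hν : ‖ν‖ = 1) (hW : WS μ κ (1 - κ) (1 + κ) 0 20 u) (hF : Flat ν (-ε) ε 0 20 u)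
    (hh : ContDiff ℝ 2 h) (hl : ∀ x, lap h x = 0) (hg1 : ∀ x ∈ closedBall (0 : E N) 5, ‖gradient h x‖ ≤ G)
    (hg2 : ∀ x ∈ closedBall (0 : E N) 5, |⟪gradient h x, ν⟫| ≤ G * |⟪x, ν⟫|)
    (s1 : ∀ x ∈ sphere (0 : E N) 5, ⟪x, ν⟫ + ε * (h x - 3 * δ) ≤ u x)
    (s2 : ∀ x ∈ sphere (0 : E N) 5, (0 < u x ∨ Fpt u x) → u x ≤ ⟪x, ν⟫ + ε * (h x + 3 * δ)) :
    (∀ x ∈ closedBall (0 : E N) 5, ⟪x, ν⟫ + ε * (h x - 40 * δ) ≤ u x) ∧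
    (∀ x ∈ closedBall (0 : E N) 5, 0 < u x → u x ≤ ⟪x, ν⟫ + ε * (h x + 40 * δ)) := by
  have hN1 : (1:ℝ) ≤ N := by exact_mod_cast hN
  have hm0 : 0 < m := by rw [hm]; positivity
  have hm1 : m ≤ 1 := by rw [hm]; exact Real.rpow_le_one (by norm_num) (by norm_num) hμ
  have hmδ : m * δ ≤ 1 * δ := by gcongr
  have hsd : ε * (4 * (G + 12) ^ 2) ≤ δ := by linarith
  have hse : ε * (4 * (G + 12) ^ 2) = 4 * (ε * G * G) + 96 * (ε * G) + 576 * ε := by ring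
  have p1 : 0 ≤ ε * G := by positivity
  have p2 : 0 ≤ ε * G * G := by positivity
  have hεm : 576 * ε ≤ m * δ := by linarith
  have hεδ : ε * δ ≤ ε * 1 := by gcongr
  have hKs : closedBall (0 : E N) 5 ⊆ ball 0 20 := closedBall_subset_ball (by norm_num)
  have hνν : ⟪ν, ν⟫ = 1 := by rw [real_inner_self_eq_norm_sq, hν]; norm_num
  have hgn : ∀ t, |t| = ε * δ → ∀ x ∈ closedBall (0 : E N) 5,
      ‖ε • gradient h x + t • ((2:ℝ) • x + ν)‖ ≤ ε * (G + 11) := by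
    intro t ht x hx
    have k1 := hg1 x hx
    rw [mem_closedBall_zero_iff] at hx
    have k2 : ‖(2:ℝ) • x + ν‖ ≤ 11 := by
      refine (norm_add_le _ _).trans ?_
      rw [norm_smul, hν]; norm_num; linarith
    refine (norm_add_le _ _).trans ?_
    rw [norm_smul, norm_smul, Real.norm_of_nonneg hε.le, Real.norm_eq_abs, ht]
    have : ε * ‖gradient h x‖ ≤ ε * G := by gcongr
    have : ε * δ * ‖(2:ℝ) • x + ν‖ ≤ ε * 1 * 11 := by gcongr
    linarith
  have hgr : ∀ t, |t| = ε * δ → ∀ x ∈ closedBall (0 : E N) 5,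
      (1:ℝ)/2 ≤ ‖ν + (ε • gradient h x + t • ((2:ℝ) • x + ν))‖ := by
    intro t ht x hx
    have k1 := hgn t ht x hx
    have k2 := norm_sub_le (ν + (ε • gradient h x + t • ((2:ℝ) • x + ν))) (ε • gradient h x + t • ((2:ℝ) • x + ν))
    rw [add_sub_cancel_right, hν] at k2
    linarith
  have hmg : ∀ t, |t| = ε * δ → ∀ x ∈ closedBall (0 : E N) 5,
      m ≤ ‖ν + (ε • gradient h x + t • ((2:ℝ) • x + ν))‖ ^ μ := by
    intro t ht x hx
    rw [hm]; exact Real.rpow_le_rpow (by norm_num) (hgr t ht x hx) hμ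
  have hint : ∀ t x, ⟪ε • gradient h x + t • ((2:ℝ) • x + ν), ν⟫ = ε * ⟪gradient h x, ν⟫ + t * (2 * ⟪x, ν⟫ + 1) := by
    intro t x
    rw [inner_add_left, real_inner_smul_left, real_inner_smul_left, inner_add_left, real_inner_smul_left, hνν]
  have hFp : ∀ x ∈ closedBall (0 : E N) 5, Fpt u x → |⟪x, ν⟫| ≤ ε ∧ |⟪gradient h x, ν⟫| ≤ ε * G := by
    intro x hx hFx
    obtain ⟨k1, k2⟩ := hF.fpt (hKs hx) hFx
    have k3 : |⟪x, ν⟫| ≤ ε := abs_le.2 ⟨by linarith, by linarith⟩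
    refine ⟨k3, (hg2 x hx).trans ?_⟩
    rw [mul_comm]; gcongr
  have hxν : ∀ x ∈ closedBall (0 : E N) 5, |⟪x, ν⟫| ≤ 5 ∧ 0 ≤ ‖x‖ ^ 2 ∧ ‖x‖ ^ 2 ≤ 25 := by
    intro x hx
    rw [mem_closedBall_zero_iff] at hx
    have := abs_real_inner_le_norm x ν
    rw [hν, mul_one] at this
    exact ⟨this.trans hx, by positivity, by nlinarith [norm_nonneg x]⟩
  have hfr : ∀ x ∈ closedBall (0 : E N) 5, x ∉ interior (closedBall (0 : E N) 5) → x ∈ sphere (0 : E N) 5 := by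
    intro x hx hxi
    rw [interior_closedBall _ (by norm_num)] at hxi
    rw [mem_sphere]; rw [mem_ball, not_lt] at hxi; exact le_antisymm hx hxi
  have hεδ0 : 0 < ε * δ := by positivity
  have hlap : κ < m * (ε * δ * (2 * N)) := by
    calc κ ≤ ε * ε := by rw [← sq]; exact hκ
      _ < ε * (m * δ * 2) := by have : 0 < m * δ := by positivity
                                gcongr; linarith
      _ ≤ ε * (m * δ * (2 * N)) := by gcongr; linarith
      _ = _ := by ring
  constructor
  · obtain ⟨d1, d2, d3⟩ := vt_data hh hl ν ε (ε * δ) (-34 * (ε * δ))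
    have ht : |ε * δ| = ε * δ := abs_of_pos hεδ0
    have hcmp := cmp_below hW hκ0 (by linarith) (isCompact_closedBall 0 5) hKs d1 (fun x hx => by
        have hx' := interior_subset hx
        rw [d2, d3]
        refine hlap.trans_le ?_
        have := hmg _ ht x hx'
        gcongr) (fun x hx hFx => by
        have hx' := interior_subset hx
        obtain ⟨k1, k2⟩ := hFp x hx' hFx
        rw [d2]
        have k := real_inner_le_norm (ν + (ε • gradient h x + (ε * δ) • ((2:ℝ) • x + ν))) ν
        rw [hν, mul_one, inner_add_left, hνν, hint] at k
        have k3 : ε * (-(ε * G)) ≤ ε * ⟪gradient h x, ν⟫ := by gcongr; exact (abs_le.1 k2).1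
        have k4 : ε * δ * (2 * (-ε) + 1) ≤ ε * δ * (2 * ⟪x, ν⟫ + 1) := by gcongr; exact (abs_le.1 k1).1
        have k5 : 0 < ε * (-(ε * G) + δ * (2 * (-ε) + 1) - ε) := by
          apply mul_pos hε; linarith
        have : ε ^ 2 = ε * ε := sq ε
        linarith) (fun x hx hxi => by
        have hx' := hfr x hx hxi
        have k1 := s1 x hx'
        rw [sub_zero]
        rw [mem_sphere_zero_iff_norm] at hx'
        rw [hx']
        have := mul_le_mul_of_nonneg_left (abs_le.1 (hxν x hx).1).2 hεδ0.le
        linarith)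
    intro x hx
    have k1 := hcmp x hx
    obtain ⟨k2, k3, k4⟩ := hxν x hx
    rw [sub_zero] at k1
    have := mul_le_mul_of_nonneg_left (abs_le.1 k2).1 hεδ0.le
    have := mul_le_mul_of_nonneg_left k3 hεδ0.le
    linarith
  · obtain ⟨d1, d2, d3⟩ := vt_data hh hl ν ε (-(ε * δ)) (34 * (ε * δ))
    have ht : |-(ε * δ)| = ε * δ := by rw [abs_neg, abs_of_pos hεδ0]
    have hcmp := cmp_above hW (isCompact_closedBall 0 5) hKs d1 (fun x hx _ => by
        have hx' := interior_subset hx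
        rw [d2, d3, neg_mul, mul_neg]
        refine neg_lt_neg (hlap.trans_le ?_)
        have := hmg _ ht x hx'
        gcongr) (fun x hx hFx => by
        have hx' := interior_subset hx
        obtain ⟨k1, k2⟩ := hFp x hx' hFx
        rw [d2]
        have g1 := hgr _ ht x hx'
        refine ⟨fun h0 => by rw [h0, norm_zero] at g1; linarith, ?_⟩
        have g2 := hgn _ ht x hx'
        have g3 : ‖ε • gradient h x + (-(ε * δ)) • ((2:ℝ) • x + ν)‖ ^ 2 ≤ (ε * (G + 11)) ^ 2 := by gcongr
        have hκ1 : κ ≤ 1 := by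
          have : ε * ε ≤ 1 * 1 := by gcongr <;> linarith
          have : ε ^ 2 = ε * ε := sq ε
          linarith
        refine lt_of_pow_lt_pow_left₀ 2 (by linarith) ?_
        rw [norm_add_sq_real, hν, real_inner_comm, hint]
        have k3 : ε * ⟪gradient h x, ν⟫ ≤ ε * (ε * G) := by gcongr; exact (abs_le.1 k2).2
        have k4 : ε * δ * (2 * (-ε) + 1) ≤ ε * δ * (2 * ⟪x, ν⟫ + 1) := by gcongr; exact (abs_le.1 k1).1
        have k5 : 0 < ε * (2 * δ - 2 * (ε * G) - 4 * (ε * δ) - ε * (G + 11) ^ 2 - 2 * ε) := by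
          apply mul_pos hε; linarith
        linarith [sq_nonneg κ]) (fun x hx hxi hpF => by
        have hx' := hfr x hx hxi
        have k1 := s2 x hx' hpF
        rw [sub_zero]
        rw [mem_sphere_zero_iff_norm] at hx'
        rw [hx']
        have := mul_le_mul_of_nonneg_left (abs_le.1 (hxν x hx).1).2 hεδ0.le
        linarith)
    intro x hx hux
    have k1 := hcmp x hx hux
    obtain ⟨k2, k3, k4⟩ := hxν x hx
    rw [sub_zero] at k1
    have := mul_le_mul_of_nonneg_left (abs_le.1 k2).1 hεδ0.le
    have := mul_le_mul_of_nonneg_left k3 hεδ0.le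
    linarith
end IFsec

section HAsec
variable {N : ℕ}

lemma hg_sum {ι : Type*} (s : Finset ι) {φ : ι → E N → ℝ} {a : ι → E N} {x : E N} (h : ∀ i, HasGradientAt (φ i) (a i) x) :
    HasGradientAt (fun y => ∑ i ∈ s, φ i y) (∑ i ∈ s, a i) x := by
  classical
  induction s using Finset.induction_on with
  | empty => simpa using hg_const 0 x
  | insert i s hi ih => simp only [Finset.sum_insert hi]; exact hg_add (h i) ih

lemma grad_lip {h : E N → ℝ} (hh : ContDiff ℝ 2 h) (R : ℝ) : ∃ G : ℝ, 0 ≤ G ∧ ∀ x ∈ closedBall (0 : E N) R,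
    ‖gradient h x‖ ≤ G ∧ ∀ y ∈ closedBall (0 : E N) R, ‖gradient h x - gradient h y‖ ≤ G * ‖x - y‖ := by
  have hc : ContDiff ℝ 1 (gradient h) := by
    unfold gradient
    exact (LinearIsometryEquiv.contDiff _).comp (hh.fderiv_right (by norm_num))
  obtain ⟨G1, hG1⟩ := (isCompact_closedBall (0 : E N) R).exists_bound_of_continuousOn hc.continuous.continuousOn
  obtain ⟨G2, hG2⟩ := (isCompact_closedBall (0 : E N) R).exists_bound_of_continuousOn
    (hc.continuous_fderiv (by norm_num)).continuousOn
  refine ⟨max 0 (max G1 G2), le_max_left _ _, fun x hx => ⟨(hG1 x hx).trans ((le_max_left _ _).trans (le_max_right _ _)),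
    fun y hy => ?_⟩⟩
  exact (convex_closedBall (0 : E N) R).norm_image_sub_le_of_norm_fderiv_le (𝕜 := ℝ)
    (fun z _ => hc.differentiable (by norm_num) z)
    (fun z hz => (hG2 z hz).trans ((le_max_right _ _).trans (le_max_right _ _))) hy hx

lemma HA (hN : 0 < N) {r δ : ℝ} (hr : 0 < r) (hδ : 0 < δ) : ∃ (T : Finset (E N)) (h χ : E N → E N → ℝ) (G : ℝ), 0 ≤ G ∧
    (∀ t ∈ T, t ∈ sphere (0 : E N) 5) ∧ (∀ t, ContDiff ℝ 2 (h t) ∧ ∀ x, lap (h t) x = 0) ∧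
    (∀ t ∈ T, ∀ x ∈ closedBall (0 : E N) 5, ‖gradient (h t) x‖ ≤ G ∧
      ∀ y ∈ closedBall (0 : E N) 5, ‖gradient (h t) x - gradient (h t) y‖ ≤ G * ‖x - y‖) ∧
    ∀ x ∈ sphere (0 : E N) 5, ∑ t ∈ T, |h t x - χ t x| ≤ δ ∧ ∑ t ∈ T, χ t x = 1 ∧
      ∀ t ∈ T, 0 ≤ χ t x ∧ (χ t x ≠ 0 → ‖x - t‖ < r) := by
  obtain ⟨T0, hT0, hfin, hcov⟩ := finite_cover_balls_of_compact (isCompact_sphere (0 : E N) 5) hr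
  obtain ⟨T, rfl⟩ := hfin.exists_finset_coe
  have hc : ∀ t : E N, Continuous (fun x : E N => max 0 (r - ‖x - t‖)) := fun t => by fun_prop
  have hS : ∀ x ∈ sphere (0 : E N) 5, 0 < ∑ t ∈ T, max 0 (r - ‖x - t‖) := by
    intro x hx
    obtain ⟨t, ht, hxt⟩ := mem_iUnion₂.1 (hcov hx)
    rw [mem_ball, dist_eq_norm] at hxt
    exact Finset.sum_pos' (fun t _ => le_max_left _ _) ⟨t, ht, lt_max_of_lt_right (by linarith)⟩
  have hap := fun t : E N => harm_approx hN (ρ := 5) (by norm_num)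
    (g := fun x => max 0 (r - ‖x - t‖) / ∑ t ∈ T, max 0 (r - ‖x - t‖))
    (((hc t).continuousOn).div (continuous_finsetSum T (fun t _ => hc t)).continuousOn (fun x hx => (hS x hx).ne'))
    (δ := δ / (T.card + 1)) (by positivity)
  choose h h1 h2 h3 using hap
  choose G hG0 hG using fun t => grad_lip (h1 t) 5
  refine ⟨T, h, fun t x => max 0 (r - ‖x - t‖) / ∑ t ∈ T, max 0 (r - ‖x - t‖), ∑ t ∈ T, G t,
    Finset.sum_nonneg (fun t _ => hG0 t), fun t ht => hT0 ht, fun t => ⟨h1 t, h2 t⟩, fun t ht x hx => ?_, fun x hx => ⟨?_, ?_, fun t ht => ⟨?_, ?_⟩⟩⟩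
  · have hle : G t ≤ ∑ t ∈ T, G t := Finset.single_le_sum (fun t _ => hG0 t) ht
    exact ⟨(hG t x hx).1.trans hle, fun y hy => ((hG t x hx).2 y hy).trans (by gcongr)⟩
  · calc _ ≤ ∑ t ∈ T, δ / (T.card + 1) := Finset.sum_le_sum (fun t _ => h3 t x hx)
      _ = T.card / (T.card + 1) * δ := by rw [Finset.sum_const, nsmul_eq_mul]; ring
      _ ≤ 1 * δ := by gcongr; rw [div_le_one (by positivity)]; linarith
      _ = δ := one_mul δ
  · rw [← Finset.sum_div, div_self (hS x hx).ne']
  · exact div_nonneg (le_max_left _ _) (hS x hx).le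
  · intro hne
    by_contra hcon
    push Not at hcon
    exact hne (by beta_reduce; rw [max_eq_left (by linarith), zero_div])

lemma IF_fin (hN : 0 < N) {L : ℝ} (hL : L = 64 * N + 100) {ρ δ ε : ℝ} (hρ : 0 < ρ) (hρ1 : 6400 * L ^ 2 * ρ ≤ 1)
    (hδ : δ = ρ / 800) (hε : 0 < ε) (hε1 : 160 * L ^ 2 * ε ≤ 1) {ν : E N} {u h : E N → ℝ} (hν : ‖ν‖ = 1)
    (hnn : ∀ x ∈ closedBall (0 : E N) 5, 0 ≤ u x) (h0 : Fpt u 0)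
    (hh : ContDiff ℝ 2 h) (hl : ∀ x, lap h x = 0) (hb : ∀ x ∈ closedBall (0 : E N) 4, |h x| ≤ 2) (hgν : ⟪gradient h 0, ν⟫ = 0)
    (c1 : ∀ x ∈ closedBall (0 : E N) 5, ⟪x, ν⟫ + ε * (h x - 40 * δ) ≤ u x)
    (c2 : ∀ x ∈ closedBall (0 : E N) 5, 0 < u x → u x ≤ ⟪x, ν⟫ + ε * (h x + 40 * δ)) :
    ∃ ν' : E N, ‖ν'‖ = 1 ∧ ‖ν' - ν‖ ≤ 4 * L * ε ∧ Flat ν' (-(ε * ρ / 2)) (ε * ρ / 2) 0 (20 * ρ) u := by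
  have hL1 : 100 ≤ L := by rw [hL]; linarith [(Nat.cast_nonneg N : (0:ℝ) ≤ N)]
  obtain ⟨k1, k2⟩ := HE hN hL (h := fun y => (1/2) * h y) (contDiff_const.mul hh)
    (fun x => by rw [lap_smul _ hh, hl, mul_zero]) (fun x hx => by
      rw [abs_mul]; norm_num; linarith [hb x hx])
  rw [(hg_smul (1/2) (hasGrad hh 0)).gradient] at k1 k2
  set ξ := gradient h 0 with hξ
  have hξn : ‖ξ‖ ≤ 2 * L := by rw [norm_smul] at k1; norm_num at k1; linarith
  have hT : ∀ x ∈ closedBall (0 : E N) 1, |h x - h 0 - ⟪ξ, x⟫| ≤ 2 * L ^ 2 * ‖x‖ ^ 2 := by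
    intro x hx
    have k := k2 x hx
    rw [real_inner_smul_left, show 1 / 2 * h x - 1 / 2 * h 0 - 1 / 2 * ⟪ξ, x⟫ = (1/2) * (h x - h 0 - ⟪ξ, x⟫) by ring,
      abs_mul] at k
    norm_num at k; linarith
  have h00 : |h 0| ≤ 40 * δ := by
    rw [abs_le]
    constructor
    · by_contra hcon
      push Not at hcon
      have hcont : Continuous (fun x : E N => ⟪x, ν⟫ + ε * (h x + 40 * δ)) :=
        (cd_inner ν).continuous.add (continuous_const.mul (hh.continuous.add continuous_const))
      have hlt : ⟪(0 : E N), ν⟫ + ε * (h 0 + 40 * δ) < 0 := by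
        rw [inner_zero_left, zero_add]; exact mul_neg_of_pos_of_neg hε (by linarith)
      obtain ⟨y, hy, hy2, hy3⟩ := (h0.2.and_eventually ((hcont.continuousAt.eventually_lt_const hlt).and
        (closedBall_mem_nhds (0 : E N) (show (0:ℝ) < 5 by norm_num)))).exists
      linarith [c2 y hy3 hy]
    · have := c1 0 (mem_closedBall_self (by norm_num))
      rw [h0.1, inner_zero_left, zero_add] at this
      have := nonpos_of_mul_nonpos_right this hε
      linarith
  obtain ⟨M, hM⟩ : ∃ M, M = ‖ν + ε • ξ‖ := ⟨_, rfl⟩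
  have hM0 : 0 ≤ M := by rw [hM]; positivity
  have hM2 : M ^ 2 = 1 + ε ^ 2 * ‖ξ‖ ^ 2 := by
    rw [hM, norm_add_sq_real, real_inner_smul_right, real_inner_comm, hgν, hν, norm_smul, Real.norm_of_nonneg hε.le]; ring
  have hp : 0 ≤ ε ^ 2 * ‖ξ‖ ^ 2 := by positivity
  have hM1 : 1 ≤ M := by
    by_contra hcon; push Not at hcon
    have : M ^ 2 < 1 := pow_lt_one₀ hM0 hcon (by norm_num)
    linarith
  have hξ2 : ‖ξ‖ ^ 2 ≤ (2 * L) ^ 2 := by gcongr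
  have hξ3 : ε ^ 2 * ‖ξ‖ ^ 2 ≤ ε ^ 2 * (2 * L) ^ 2 := by gcongr
  have hMu : M - 1 ≤ 2 * L ^ 2 * ε ^ 2 := by nlinarith
  have hMε : 2 * L ^ 2 * ε ^ 2 ≤ ε / 80 := by
    have := mul_le_mul_of_nonneg_right hε1 hε.le
    linarith
  have hνM : ν + ε • ξ = M • (M⁻¹ • (ν + ε • ξ)) := by rw [smul_smul, mul_inv_cancel₀ (by linarith), one_smul]
  have hn1 : ‖M⁻¹ • (ν + ε • ξ)‖ = 1 := by
    rw [norm_smul, ← hM, norm_inv, Real.norm_of_nonneg hM0, inv_mul_cancel₀ (by linarith)]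
  obtain ⟨ν', hν'⟩ : ∃ ν', ν' = M⁻¹ • (ν + ε • ξ) := ⟨_, rfl⟩
  rw [← hν'] at hνM hn1
  refine ⟨ν', hn1, ?_, ?_⟩
  · have : ν' - ν = (1 - M) • ν' + ε • ξ := by
      rw [sub_smul, one_smul, ← hνM]; abel
    rw [this]
    refine (norm_add_le _ _).trans ?_
    rw [norm_smul, norm_smul, hn1, Real.norm_of_nonneg hε.le, Real.norm_eq_abs, abs_sub_comm, abs_of_nonneg (by linarith)]
    have : ε * ‖ξ‖ ≤ ε * (2 * L) := by gcongr
    have : ε * 100 ≤ ε * L := by gcongr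
    linarith
  · intro x hx
    rw [mem_ball_zero_iff] at hx
    have hLρ : 20 * ρ ≤ 1 := by nlinarith
    have hx1 : x ∈ closedBall (0 : E N) 1 := by rw [mem_closedBall_zero_iff]; linarith
    have hx5 : x ∈ closedBall (0 : E N) 5 := closedBall_subset_closedBall (by norm_num) hx1
    have e1 : |h x - ⟪ξ, x⟫| ≤ 40 * δ + ρ / 8 := by
      have k := hT x hx1
      have k3 : ‖x‖ ^ 2 ≤ (20 * ρ) ^ 2 := by gcongr
      have k4 : 2 * L ^ 2 * ‖x‖ ^ 2 ≤ 2 * L ^ 2 * (20 * ρ) ^ 2 := by gcongr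
      have k5 := mul_le_mul_of_nonneg_right hρ1 hρ.le
      rw [abs_le] at *
      constructor <;> linarith
    have e2 : ⟪x, ν⟫ + ε * ⟪ξ, x⟫ = ⟪x, ν'⟫ + (M - 1) * ⟪x, ν'⟫ := by
      have : ⟪x, ν + ε • ξ⟫ = ⟪x, M • ν'⟫ := by rw [← hνM]
      rw [inner_add_right, real_inner_smul_right, real_inner_smul_right, real_inner_comm] at this
      rw [real_inner_comm, real_inner_comm x ξ]
      linarith
    have e3 : |(M - 1) * ⟪x, ν'⟫| ≤ ε / 80 * (20 * ρ) := by
      rw [abs_mul, abs_of_nonneg (by linarith : 0 ≤ M - 1)]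
      have := abs_real_inner_le_norm x ν'
      rw [hn1, mul_one] at this
      gcongr
      · linarith
      · linarith
    have e4 : |ε * (h x - ⟪ξ, x⟫)| ≤ ε * (40 * δ + ρ / 8) := by
      rw [abs_mul, abs_of_pos hε]; gcongr
    have hερ : 0 < ε * ρ := by positivity
    rw [hδ] at *
    rw [abs_le] at e3 e4
    refine ⟨max_le ?_ (hnn x hx5), ?_⟩
    · linarith [c1 x hx5]
    · rcases (hnn x hx5).lt_or_eq with hp | hp
      · refine le_trans ?_ (le_max_left _ _)
        linarith [c2 x hx5 hp]
      · rw [← hp]; exact le_max_right _ _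
end HAsec

section IF2sec
variable {N : ℕ}

lemma sym_data {h0 : E N → ℝ} (hc : ContDiff ℝ 2 h0) (hl : ∀ x, lap h0 x = 0) {G : ℝ}
    (hG : ∀ x ∈ closedBall (0 : E N) 5, ‖gradient h0 x‖ ≤ G ∧
      ∀ y ∈ closedBall (0 : E N) 5, ‖gradient h0 x - gradient h0 y‖ ≤ G * ‖x - y‖) {ν : E N} (hν : ‖ν‖ = 1)
    {R : E N ≃ₗᵢ[ℝ] E N} (hR : ∀ ξ, R ξ = ξ - (2 * ⟪ξ, ν⟫) • ν) :
    ContDiff ℝ 2 (fun y => (1/2) * h0 y + (1/2) * h0 (0 + (1:ℝ) • R y)) ∧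
    (∀ x, lap (fun y => (1/2) * h0 y + (1/2) * h0 (0 + (1:ℝ) • R y)) x = 0) ∧
    ∀ x ∈ closedBall (0 : E N) 5, ‖gradient (fun y => (1/2) * h0 y + (1/2) * h0 (0 + (1:ℝ) • R y)) x‖ ≤ G ∧
      |⟪gradient (fun y => (1/2) * h0 y + (1/2) * h0 (0 + (1:ℝ) • R y)) x, ν⟫| ≤ G * |⟪x, ν⟫| := by
  have hνν : ⟪ν, ν⟫ = 1 := by rw [real_inner_self_eq_norm_sq, hν]; norm_num
  have c2 : ContDiff ℝ 2 (fun y => h0 (0 + (1:ℝ) • R y)) :=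
    hc.comp (by
      have hRc : ContDiff ℝ 2 (fun y => R y) := R.contDiff
      simp only [one_smul]; exact contDiff_const.add hRc)
  refine ⟨(contDiff_const.mul hc).add (contDiff_const.mul c2), fun x => ?_, fun x hx => ?_⟩
  · rw [lap_add (contDiff_const.mul hc) (contDiff_const.mul c2), lap_smul _ hc, lap_smul _ c2, lap_comp hc, hl, hl]; ring
  · have g := (hg_add (hg_smul (1/2) (hasGrad hc x)) (hg_smul (1/2) (hg_comp 0 1 R x (hasGrad hc (0 + (1:ℝ) • R x))))).gradient
    rw [g, one_smul, one_smul, zero_add]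
    have hx2 : R x ∈ closedBall (0 : E N) 5 := by
      rw [mem_closedBall_zero_iff] at *; rwa [R.norm_map]
    have k1 := (hG x hx).1
    have k2 := (hG _ hx2).1
    constructor
    · refine (norm_add_le _ _).trans ?_
      rw [norm_smul, norm_smul, R.symm.norm_map]; norm_num; linarith
    · have e1 : ⟪R.symm (gradient h0 (R x)), ν⟫ = - ⟪gradient h0 (R x), ν⟫ := by
        rw [← R.inner_map_map, R.apply_symm_apply, hR ν, hνν, inner_sub_right, real_inner_smul_right]; ring
      rw [inner_add_left, real_inner_smul_left, real_inner_smul_left, e1,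
        show 1 / 2 * ⟪gradient h0 x, ν⟫ + 1 / 2 * -⟪gradient h0 (R x), ν⟫ = 1/2 * ⟪gradient h0 x - gradient h0 (R x), ν⟫ by
          rw [inner_sub_left]; ring, abs_mul]
      have k3 := (hG x hx).2 _ hx2
      have k4 := abs_real_inner_le_norm (gradient h0 x - gradient h0 (R x)) ν
      rw [hν, mul_one] at k4
      have k5 : ‖x - R x‖ = 2 * |⟪x, ν⟫| := by
        rw [hR, sub_sub_cancel, norm_smul, hν, mul_one, Real.norm_eq_abs, abs_mul]; norm_num
      rw [k5] at k3
      norm_num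
      linarith

lemma refl_dist {ν : E N} (hν : ‖ν‖ = 1) {R : E N ≃ₗᵢ[ℝ] E N} (hR : ∀ ξ, R ξ = ξ - (2 * ⟪ξ, ν⟫) • ν) (x s : E N) :
    ‖x - R s‖ ^ 2 = ‖x - s‖ ^ 2 + 4 * ⟪x, ν⟫ * ⟪s, ν⟫ := by
  rw [hR, show x - (s - (2 * ⟪s, ν⟫) • ν) = (x - s) + (2 * ⟪s, ν⟫) • ν by abel, norm_add_sq_real,
    real_inner_smul_right, norm_smul, hν, inner_sub_left, Real.norm_eq_abs, mul_one, sq_abs]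
  ring

lemma avg_le {T : Finset (E N)} {p W : E N → ℝ} (h0 : ∀ t ∈ T, 0 ≤ p t) (h1 : ∑ t ∈ T, p t = 1) {A : ℝ}
    (hA : ∀ t ∈ T, p t ≠ 0 → W t ≤ A) : ∑ t ∈ T, p t * W t ≤ A := by
  calc ∑ t ∈ T, p t * W t ≤ ∑ t ∈ T, p t * A := Finset.sum_le_sum (fun t ht => by
        by_cases hp : p t = 0
        · rw [hp, zero_mul, zero_mul]
        · exact mul_le_mul_of_nonneg_left (hA t ht hp) (h0 t ht))
    _ = A := by rw [← Finset.sum_mul, h1, one_mul]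

lemma IF (hN : 0 < N) {μ : ℝ} (hμ : 0 ≤ μ) : ∃ L : ℝ, 100 ≤ L ∧ ∀ ρ, 0 < ρ → 6400 * L ^ 2 * ρ ≤ 1 →
    ∃ ε0 : ℝ, 0 < ε0 ∧ ε0 ≤ 1 ∧ ∀ (ν : E N) (u : E N → ℝ) (ε κ : ℝ), ‖ν‖ = 1 → 0 ≤ κ → κ ≤ ε ^ 2 → 0 < ε → ε ≤ ε0 →
    WS μ κ (1 - κ) (1 + κ) 0 20 u → Flat ν (-ε) ε 0 20 u → Fpt u 0 →
    ∃ ν' : E N, ‖ν'‖ = 1 ∧ ‖ν' - ν‖ ≤ 4 * L * ε ∧ Flat ν' (-(ε * ρ / 2)) (ε * ρ / 2) 0 (20 * ρ) u := by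
  obtain ⟨L, hL⟩ : ∃ L : ℝ, L = 64 * N + 100 := ⟨_, rfl⟩
  have hL1 : 100 ≤ L := by rw [hL]; linarith [(Nat.cast_nonneg N : (0:ℝ) ≤ N)]
  refine ⟨L, hL1, fun ρ hρ hρ1 => ?_⟩
  obtain ⟨δ, hδ⟩ : ∃ δ, δ = ρ / 800 := ⟨_, rfl⟩
  have hδ0 : 0 < δ := by rw [hδ]; positivity
  have hδ1 : δ ≤ 1 := by nlinarith
  obtain ⟨r, ε1, hr0, hr1, hε10, hε11, hIT⟩ := IT hN hμ hδ0
  obtain ⟨T, h, χ, G, hG0, hT, hh, hG, hχ⟩ := HA hN (half_pos hr0) hδ0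
  obtain ⟨m, hm⟩ : ∃ m : ℝ, m = (1 / 2) ^ μ := ⟨_, rfl⟩
  have hm0 : 0 < m := by rw [hm]; positivity
  obtain ⟨G', hG'⟩ : ∃ G' : ℝ, G' = T.card * G := ⟨_, rfl⟩
  have hG'0 : 0 ≤ G' := by rw [hG']; positivity
  refine ⟨min ε1 (min (m * δ / (4 * (G' + 12) ^ 2)) (min (r ^ 2 / 120) (1 / (160 * L ^ 2)))), by positivity,
    (min_le_left _ _).trans hε11, ?_⟩
  intro ν u ε κ hν hκ0 hκ hε hεb hW hF hF0
  have e1 : ε ≤ ε1 := hεb.trans (min_le_left _ _)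
  have e2 : ε ≤ m * δ / (4 * (G' + 12) ^ 2) := hεb.trans ((min_le_right _ _).trans (min_le_left _ _))
  have e3 : ε ≤ r ^ 2 / 120 := hεb.trans ((min_le_right _ _).trans ((min_le_right _ _).trans (min_le_left _ _)))
  have e4 : ε ≤ 1 / (160 * L ^ 2) := hεb.trans ((min_le_right _ _).trans ((min_le_right _ _).trans (min_le_right _ _)))
  rw [le_div_iff₀ (by positivity)] at e2 e4
  obtain ⟨R, hR⟩ := exists_refl ν hν
  have hνν : ⟪ν, ν⟫ = 1 := by rw [real_inner_self_eq_norm_sq, hν]; norm_num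
  have hRν : ∀ x, ⟪R x, ν⟫ = -⟪x, ν⟫ := fun x => by
    rw [hR, inner_sub_left, real_inner_smul_left, hνν]; ring
  have hRR : ∀ x, R (R x) = x := fun x => by
    rw [hR (R x), hRν, hR x]; module
  -- reflected centers
  have hs : ∀ t, ∃ s : E N, 0 ≤ ⟪s, ν⟫ ∧ ‖s‖ = ‖t‖ ∧ ∀ x, (‖x - t‖ = ‖x - s‖ ∨ ‖x - t‖ = ‖x - R s‖) := fun t => by
    rcases le_total 0 ⟪t, ν⟫ with h | h
    · exact ⟨t, h, rfl, fun x => Or.inl rfl⟩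
    · exact ⟨R t, by rw [hRν]; linarith, R.norm_map t, fun x => Or.inr (by rw [hRR])⟩
  choose s hs1 hs2 hs3 using hs
  have hsn : ∀ t ∈ T, ‖s t‖ = 5 := fun t ht => by
    rw [hs2]; exact mem_sphere_zero_iff_norm.1 (hT t ht)
  have hsb : ∀ t ∈ T, ball (s t) 1 ⊆ ball 0 20 := fun t ht => ball_subset_ball' (by
    rw [dist_zero_right, hsn t ht]; norm_num)
  have hit : ∀ t, ∃ a b, t ∈ T → (-ε ≤ a ∧ b ≤ ε ∧ 0 ≤ b - a ∧ b - a ≤ 2 * δ * ε ∧ Flat ν a b (s t) r u) := fun t => by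
    by_cases ht : t ∈ T
    · obtain ⟨a, b, hab⟩ := hIT ν (s t) u ε κ hν hκ0 hκ hε e1 (hW.mono (hsb t ht) le_rfl le_rfl le_rfl)
        (fun x hx => hF x (hsb t ht hx))
      exact ⟨a, b, fun _ => hab⟩
    · exact ⟨0, 0, fun h => absurd h ht⟩
  choose a b hab using hit
  have hW1 : ∀ t ∈ T, |a t / ε| ≤ 1 := fun t ht => by
    obtain ⟨k1, k2, k3, k4, k5⟩ := hab t ht
    rw [abs_le]
    exact ⟨by rw [le_div_iff₀ hε]; linarith, by rw [div_le_one hε]; linarith⟩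
  -- the harmonic function
  have hc0 : ContDiff ℝ 2 (fun y => ∑ t ∈ T, a t / ε * h t y) :=
    ContDiff.sum (fun t _ => contDiff_const.mul (hh t).1)
  have hl0 : ∀ x, lap (fun y => ∑ t ∈ T, a t / ε * h t y) x = 0 := fun x => by
    rw [lap_sum T (fun t => contDiff_const.mul (hh t).1)]
    exact Finset.sum_eq_zero (fun t _ => by rw [lap_smul _ (hh t).1, (hh t).2, mul_zero])
  have hgr : ∀ x, gradient (fun y => ∑ t ∈ T, a t / ε * h t y) x = ∑ t ∈ T, (a t / ε) • gradient (h t) x := fun x =>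
    (hg_sum T (fun t => hg_smul (a t / ε) (hasGrad (hh t).1 x))).gradient
  obtain ⟨h0, hh0⟩ : ∃ h0, h0 = (fun y => ∑ t ∈ T, a t / ε * h t y) := ⟨_, rfl⟩
  rw [← hh0] at hc0 hl0 hgr
  have hGG : ∀ x ∈ closedBall (0 : E N) 5, ‖gradient h0 x‖ ≤ G' ∧
      ∀ y ∈ closedBall (0 : E N) 5, ‖gradient h0 x - gradient h0 y‖ ≤ G' * ‖x - y‖ := by
    intro x hx
    constructor
    · rw [hgr, hG', ← nsmul_eq_mul]
      refine (norm_sum_le _ _).trans (Finset.sum_le_card_nsmul _ _ _ fun t ht => ?_)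
      rw [norm_smul, Real.norm_eq_abs]
      have := mul_le_mul (hW1 t ht) (hG t ht x hx).1 (norm_nonneg _) zero_le_one
      linarith
    · intro y hy
      rw [hgr, hgr, ← Finset.sum_sub_distrib, hG', mul_assoc, ← nsmul_eq_mul]
      refine (norm_sum_le _ _).trans (Finset.sum_le_card_nsmul _ _ _ fun t ht => ?_)
      rw [← smul_sub, norm_smul, Real.norm_eq_abs]
      have := mul_le_mul (hW1 t ht) ((hG t ht x hx).2 y hy) (norm_nonneg _) zero_le_one
      linarith
  obtain ⟨d1, d2, d3⟩ := sym_data hc0 hl0 hGG hν hR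
  obtain ⟨H, hH⟩ : ∃ H, H = (fun y => (1/2) * h0 y + (1/2) * h0 (0 + (1:ℝ) • R y)) := ⟨_, rfl⟩
  rw [← hH] at d1 d2 d3
  -- weights on the sphere
  have hp : ∀ x ∈ sphere (0 : E N) 5, ∃ p : E N → ℝ, (∀ t ∈ T, 0 ≤ p t) ∧ ∑ t ∈ T, p t = 1 ∧
      |H x - ∑ t ∈ T, p t * (a t / ε)| ≤ δ ∧ ∀ t ∈ T, p t ≠ 0 → -(3 * ε) ≤ ⟪x, ν⟫ → x ∈ ball (s t) r := by
    intro x hx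
    have hRx : R x ∈ sphere (0 : E N) 5 := by
      rw [mem_sphere_zero_iff_norm] at *; rwa [R.norm_map]
    obtain ⟨x1, x2, x3⟩ := hχ x hx
    obtain ⟨y1, y2, y3⟩ := hχ _ hRx
    have hb : ∀ z ∈ sphere (0 : E N) 5, |h0 z - ∑ t ∈ T, a t / ε * χ t z| ≤ δ := by
      intro z hz
      rw [hh0]; beta_reduce
      rw [← Finset.sum_sub_distrib]
      refine (Finset.abs_sum_le_sum_abs _ _).trans (le_trans (Finset.sum_le_sum fun t ht => ?_) (hχ z hz).1)
      rw [← mul_sub, abs_mul]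
      exact mul_le_of_le_one_left (abs_nonneg _) (hW1 t ht)
    refine ⟨fun t => (1/2) * χ t x + (1/2) * χ t (R x), fun t ht => ?_, ?_, ?_, fun t ht hne hxν => ?_⟩
    · linarith [(x3 t ht).1, (y3 t ht).1]
    · rw [Finset.sum_add_distrib, ← Finset.mul_sum, ← Finset.mul_sum, x2, y2]; norm_num
    · have e : ∑ t ∈ T, ((1/2) * χ t x + (1/2) * χ t (R x)) * (a t / ε) =
          1/2 * (∑ t ∈ T, a t / ε * χ t x) + 1/2 * ∑ t ∈ T, a t / ε * χ t (R x) := by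
        rw [Finset.mul_sum, Finset.mul_sum, ← Finset.sum_add_distrib]
        exact Finset.sum_congr rfl fun t _ => by ring
      have b1 := hb x hx
      have b2 := hb _ hRx
      rw [e, hH]; beta_reduce
      rw [zero_add, one_smul]
      rw [abs_le] at *
      constructor <;> linarith
    · have hd : ‖x - t‖ < r / 2 ∨ ‖R x - t‖ < r / 2 := by
        by_contra hcon
        push Not at hcon
        have k1 : χ t x = 0 := by by_contra hz; linarith [(x3 t ht).2 hz]
        have k2 : χ t (R x) = 0 := by by_contra hz; linarith [(y3 t ht).2 hz]
        exact hne (by beta_reduce; rw [k1, k2]; norm_num)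
      have hd2 : ‖x - s t‖ < r / 2 ∨ ‖x - R (s t)‖ < r / 2 := by
        rcases hd with hd | hd
        · rcases hs3 t x with k | k
          · exact Or.inl (k ▸ hd)
          · exact Or.inr (k ▸ hd)
        · have f1 : ‖R x - s t‖ = ‖x - R (s t)‖ := by
            rw [← R.norm_map (R x - s t), map_sub, hRR]
          have f2 : ‖R x - R (s t)‖ = ‖x - s t‖ := by rw [← map_sub, R.norm_map]
          rcases hs3 t (R x) with k | k
          · rw [k, f1] at hd; exact Or.inr hd
          · rw [k, f2] at hd; exact Or.inl hd
      rw [mem_ball, dist_eq_norm]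
      rcases hd2 with hd | hd
      · linarith
      · have k1 := refl_dist hν hR x (s t)
        have k2 : ‖x - R (s t)‖ ^ 2 ≤ (r / 2) ^ 2 := by gcongr
        have k3 : ⟪s t, ν⟫ ≤ 5 := by
          have := real_inner_le_norm (s t) ν
          rwa [hν, mul_one, hsn t ht] at this
        have k4 : -⟪x, ν⟫ * ⟪s t, ν⟫ ≤ 3 * ε * 5 :=
          mul_le_mul (by linarith) k3 (hs1 t) (by positivity)
        refine lt_of_pow_lt_pow_left₀ 2 hr0.le ?_
        have : 0 < r ^ 2 := by positivity
        linarith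
  have hH2 : ∀ x ∈ sphere (0 : E N) 5, |H x| ≤ 2 := by
    intro x hx
    obtain ⟨p, p1, p2, p3, p4⟩ := hp x hx
    have u1 := avg_le p1 p2 (W := fun t => a t / ε) (A := 1) (fun t ht _ => (abs_le.1 (hW1 t ht)).2)
    have u2 := avg_le p1 p2 (W := fun t => -(a t / ε)) (A := 1) (fun t ht _ => by linarith [(abs_le.1 (hW1 t ht)).1])
    simp only [mul_neg, Finset.sum_neg_distrib] at u2
    rw [abs_le] at *
    constructor <;> linarith
  have hH3 : ∀ x ∈ closedBall (0 : E N) 5, |H x| ≤ 2 := by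
    intro x hx
    have q1 := max_princ' d1 (c := 0) (r := 5) (m := 2) (fun x _ => (d2 x).ge) (fun x hx => (abs_le.1 (hH2 x hx)).2) hN x hx
    have q2 := max_princ' (contDiff_const.mul d1 : ContDiff ℝ 2 (fun y => (-1) * H y)) (c := 0) (r := 5) (m := 2)
      (fun x _ => by rw [lap_smul _ d1, d2, mul_zero]) (fun x hx => by linarith [(abs_le.1 (hH2 x hx)).1]) hN x hx
    exact abs_le.2 ⟨by linarith, q1⟩
  have hsp : sphere (0 : E N) 5 ⊆ ball 0 20 := fun x hx => by
    rw [mem_sphere_zero_iff_norm] at hx; rw [mem_ball_zero_iff, hx]; norm_num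
  obtain ⟨c1, c2⟩ := IF_cmp hN hμ hm hκ0 hκ hε hδ0 hδ1 hG'0 e2 hν hW hF d1 d2 (fun x hx => (d3 x hx).1) (fun x hx => (d3 x hx).2)
    (fun x hx => by
      have hh2 := (abs_le.1 (hH2 x hx)).2
      rcases lt_or_ge ⟪x, ν⟫ (-(3 * ε)) with hlt | hge
      · have := hW.nn x (hsp hx)
        have : ε * (H x - 3 * δ) ≤ ε * 3 := by gcongr; linarith
        linarith
      · obtain ⟨p, p1, p2, p3, p4⟩ := hp x hx
        have u1 := avg_le p1 p2 (W := fun t => a t / ε) (A := (u x - ⟪x, ν⟫) / ε) (fun t ht hne => by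
          have := (hab t ht).2.2.2.2.lo (p4 t ht hne hge)
          gcongr; linarith)
        have u2 : H x - 3 * δ ≤ (u x - ⟪x, ν⟫) / ε := by linarith [(abs_le.1 p3).2]
        rw [le_div_iff₀ hε] at u2
        linarith) (fun x hx hpF => by
      have hge : -(3 * ε) ≤ ⟪x, ν⟫ := by
        rcases hpF with hp | hp
        · linarith [hF.pos (hsp hx) hp]
        · linarith [(hF.fpt (hsp hx) hp).2]
      obtain ⟨p, p1, p2, p3, p4⟩ := hp x hx
      have u1 := avg_le p1 p2 (W := fun t => -(a t / ε)) (A := 2 * δ - (u x - ⟪x, ν⟫) / ε) (fun t ht hne => by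
          have hx' := p4 t ht hne hge
          obtain ⟨k1, k2, k3, k4, k5⟩ := hab t ht
          have k6 : u x ≤ ⟪x, ν⟫ + b t := by
            rcases hpF with hp | hp
            · exact k5.pos hx' hp
            · rw [hp.1]; exact (k5.fpt hx' hp).2
          have : (u x - ⟪x, ν⟫) / ε ≤ (a t + 2 * δ * ε) / ε := by gcongr; linarith
          have e : (a t + 2 * δ * ε) / ε = a t / ε + 2 * δ := by field_simp
          linarith)
      simp only [mul_neg, Finset.sum_neg_distrib] at u1
      have u2 : (u x - ⟪x, ν⟫) / ε ≤ H x + 3 * δ := by linarith [(abs_le.1 p3).1]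
      rw [div_le_iff₀ hε] at u2
      linarith)
  refine IF_fin hN hL hρ hρ1 hδ hε (by linarith) hν (fun x hx => hW.nn x (closedBall_subset_ball (by norm_num) hx)) hF0 d1 d2
    (fun x hx => hH3 x (closedBall_subset_closedBall (by norm_num) hx)) ?_ c1 c2
  have := (d3 0 (mem_closedBall_self (by norm_num))).2
  rw [inner_zero_left, abs_zero, mul_zero] at this
  exact abs_nonpos_iff.1 this
end IF2sec

section PTsec
variable {N : ℕ}

lemma IT2 {μ L ρ ε0 : ℝ} (hρ : 0 < ρ)
    (hIF : ∀ (ν : E N) (u : E N → ℝ) (ε κ : ℝ), ‖ν‖ = 1 → 0 ≤ κ → κ ≤ ε ^ 2 → 0 < ε → ε ≤ ε0 →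
    WS μ κ (1 - κ) (1 + κ) 0 20 u → Flat ν (-ε) ε 0 20 u → Fpt u 0 →
    ∃ ν' : E N, ‖ν'‖ = 1 ∧ ‖ν' - ν‖ ≤ 4 * L * ε ∧ Flat ν' (-(ε * ρ / 2)) (ε * ρ / 2) 0 (20 * ρ) u)
    {ε : ℝ} (hε : 0 < ε) (hε0 : ε ≤ ε0) {v : E N → ℝ} {e : E N} (he : ‖e‖ = 1) (hF : Flat e (-ε) ε 0 20 v) (h0 : Fpt v 0)
    (hW : ∀ k : ℕ, WS μ ((ε * (1/2) ^ k) ^ 2) (1 - (ε * (1/2) ^ k) ^ 2) (1 + (ε * (1/2) ^ k) ^ 2) 0 20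
      (fun y => v (0 + ρ ^ k • y) / (1 * ρ ^ k))) :
    ∃ ν : ℕ → E N, ν 0 = e ∧ ∀ k, ‖ν k‖ = 1 ∧ ‖ν (k + 1) - ν k‖ ≤ 4 * L * (ε * (1/2) ^ k) ∧
      Flat (ν k) (-(ε * (1/2) ^ k * ρ ^ k)) (ε * (1/2) ^ k * ρ ^ k) 0 (20 * ρ ^ k) v := by
  let P : ℕ → E N → Prop := fun k ν => ‖ν‖ = 1 ∧
    Flat ν (-(ε * (1/2) ^ k * ρ ^ k)) (ε * (1/2) ^ k * ρ ^ k) 0 (20 * ρ ^ k) v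
  have step : ∀ k (ν : {ν // P k ν}), ∃ ν' : {ν // P (k + 1) ν}, ‖ν'.1 - ν.1‖ ≤ 4 * L * (ε * (1/2) ^ k) := by
    intro k ν
    obtain ⟨ν, hν, hFl⟩ := ν
    have hs : 0 < ρ ^ k := pow_pos hρ k
    have hF1 := (Flat.scale hs).1 hFl
    rw [inner_zero_left, zero_add, zero_add, neg_div, mul_div_cancel_right₀ _ hs.ne'] at hF1
    obtain ⟨ν', h1, h2, h3⟩ := hIF ν _ (ε * (1/2) ^ k) ((ε * (1/2) ^ k) ^ 2) hν (by positivity) le_rfl (by positivity)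
      ((mul_le_of_le_one_right hε.le (pow_le_one₀ (by norm_num) (by norm_num))).trans hε0) (hW k) hF1
      ((Fpt_comp hs (by positivity) 0).2 (by simpa using h0))
    refine ⟨⟨ν', h1, ?_⟩, h2⟩
    rw [show 20 * ρ ^ (k + 1) = 20 * ρ * ρ ^ k by ring]
    rw [Flat.scale hs, inner_zero_left, zero_add, zero_add]
    have e1 : ε * (1/2) ^ (k + 1) * ρ ^ (k + 1) / ρ ^ k = ε * (1 / 2) ^ k * ρ / 2 := by
      rw [div_eq_iff hs.ne']; ring
    rw [neg_div, e1]
    exact h3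
  choose F hFs using step
  let ν : (k : ℕ) → {ν // P k ν} := fun k => Nat.rec ⟨e, he, by simpa using hF⟩ (fun k ν => F k ν) k
  exact ⟨fun k => (ν k).1, rfl, fun k => ⟨(ν k).2.1, hFs k (ν k), (ν k).2.2⟩⟩

lemma PT0 {L ρ ε β : ℝ} (hL : 100 ≤ L) (hρ : 0 < ρ) (hρ1 : ρ < 1) (hε : 0 < ε) (hβ0 : 0 < β) (hβ1 : β < 1)
    (hβ : ρ ^ β = 1 / 2) {v : E N → ℝ} {ν : ℕ → E N}
    (h : ∀ k, ‖ν k‖ = 1 ∧ ‖ν (k + 1) - ν k‖ ≤ 4 * L * (ε * (1/2) ^ k) ∧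
      Flat (ν k) (-(ε * (1/2) ^ k * ρ ^ k)) (ε * (1/2) ^ k * ρ ^ k) 0 (20 * ρ ^ k) v) :
    ∃ ν0 : E N, ‖ν0‖ = 1 ∧ ‖ν0 - ν 0‖ ≤ 8 * L * ε ∧ ∀ z, Fpt v z → ‖z‖ ≤ 10 →
      |⟪z, ν0⟫| ≤ 100 * L * ε / ρ ^ 2 * ‖z‖ ^ (1 + β) := by
  have hd : ∀ k, dist (ν k) (ν (k + 1)) ≤ (8 * L * ε) / 2 / 2 ^ k := fun k => by
    rw [dist_comm, dist_eq_norm]; refine (h k).2.1.trans (le_of_eq ?_)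
    rw [one_div, inv_pow]; field_simp; norm_num
  obtain ⟨ν0, hν0⟩ := cauchySeq_tendsto_of_complete (cauchySeq_of_le_geometric_two hd)
  have hk := fun k => dist_le_of_le_geometric_two_of_tendsto hd hν0 k
  refine ⟨ν0, ?_, ?_, fun z hz hz1 => ?_⟩
  · have h1 : Tendsto (fun k => ‖ν k‖) atTop (𝓝 ‖ν0‖) := hν0.norm
    simp only [(h _).1] at h1
    exact tendsto_nhds_unique h1 tendsto_const_nhds
  · have := hk 0
    rw [dist_comm, dist_eq_norm] at this; simpa using this
  · by_cases hz0 : z = 0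
    · rw [hz0, inner_zero_left, abs_zero]; positivity
    have hzn : 0 < ‖z‖ := norm_pos_iff.2 hz0
    obtain ⟨k, k1, k2⟩ := exists_nat_pow_near_of_lt_one (x := ‖z‖ / 10) (y := ρ) (by positivity) (by linarith) hρ hρ1
    have hs : 0 < ρ ^ k := pow_pos hρ k
    obtain ⟨f1, f2⟩ := (h k).2.2.fpt (x := z) (by rw [mem_ball_zero_iff]; linarith) hz
    have g1 : |⟪z, ν k⟫| ≤ ε * (1/2) ^ k * ρ ^ k := abs_le.2 ⟨by linarith, by linarith⟩
    have g2 : |⟪z, ν0 - ν k⟫| ≤ (10 * ρ ^ k) * (8 * L * ε * (1/2) ^ k) := by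
      refine (abs_real_inner_le_norm _ _).trans ?_
      gcongr
      · linarith
      · have := hk k
        rw [dist_comm, dist_eq_norm] at this
        rwa [one_div, inv_pow, ← div_eq_mul_inv]
    have g3 : |⟪z, ν0⟫| ≤ 100 * L * ε * (ρ ^ k * (1/2) ^ k) := by
      rw [show ν0 = ν k + (ν0 - ν k) by abel, inner_add_right]
      refine (abs_add_le _ _).trans ?_
      have : ε * 100 ≤ ε * L := by gcongr
      have p : 0 ≤ (1/2 : ℝ) ^ k * ρ ^ k := by positivity
      have := mul_le_mul_of_nonneg_right this p
      have : 0 ≤ ε * ((1/2 : ℝ) ^ k * ρ ^ k) := by positivity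
      linarith
    have g4 : ρ ^ k * (1/2) ^ k = (ρ ^ k) ^ (1 + β) := by
      rw [Real.rpow_add hs, Real.rpow_one, ← hβ, ← Real.rpow_natCast (ρ ^ β) k, ← Real.rpow_natCast ρ k,
        ← Real.rpow_mul hρ.le, ← Real.rpow_mul hρ.le, mul_comm β]
    have g5 : ρ ^ k ≤ ‖z‖ / ρ := by
      rw [le_div_iff₀ hρ]
      rw [pow_succ] at k1
      linarith
    have g6 : (ρ ^ k) ^ (1 + β) ≤ (‖z‖ / ρ) ^ (1 + β) := Real.rpow_le_rpow hs.le g5 (by linarith)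
    have g7 : (‖z‖ / ρ) ^ (1 + β) ≤ ‖z‖ ^ (1 + β) / ρ ^ 2 := by
      rw [Real.div_rpow hzn.le hρ.le]
      have : ρ ^ 2 ≤ ρ ^ (1 + β) := by
        rw [← Real.rpow_natCast ρ 2]
        exact Real.rpow_le_rpow_of_exponent_ge hρ hρ1.le (by push_cast; linarith)
      gcongr
    calc |⟪z, ν0⟫| ≤ 100 * L * ε * (ρ ^ k * (1/2) ^ k) := g3
      _ ≤ 100 * L * ε * (‖z‖ ^ (1 + β) / ρ ^ 2) := by rw [g4]; gcongr; exact g6.trans g7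
      _ = _ := by ring

lemma flat_init {u : E N → ℝ} {e x0 : E N} {η q s ε : ℝ} (he : ‖e‖ = 1) (hs : s = 1 / 80) (hη0 : 0 ≤ η) (hη : 400 * η ≤ ε) (hη1 : η ≤ 1/2)
    (hq : |q - 1| ≤ η) (hF : Flat e (-η) η 0 1 u) (hb : ball x0 (1/4) ⊆ ball 0 1) (h0 : Fpt u x0) :
    Flat e (-ε) ε 0 20 (fun y => u (x0 + s • y) / (q * s)) := by
  obtain ⟨q1, q2⟩ := abs_le.1 hq
  have hs0 : 0 < s := by rw [hs]; norm_num
  have hq0 : 1/2 ≤ q := by linarith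
  have hqs : 0 < q * s := by positivity
  obtain ⟨f1, f2⟩ := hF.fpt (hb (mem_ball_self (by norm_num))) h0
  intro x hx
  have hx' : x0 + s • x ∈ ball (0 : E N) 1 := hb (by
    rw [show (1/4 : ℝ) = 20 * s by rw [hs]; norm_num]; exact (mem_scale hs0).2 hx)
  obtain ⟨h1, h2⟩ := hF _ hx'
  rw [inner_add_left, real_inner_smul_left] at h1 h2
  have hxe : |⟪x, e⟫| ≤ 20 := by
    have := abs_real_inner_le_norm x e
    rw [he, mul_one] at this; rw [mem_ball_zero_iff] at hx; linarith
  have k1 : |(q - 1) * ⟪x, e⟫| ≤ η * 20 := by rw [abs_mul]; gcongr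
  obtain ⟨k2, k3⟩ := abs_le.1 k1
  have k4 : ε * (1/2) ≤ ε * q := by gcongr; linarith
  rw [hs] at *
  constructor
  · beta_reduce
    rw [le_div_iff₀ hqs, max_mul_of_nonneg _ _ hqs.le, zero_mul]
    refine le_trans (max_le_max ?_ le_rfl) h1
    linarith
  · beta_reduce
    rw [div_le_iff₀ hqs, max_mul_of_nonneg _ _ hqs.le, zero_mul]
    refine h2.trans (max_le_max ?_ le_rfl)
    linarith
end PTsec

section PTs2
variable {N : ℕ}

lemma PT1 {μ α ρ ε εt q s : ℝ} (hμ : 0 ≤ μ) (hρ : 0 < ρ) (hρ4 : ρ ≤ 1/4) (hα : 0 < α) (hρα : ρ ^ α ≤ 1/4)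
    (hs : s = 1 / 80) (hε : 0 < ε) (ht0 : 0 < εt) (ht : εt * (2:ℝ) ^ (μ + 1) ≤ ε ^ 2)
    (hq : 1/2 ≤ q) {u : E N → ℝ} {x0 : E N}
    (hW : ∀ σ, 0 < σ → σ ≤ 1/4 → WS μ εt (q - εt * σ ^ α) (q + εt * σ ^ α) x0 σ u) (k : ℕ) :
    WS μ ((ε * (1/2) ^ k) ^ 2) (1 - (ε * (1/2) ^ k) ^ 2) (1 + (ε * (1/2) ^ k) ^ 2) 0 20
      (fun y => (fun y => u (x0 + s • y) / (q * s)) (0 + ρ ^ k • y) / (1 * ρ ^ k)) := by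
  have hs0 : 0 < s := by rw [hs]; norm_num
  have hq0 : 0 < q := by linarith
  have hk : 0 < ρ ^ k := pow_pos hρ k
  have hk1 : ρ ^ k ≤ (1/4) ^ k := pow_le_pow_left₀ hρ.le hρ4 k
  have hk2 : ρ ^ k ≤ 1 := pow_le_one₀ hρ.le (by linarith)
  have e20 : 20 * (s * ρ ^ k) = ρ ^ k / 4 := by rw [hs]; ring
  have hsk : 0 < s * ρ ^ k := by positivity
  have h1 := (hW (20 * (s * ρ ^ k)) (by positivity) (by rw [e20]; linarith)).scale (r := 20) (x1 := x0) hsk hq0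
    (fun y hy => (mem_scale hsk).2 hy)
  have e2 : (fun y => (fun y => u (x0 + s • y) / (q * s)) (0 + ρ ^ k • y) / (1 * ρ ^ k)) =
      (fun y => u (x0 + (s * ρ ^ k) • y) / (q * (s * ρ ^ k))) := by
    funext y
    beta_reduce
    rw [zero_add, smul_smul, one_mul, div_div, mul_assoc]
  rw [e2]
  have e3 : (ε * (1/2) ^ k) ^ 2 = ε ^ 2 * (1/4) ^ k := by
    rw [mul_pow, ← pow_mul, mul_comm k 2, pow_mul]; norm_num
  have h2 : (2:ℝ) ≤ 2 ^ (μ + 1) := by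
    have := Real.rpow_le_rpow_of_exponent_le (x := 2) (by norm_num) (show (1:ℝ) ≤ μ + 1 by linarith)
    rwa [Real.rpow_one] at this
  have hqm : 1 ≤ 2 ^ (μ + 1) * q ^ (μ + 1) := by
    rw [← Real.mul_rpow (by norm_num) hq0.le]
    exact Real.one_le_rpow (by linarith) (by linarith)
  have hqp : 0 < q ^ (μ + 1) := Real.rpow_pos_of_pos hq0 _
  have hσ : (20 * (s * ρ ^ k)) ^ α ≤ (1/4) ^ k := by
    rw [e20]
    calc (ρ ^ k / 4) ^ α ≤ (ρ ^ k) ^ α := Real.rpow_le_rpow (by positivity) (by linarith) hα.le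
      _ = (ρ ^ α) ^ k := by rw [← Real.rpow_natCast, ← Real.rpow_natCast, ← Real.rpow_mul hρ.le, ← Real.rpow_mul hρ.le, mul_comm]
      _ ≤ _ := pow_le_pow_left₀ (by positivity) hρα k
  have hp4 : 0 < (1/4 : ℝ) ^ k := by positivity
  have hb : εt * (20 * (s * ρ ^ k)) ^ α ≤ ε ^ 2 * (1/4) ^ k * q := by
    calc εt * (20 * (s * ρ ^ k)) ^ α ≤ εt * (1/4) ^ k := by gcongr
      _ ≤ (εt * 2) * (1/4) ^ k * q := by
        have : εt * (1/4) ^ k * (1/2) ≤ εt * (1/4) ^ k * q := by gcongr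
        linarith
      _ ≤ (εt * 2 ^ (μ + 1)) * (1/4) ^ k * q := by gcongr
      _ ≤ _ := by gcongr
  refine h1.mono subset_rfl ?_ ?_ ?_
  · rw [e3, div_le_iff₀ hqp]
    calc εt * (s * ρ ^ k) ≤ εt * (1 * (1/4) ^ k) := by gcongr; rw [hs]; norm_num
      _ = εt * (1/4) ^ k * 1 := by ring
      _ ≤ εt * (1/4) ^ k * (2 ^ (μ + 1) * q ^ (μ + 1)) := by gcongr
      _ = (εt * 2 ^ (μ + 1)) * (1/4) ^ k * q ^ (μ + 1) := by ring
      _ ≤ _ := by gcongr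
  · rw [e3, le_div_iff₀ hq0]; linarith
  · rw [e3, div_le_iff₀ hq0]; linarith

lemma PT (hN : 0 < N) {μ α : ℝ} (hμ : 0 ≤ μ) (hα : 0 < α) : ∃ εt β : ℝ, 0 < εt ∧ εt ≤ 1 / 100 ∧ 0 < β ∧ β < 1 ∧
    ∀ (u : E N → ℝ) (e : E N), ‖e‖ = 1 → Flat e (-εt) εt 0 1 u →
    (∀ x0 ∈ ball (0 : E N) 1, ∃ q : ℝ, |q - 1| ≤ εt ∧ ∀ σ, 0 < σ → ball x0 σ ⊆ ball 0 1 →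
      WS μ εt (q - εt * σ ^ α) (q + εt * σ ^ α) x0 σ u) →
    ∀ x0 ∈ ball (0 : E N) (3/4), Fpt u x0 → ∃ ν0 : E N, ‖ν0‖ = 1 ∧ ‖ν0 - e‖ ≤ 1/4 ∧
      ∀ y, Fpt u y → ‖y - x0‖ ≤ 1/8 → |⟪y - x0, ν0⟫| ≤ 1/4 * ‖y - x0‖ ^ (1 + β) := by
  obtain ⟨L, hL, hIF⟩ := IF hN hμ
  obtain ⟨ρ, hρd⟩ : ∃ ρ, ρ = min (min (1/4) (1 / (6400 * L ^ 2))) ((1/4) ^ (1/α)) := ⟨_, rfl⟩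
  have hρ : 0 < ρ := by rw [hρd]; refine lt_min (lt_min (by norm_num) (by positivity)) (by positivity)
  have hρ4 : ρ ≤ 1/4 := by rw [hρd]; exact (min_le_left _ _).trans (min_le_left _ _)
  have hρL : 6400 * L ^ 2 * ρ ≤ 1 := by
    have : ρ ≤ 1 / (6400 * L ^ 2) := by rw [hρd]; exact (min_le_left _ _).trans (min_le_right _ _)
    rw [le_div_iff₀ (by positivity)] at this; linarith
  have hρα : ρ ^ α ≤ 1/4 := by
    have h1 : ρ ≤ (1/4) ^ (1/α) := by rw [hρd]; exact min_le_right _ _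
    calc ρ ^ α ≤ ((1/4) ^ (1/α)) ^ α := Real.rpow_le_rpow hρ.le h1 hα.le
      _ = 1/4 := by rw [← Real.rpow_mul (by norm_num), one_div_mul_cancel hα.ne', Real.rpow_one]
  obtain ⟨ε0, hε0, hε1, hIF⟩ := hIF ρ hρ hρL
  have hlρ : Real.log ρ < Real.log (1/2) := Real.log_lt_log hρ (by linarith)
  have hl2 : Real.log (1/2) < 0 := Real.log_neg (by norm_num) (by norm_num)
  obtain ⟨β, hβd⟩ : ∃ β, β = Real.log (1/2) / Real.log ρ := ⟨_, rfl⟩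
  have hβ0 : 0 < β := by rw [hβd]; exact div_pos_of_neg_of_neg hl2 (by linarith)
  have hβ1 : β < 1 := by rw [hβd, div_lt_one_of_neg (by linarith)]; exact hlρ
  have hβ : ρ ^ β = 1/2 := by
    rw [Real.rpow_def_of_pos hρ, hβd, mul_div_cancel₀ _ (by linarith), Real.exp_log (by norm_num)]
  obtain ⟨ε, hεd⟩ : ∃ ε, ε = min ε0 (ρ ^ 2 / (32000 * L)) := ⟨_, rfl⟩
  have hL0 : 0 < L := by linarith
  have hε : 0 < ε := by rw [hεd]; exact lt_min hε0 (by positivity)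
  have hεε : ε ≤ ε0 := by rw [hεd]; exact min_le_left _ _
  have hεL : ε * (32000 * L) ≤ ρ ^ 2 := by
    rw [← le_div_iff₀ (by positivity), hεd]; exact min_le_right _ _
  obtain ⟨εt, htd⟩ : ∃ εt, εt = min (min (1/100) (ε / 400)) (ε ^ 2 / (2:ℝ) ^ (μ + 1)) := ⟨_, rfl⟩
  have h2p : 0 < (2:ℝ) ^ (μ + 1) := by positivity
  have ht0 : 0 < εt := by rw [htd]; exact lt_min (lt_min (by norm_num) (by positivity)) (by positivity)
  have ht1 : εt ≤ 1/100 := by rw [htd]; exact (min_le_left _ _).trans (min_le_left _ _)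
  have ht2 : 400 * εt ≤ ε := by
    have : εt ≤ ε / 400 := by rw [htd]; exact (min_le_left _ _).trans (min_le_right _ _)
    linarith
  have ht3 : εt * (2:ℝ) ^ (μ + 1) ≤ ε ^ 2 := by
    rw [← le_div_iff₀ h2p, htd]; exact min_le_right _ _
  refine ⟨εt, β, ht0, ht1, hβ0, hβ1, fun u e he hFl hW x0 hx0 hF0 => ?_⟩
  rw [mem_ball_zero_iff] at hx0
  have hb : ball x0 (1/4) ⊆ ball (0 : E N) 1 := ball_subset_ball' (by rw [dist_zero_right]; linarith)
  obtain ⟨q, hq, hWq⟩ := hW x0 (hb (mem_ball_self (by norm_num)))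
  obtain ⟨q1, q2⟩ := abs_le.1 hq
  obtain ⟨s, hs⟩ : ∃ s : ℝ, s = 1 / 80 := ⟨_, rfl⟩
  have hs0 : 0 < s := by rw [hs]; norm_num
  have hq0 : 0 < q := by linarith
  have hqs : 0 < q * s := by positivity
  have f1 := flat_init he hs ht0.le ht2 (by linarith) hq hFl hb hF0
  obtain ⟨ν, hν0, hν⟩ := IT2 hρ hIF hε hεε he f1 ((Fpt_comp hs0 hqs 0).2 (by simpa using hF0))
    (PT1 hμ hρ hρ4 hα hρα hs hε ht0 ht3 (by linarith) (fun σ h1 h2 => hWq σ h1 ((ball_subset_ball h2).trans hb)))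
  obtain ⟨ν0, n1, n2, n3⟩ := PT0 hL hρ (by linarith) hε hβ0 hβ1 hβ hν
  have hρ2 : ρ ^ 2 ≤ 1 := pow_le_one₀ hρ.le (by linarith)
  refine ⟨ν0, n1, by rw [hν0] at n2; linarith, fun y hy hyx => ?_⟩
  obtain ⟨z, hz⟩ : ∃ z : E N, y - x0 = s • z := ⟨s⁻¹ • (y - x0), by rw [smul_inv_smul₀ hs0.ne']⟩
  have hy' : y = x0 + s • z := by rw [← hz]; abel
  have hnz : ‖y - x0‖ = s * ‖z‖ := by rw [hz, norm_smul, Real.norm_of_nonneg hs0.le]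
  have k := n3 z ((Fpt_comp hs0 hqs z).2 (by rw [← hy']; exact hy)) (by rw [hnz, hs] at hyx; linarith)
  rw [hnz, hz, real_inner_smul_left, abs_mul, abs_of_pos hs0, Real.mul_rpow hs0.le (norm_nonneg _)]
  have hz0 : 0 ≤ ‖z‖ ^ (1 + β) := by positivity
  have hsb : s ^ 2 ≤ s ^ (1 + β) := by
    rw [← Real.rpow_natCast s 2]
    exact Real.rpow_le_rpow_of_exponent_ge hs0 (by rw [hs]; norm_num) (by push_cast; linarith)
  have hc : 100 * L * ε / ρ ^ 2 ≤ 1 / 320 := by rw [div_le_iff₀ (by positivity)]; linarith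
  calc s * |⟪z, ν0⟫| ≤ s * (1 / 320 * ‖z‖ ^ (1 + β)) := by
        gcongr; exact k.trans (by gcongr)
    _ = 1/4 * (s ^ 2 * ‖z‖ ^ (1 + β)) := by rw [hs]; ring
    _ ≤ _ := by gcongr
end PTs2

section Gr
variable {V : Type*} [NormedAddCommGroup V] [InnerProductSpace ℝ V] [FiniteDimensional ℝ V]

lemma whit {g : V → ℝ} {A : V → V} {C M r β : ℝ} (hC : 0 ≤ C) (hM : 0 ≤ M) (hr : 0 < r) (hβ : 0 < β) (hβ1 : β < 1)
    (h : ∀ y y', ‖y' - y‖ ≤ r → |g y' - g y - ⟪A y, y' - y⟫| ≤ C * ‖y' - y‖ ^ (1 + β)) (hA : ∀ y, ‖A y‖ ≤ M) :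
    (∀ y, HasGradientAt g (A y) y) ∧ ∃ K, ∀ y z, ‖A y - A z‖ ≤ K * ‖y - z‖ ^ β := by
  constructor
  · intro y
    rw [hasGradientAt_iff_isLittleO]
    have h1 : (fun x' => g x' - g y - ⟪A y, x' - y⟫) =O[𝓝 y] (fun x' => ‖x' - y‖ ^ (1 + β)) := by
      refine Asymptotics.IsBigO.of_bound C ?_
      filter_upwards [Metric.closedBall_mem_nhds y hr] with x hx
      rw [mem_closedBall, dist_eq_norm] at hx
      rw [Real.norm_eq_abs, Real.norm_of_nonneg (by positivity)]
      exact h y x hx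
    refine h1.trans_isLittleO ?_
    have h2 : (fun x' : V => ‖x' - y‖ ^ (1 + β)) = fun x' => ‖x' - y‖ ^ β * ‖x' - y‖ := by
      funext x
      rw [add_comm, Real.rpow_add_one' (norm_nonneg _) (by linarith)]
    rw [h2]
    have h3 : (fun x' : V => ‖x' - y‖ ^ β * ‖x' - y‖) =o[𝓝 y] (fun x' => (1 : ℝ) * ‖x' - y‖) := by
      refine Asymptotics.IsLittleO.mul_isBigO ?_ (Asymptotics.isBigO_refl _ _)
      rw [Asymptotics.isLittleO_one_iff]
      have : Tendsto (fun x' : V => ‖x' - y‖ ^ β) (𝓝 y) (𝓝 (‖y - y‖ ^ β)) :=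
        (((continuous_id.sub continuous_const).norm).rpow_const (fun _ => Or.inr hβ.le)).tendsto y
      rwa [sub_self, norm_zero, Real.zero_rpow hβ.ne'] at this
    simp only [one_mul] at h3
    exact h3.of_norm_right
  · refine ⟨6 * C + 2 * M / (r / 2) ^ β, fun y z => ?_⟩
    have hrb : 0 < (r / 2) ^ β := by positivity
    by_cases hd : r / 2 ≤ ‖y - z‖
    · have h1 : (r / 2) ^ β ≤ ‖y - z‖ ^ β := Real.rpow_le_rpow (by positivity) hd hβ.le
      have h2 : ‖A y - A z‖ ≤ 2 * M := (norm_sub_le _ _).trans (by linarith [hA y, hA z])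
      calc ‖A y - A z‖ ≤ 2 * M / (r / 2) ^ β * (r / 2) ^ β := by rw [div_mul_cancel₀ _ hrb.ne']; exact h2
        _ ≤ 2 * M / (r / 2) ^ β * ‖y - z‖ ^ β := by gcongr
        _ ≤ _ := by gcongr; linarith
    · push Not at hd
      by_cases hw : A y - A z = 0
      · rw [hw, norm_zero]; positivity
      have hwn : 0 < ‖A y - A z‖ := norm_pos_iff.2 hw
      by_cases hyz : y = z
      · rw [hyz, sub_self] at hw; exact absurd rfl hw
      obtain ⟨d, hdd⟩ : ∃ d, d = ‖y - z‖ := ⟨_, rfl⟩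
      have hd0 : 0 < d := by rw [hdd]; exact norm_pos_iff.2 (sub_ne_zero.2 hyz)
      rw [← hdd] at hd ⊢
      obtain ⟨k, hk⟩ : ∃ k : V, k = (d / ‖A y - A z‖) • (A y - A z) := ⟨_, rfl⟩
      have hkn : ‖k‖ = d := by
        rw [hk, norm_smul, Real.norm_of_nonneg (by positivity), div_mul_cancel₀ _ hwn.ne']
      have hki : ⟪A y - A z, k⟫ = d * ‖A y - A z‖ := by
        rw [hk, real_inner_smul_right, real_inner_self_eq_norm_sq]; field_simp
      have a1 := h y (y + k) (by rw [add_sub_cancel_left, hkn]; linarith)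
      have a2 := h z y (by rw [← hdd]; linarith)
      have e3 : y + k - z = (y - z) + k := by abel
      have n3 : ‖y + k - z‖ ≤ 2 * d := by rw [e3]; refine (norm_add_le _ _).trans (by rw [hkn, ← hdd]; linarith)
      have a3 := h z (y + k) (by linarith)
      have n4 : ‖y + k - z‖ ^ (1 + β) ≤ 4 * d ^ (1 + β) := by
        calc ‖y + k - z‖ ^ (1 + β) ≤ (2 * d) ^ (1 + β) := Real.rpow_le_rpow (norm_nonneg _) n3 (by linarith)
          _ = 2 ^ (1 + β) * d ^ (1 + β) := Real.mul_rpow (by norm_num) hd0.le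
          _ ≤ _ := by
            gcongr
            have := Real.rpow_le_rpow_of_exponent_le (x := 2) (by norm_num) (show 1 + β ≤ (2:ℝ) by linarith)
            refine this.trans (le_of_eq ?_)
            norm_num
      have a3' := a3.trans (mul_le_mul_of_nonneg_left n4 hC)
      rw [add_sub_cancel_left, hkn] at a1
      rw [← hdd] at a2
      rw [e3, inner_add_right] at a3'
      rw [inner_sub_left] at hki
      have b1 := abs_le.1 a1
      have b2 := abs_le.1 a2
      have b3 := abs_le.1 a3'
      have : d * ‖A y - A z‖ ≤ d * (6 * C * d ^ β) := by
        have : d * (6 * C * d ^ β) = 6 * (C * d ^ (1 + β)) := by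
          rw [add_comm 1 β, Real.rpow_add_one' hd0.le (by linarith)]; ring
        rw [this]
        linarith [b1.1, b1.2, b2.1, b2.2, b3.1, b3.2]
      have := le_of_mul_le_mul_left this hd0
      refine this.trans ?_
      gcongr
      have : 0 ≤ 2 * M / (r / 2) ^ β := by positivity
      linarith

lemma glob {g0 : V → ℝ} {a : V → V} {β : ℝ} (hβ : 0 < β) (hβ1 : β < 1)
    (h : ∀ y y' : V, ‖y‖ < 5/8 → ‖y'‖ < 5/8 → ‖y' - y‖ ≤ 1/10 →
      |g0 y' - g0 y - ⟪a y, y' - y⟫| ≤ 2 * ‖y' - y‖ ^ (1 + β))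
    (ha : ∀ y, ‖y‖ < 5/8 → ‖a y‖ ≤ 1) (hg : ∀ y, ‖y‖ < 5/8 → |g0 y| ≤ 1) :
    ∃ g : V → ℝ, Differentiable ℝ g ∧ (∃ K : ℝ, ∀ y z, ‖gradient g y - gradient g z‖ ≤ K * ‖y - z‖ ^ β) ∧
      ∀ y, ‖y‖ < 1/2 → g y = g0 y := by
  let b : ContDiffBump (0 : V) := ⟨1/2, 9/16, by norm_num, by norm_num⟩
  have hb2 : ContDiff ℝ 2 b := b.contDiff
  have hbc : HasCompactSupport b := b.hasCompactSupport
  obtain ⟨K1, hK1⟩ := (hb2.of_le (by norm_num : (1 : WithTop ℕ∞) ≤ 2)).lipschitzWith_of_hasCompactSupport hbc (by norm_num)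
  obtain ⟨K2, hK2⟩ := (hb2.fderiv_right (m := 1) (by norm_num)).lipschitzWith_of_hasCompactSupport (hbc.fderiv ℝ) (by norm_num)
  have hdiff : Differentiable ℝ b := hb2.differentiable (by norm_num)
  have hgr : ∀ y h : V, fderiv ℝ b y h = ⟪gradient b y, h⟫ := fun y h => by
    rw [gradient, InnerProductSpace.toDual_symm_apply]
  have hT : ∀ y y' : V, |b y' - b y - ⟪gradient b y, y' - y⟫| ≤ K2 * ‖y' - y‖ ^ 2 := fun y y' => by
    rw [← hgr, ← Real.norm_eq_abs]
    have := (convex_closedBall y ‖y' - y‖).norm_image_sub_le_of_norm_fderiv_le' (f := b) (φ := fderiv ℝ b y) (C := K2 * ‖y' - y‖)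
      (x := y) (y := y') (𝕜 := ℝ) (fun x _ => hdiff x) (fun x hx => by
        refine (hK2.norm_sub_le x y).trans ?_
        rw [mem_closedBall, dist_eq_norm] at hx
        gcongr) (mem_closedBall_self (norm_nonneg _)) (by rw [mem_closedBall, dist_eq_norm])
    rw [pow_two, ← mul_assoc]; exact this
  have hz : ∀ y : V, 9/16 ≤ ‖y‖ → b y = 0 := fun y hy => b.zero_of_le_dist (by rw [dist_zero_right]; exact hy)
  have hgn : ∀ y, ‖gradient b y‖ ≤ K1 := fun y => by
    rw [gradient, LinearIsometryEquiv.norm_map]; exact norm_fderiv_le_of_lipschitz ℝ hK1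
  have hgz : ∀ y : V, 9/16 < ‖y‖ → gradient b y = 0 := fun y hy => by
    have : (b : V → ℝ) =ᶠ[𝓝 y] fun _ => 0 := by
      filter_upwards [(continuous_norm.isOpen_preimage _ isOpen_Ioi).mem_nhds (show y ∈ norm ⁻¹' Ioi (9/16 : ℝ) from hy)] with x hx
      exact hz x (le_of_lt hx)
    rw [gradient, this.fderiv_eq]; simp
  have hb1 : ∀ y, |b y| ≤ 1 := fun y => abs_le.2 ⟨by linarith [b.nonneg (x := y)], b.le_one⟩
  obtain ⟨A, hA⟩ : ∃ A : V → V, A = fun y => b y • a y + g0 y • gradient b y := ⟨_, rfl⟩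
  have hA0 : ∀ y, 9/16 < ‖y‖ → A y = 0 := fun y hy => by
    rw [hA]; simp [hgz y hy, hz y hy.le]
  obtain ⟨w1, K, hK⟩ := whit (g := fun y => b y * g0 y) (A := A) (C := 2 + K2 + K1) (M := 1 + K1) (r := 1/20) (by positivity)
    (by positivity) (by norm_num) hβ hβ1 (by
    intro y y' hd
    beta_reduce
    have hd0 := norm_nonneg (y' - y)
    have tr1 : ‖y'‖ ≤ ‖y‖ + ‖y' - y‖ := by
      have := norm_add_le y (y' - y); rwa [add_sub_cancel] at this
    have tr2 : ‖y‖ ≤ ‖y'‖ + ‖y' - y‖ := by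
      have := norm_sub_le y' (y' - y); rwa [sub_sub_cancel] at this
    by_cases hc : ‖y‖ < 5/8 ∧ ‖y'‖ < 5/8
    · obtain ⟨c1, c2⟩ := hc
      have t1 := h y y' c1 c2 (by linarith)
      have t2 := hT y y'
      have t3 : |b y' - b y| ≤ K1 * ‖y' - y‖ := by
        have := hK1.norm_sub_le y' y; rwa [Real.norm_eq_abs] at this
      have t4 : |⟪a y, y' - y⟫| ≤ 1 * ‖y' - y‖ := (abs_real_inner_le_norm _ _).trans (by gcongr; exact ha y c1)
      have e : b y' * g0 y' - b y * g0 y - ⟪A y, y' - y⟫ = b y' * (g0 y' - g0 y - ⟪a y, y' - y⟫) +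
          g0 y * (b y' - b y - ⟪gradient b y, y' - y⟫) + (b y' - b y) * ⟪a y, y' - y⟫ := by
        rw [hA]; simp only [inner_add_left, real_inner_smul_left]; ring
      have hsq : ‖y' - y‖ ^ 2 ≤ ‖y' - y‖ ^ (1 + β) := by
        rw [← Real.rpow_natCast _ 2]
        exact Real.rpow_le_rpow_of_exponent_ge' hd0 (by linarith) (by linarith) (by push_cast; linarith)
      rw [e]
      refine (abs_add_three _ _ _).trans ?_
      rw [abs_mul, abs_mul, abs_mul]
      calc _ ≤ 1 * (2 * ‖y' - y‖ ^ (1 + β)) + 1 * (K2 * ‖y' - y‖ ^ 2) + K1 * ‖y' - y‖ * (1 * ‖y' - y‖) := by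
            gcongr
            · exact hb1 _
            · exact hg _ c1
        _ = 2 * ‖y' - y‖ ^ (1 + β) + K2 * ‖y' - y‖ ^ 2 + K1 * ‖y' - y‖ ^ 2 := by ring
        _ ≤ 2 * ‖y' - y‖ ^ (1 + β) + K2 * ‖y' - y‖ ^ (1 + β) + K1 * ‖y' - y‖ ^ (1 + β) := by gcongr
        _ = _ := by ring
    · have hc' : 9/16 < ‖y‖ ∧ 9/16 < ‖y'‖ := by
        by_cases c1 : ‖y‖ < 5/8
        · have : 5/8 ≤ ‖y'‖ := not_lt.1 fun c2 => hc ⟨c1, c2⟩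
          constructor <;> linarith
        · push Not at c1
          constructor <;> linarith
      rw [hA0 y hc'.1, hz y hc'.1.le, hz y' hc'.2.le]
      simp; positivity) (by
    intro y
    by_cases c1 : ‖y‖ < 5/8
    · rw [hA]; beta_reduce
      refine (norm_add_le _ _).trans ?_
      rw [norm_smul, norm_smul, Real.norm_eq_abs, Real.norm_eq_abs]
      calc _ ≤ 1 * 1 + 1 * (K1 : ℝ) := by
            gcongr
            · exact hb1 _
            · exact ha y c1
            · exact hg y c1
            · exact hgn y
        _ = _ := by ring
    · rw [hA0 y (by linarith), norm_zero]; positivity)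
  refine ⟨fun y => b y * g0 y, fun y => (w1 y).differentiableAt, ⟨K, fun y z => ?_⟩, fun y hy => ?_⟩
  · rw [(w1 y).gradient, (w1 z).gradient]; exact hK y z
  · beta_reduce
    rw [b.one_of_mem_closedBall (by rw [mem_closedBall_zero_iff]; exact hy.le), one_mul]
end Gr

section Fin2
variable {N : ℕ}

lemma fb_iff {u : E N → ℝ} (hc : ContinuousOn u (ball 0 1)) (hn : ∀ x ∈ ball (0 : E N) 1, 0 ≤ u x) {x : E N}
    (hx : x ∈ ball (0 : E N) 1) : x ∈ freeBdry (ball 0 1) u ↔ Fpt u x := by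
  have ho : IsOpen (posSet (ball 0 1) u) := hc.isOpen_inter_preimage isOpen_ball isOpen_Ioi
  unfold freeBdry Fpt
  rw [ho.frontier_eq]
  have hb : ball (0 : E N) 1 ∈ 𝓝 x := isOpen_ball.mem_nhds hx
  constructor
  · rintro ⟨⟨h1, h2⟩, -⟩
    refine ⟨le_antisymm (not_lt.1 fun h => h2 ⟨hx, h⟩) (hn x hx), ?_⟩
    rw [mem_closure_iff_frequently] at h1
    exact h1.mono fun y hy => hy.2
  · rintro ⟨h1, h2⟩
    refine ⟨⟨?_, fun h => ?_⟩, hx⟩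
    · rw [mem_closure_iff_frequently]
      exact (h2.and_eventually hb).mono fun y hy => ⟨hy.2, hy.1⟩
    · have := h.2; rw [h1] at this; exact lt_irrefl _ this

lemma ex_fpt {u : E N → ℝ} {e y : E N} {η : ℝ} (he : ‖e‖ = 1) (hη : 0 < η) (hη1 : η ≤ 1/100)
    (hc : ContinuousOn u (ball 0 1)) (hn : ∀ x ∈ ball (0 : E N) 1, 0 ≤ u x) (hF : Flat e (-η) η 0 1 u)
    (hye : ⟪y, e⟫ = 0) (hy : ‖y‖ < 5/8) : ∃ t : ℝ, Fpt u (y + t • e) ∧ |t| ≤ η := by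
  have hin : ∀ t ∈ Icc (-(1/4) : ℝ) (1/4), y + t • e ∈ ball (0 : E N) 1 := fun t ht => by
    rw [mem_ball_zero_iff]
    refine (norm_add_le _ _).trans_lt ?_
    rw [norm_smul, he, mul_one, Real.norm_eq_abs]
    have := abs_le.2 ht
    linarith
  have hie : ∀ t : ℝ, ⟪y + t • e, e⟫ = t := fun t => by
    rw [inner_add_left, hye, real_inner_smul_left, real_inner_self_eq_norm_sq, he]; ring
  have hlc : Continuous fun t : ℝ => y + t • e := by fun_prop
  have hcl : ContinuousOn (fun t : ℝ => u (y + t • e)) (Icc (-(1/4)) (1/4)) := hc.comp hlc.continuousOn hin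
  have hK : IsCompact (Icc (-(1/4) : ℝ) (1/4) ∩ (fun t : ℝ => u (y + t • e)) ⁻¹' {0}) :=
    isCompact_Icc.of_isClosed_subset (hcl.preimage_isClosed_of_isClosed isClosed_Icc isClosed_singleton) inter_subset_left
  have h14 : -(1/4 : ℝ) ∈ Icc (-(1/4) : ℝ) (1/4) := ⟨le_rfl, by norm_num⟩
  obtain ⟨t, ⟨ht1, ht2⟩, ht3⟩ := hK.exists_isGreatest ⟨-(1/4), h14, by
    have := (hF _ (hin _ h14)).2
    rw [hie, max_eq_right (by linarith)] at this
    exact le_antisymm this (hn _ (hin _ h14))⟩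
  have ht2' : u (y + t • e) = 0 := ht2
  have htη : t ≤ η := by
    have := (hF _ (hin _ ht1)).1
    rw [hie, ht2'] at this
    have := (le_max_left _ _).trans this
    linarith
  have hev : ∀ᶠ τ in 𝓝[>] t, 0 < u (y + τ • e) := by
    filter_upwards [Ioo_mem_nhdsGT (show t < 1/4 by linarith)] with τ hτ
    have hm : τ ∈ Icc (-(1/4) : ℝ) (1/4) := ⟨by linarith [ht1.1, hτ.1], hτ.2.le⟩
    refine lt_of_le_of_ne (hn _ (hin _ hm)) fun h0 => ?_
    have := ht3 ⟨hm, h0.symm⟩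
    linarith [hτ.1]
  have htd : Tendsto (fun τ : ℝ => y + τ • e) (𝓝[>] t) (𝓝 (y + t • e)) := (hlc.tendsto t).mono_left nhdsWithin_le_nhds
  have hfp : Fpt u (y + t • e) := ⟨ht2', htd.frequently hev.frequently⟩
  obtain ⟨f1, f2⟩ := hF.fpt (hin t ht1) hfp
  rw [hie] at f1 f2
  exact ⟨t, hfp, abs_le.2 ⟨by linarith, by linarith⟩⟩

lemma key_ineq {β d τ : ℝ} {y w : E N} {e ν0 : E N} (hβ : 0 < β) (hβ1 : β < 1) (he : ‖e‖ = 1) (hν : ‖ν0‖ = 1)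
    (hνe : ‖ν0 - e‖ ≤ 1/4) (hye : ⟪y, e⟫ = 0) (hd : d = ‖y‖) (hw : w = y + τ • e) (hw8 : ‖w‖ ≤ 1/8)
    (h : |⟪w, ν0⟫| ≤ 1/4 * ‖w‖ ^ (1 + β)) :
    31/32 ≤ ⟪ν0, e⟫ ∧ |τ| ≤ d ∧ |τ + ⟪y, ν0⟫ / ⟪ν0, e⟫| ≤ 2 * d ^ (1 + β) := by
  have hc : 31/32 ≤ ⟪ν0, e⟫ := by
    have := norm_sub_sq_real ν0 e
    rw [hν, he] at this
    have h2 : ‖ν0 - e‖ ^ 2 ≤ (1/4) ^ 2 := pow_le_pow_left₀ (norm_nonneg _) hνe 2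
    linarith
  have hc0 : 0 < ⟪ν0, e⟫ := by linarith
  have hd0 : 0 ≤ d := by rw [hd]; exact norm_nonneg _
  have hyν : |⟪y, ν0⟫| ≤ d * (1/4) := by
    have : ⟪y, ν0⟫ = ⟪y, ν0 - e⟫ := by rw [inner_sub_right, hye, sub_zero]
    rw [this, hd]
    exact (abs_real_inner_le_norm _ _).trans (by gcongr)
  have hwn : ‖w‖ ≤ d + |τ| := by
    rw [hw, hd]; refine (norm_add_le _ _).trans ?_
    rw [norm_smul, he, mul_one, Real.norm_eq_abs]
  have hiw : ⟪w, ν0⟫ = ⟪y, ν0⟫ + τ * ⟪ν0, e⟫ := by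
    rw [hw, inner_add_left, real_inner_smul_left, real_inner_comm ν0 e]
  have h1 : ‖w‖ ^ (1 + β) ≤ ‖w‖ := by
    have := Real.rpow_le_rpow_of_exponent_ge' (norm_nonneg w) (by linarith) zero_le_one (show (1:ℝ) ≤ 1 + β by linarith)
    rwa [Real.rpow_one] at this
  have h2 : |τ| * ⟪ν0, e⟫ ≤ |⟪w, ν0⟫| + |⟪y, ν0⟫| := by
    rw [← abs_of_pos hc0, ← abs_mul, show τ * ⟪ν0, e⟫ = ⟪w, ν0⟫ - ⟪y, ν0⟫ by rw [hiw]; ring]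
    exact abs_sub _ _
  have h3 : |τ| * (31/32) ≤ |τ| * ⟪ν0, e⟫ := by gcongr
  have h4 : |τ| ≤ d := by linarith [abs_nonneg τ]
  refine ⟨hc, h4, ?_⟩
  have e1 : τ + ⟪y, ν0⟫ / ⟪ν0, e⟫ = ⟪w, ν0⟫ / ⟪ν0, e⟫ := by rw [hiw]; field_simp; ring
  rw [e1, abs_div, abs_of_pos hc0, div_le_iff₀ hc0]
  have h5 : ‖w‖ ^ (1 + β) ≤ 4 * d ^ (1 + β) := by
    calc ‖w‖ ^ (1 + β) ≤ (2 * d) ^ (1 + β) := Real.rpow_le_rpow (norm_nonneg _) (by linarith) (by linarith)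
      _ = 2 ^ (1 + β) * d ^ (1 + β) := Real.mul_rpow (by norm_num) hd0
      _ ≤ _ := by
        gcongr
        have := Real.rpow_le_rpow_of_exponent_le (x := 2) (by norm_num) (show 1 + β ≤ (2:ℝ) by linarith)
        refine this.trans (le_of_eq ?_)
        norm_num
  have h6 : 0 ≤ d ^ (1 + β) := by positivity
  have h7 : 2 * d ^ (1 + β) * (31/32) ≤ 2 * d ^ (1 + β) * ⟪ν0, e⟫ := by gcongr
  linarith

lemma graph {u : E N → ℝ} {e : E N} {η β : ℝ} (he : ‖e‖ = 1) (hη : 0 < η) (hη1 : η ≤ 1/100) (hβ : 0 < β) (hβ1 : β < 1)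
    (hc : ContinuousOn u (ball 0 1)) (hn : ∀ x ∈ ball (0 : E N) 1, 0 ≤ u x) (hF : Flat e (-η) η 0 1 u)
    (hP : ∀ x0 ∈ ball (0 : E N) (3/4), Fpt u x0 → ∃ ν0 : E N, ‖ν0‖ = 1 ∧ ‖ν0 - e‖ ≤ 1/4 ∧
      ∀ y, Fpt u y → ‖y - x0‖ ≤ 1/8 → |⟪y - x0, ν0⟫| ≤ 1/4 * ‖y - x0‖ ^ (1 + β)) :
    IsC1GraphIn β (freeBdry (ball 0 1) u) (ball 0 (1/2)) := by
  have hVe : ∀ y : ((ℝ ∙ e)ᗮ : Submodule ℝ (E N)), ⟪(y : E N), e⟫ = 0 := fun y => by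
    rw [real_inner_comm]; exact Submodule.mem_orthogonal_singleton_iff_inner_right.1 y.2
  have hflat : ∀ x ∈ ball (0 : E N) 1, Fpt u x → |⟪x, e⟫| ≤ η := fun x hx hfx => by
    obtain ⟨f1, f2⟩ := hF.fpt hx hfx
    exact abs_le.2 ⟨by linarith, by linarith⟩
  have hex : ∀ y : ((ℝ ∙ e)ᗮ : Submodule ℝ (E N)), ∃ t : ℝ, ‖y‖ < 5/8 → Fpt u ((y : E N) + t • e) ∧ |t| ≤ η := fun y => by
    by_cases hy : ‖y‖ < 5/8
    · obtain ⟨t, ht⟩ := ex_fpt he hη hη1 hc hn hF (hVe y) hy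
      exact ⟨t, fun _ => ht⟩
    · exact ⟨0, fun h => absurd h hy⟩
  choose g0 hg0 using hex
  have hν : ∀ y : ((ℝ ∙ e)ᗮ : Submodule ℝ (E N)), ∃ ν0 : E N, ‖y‖ < 5/8 → ‖ν0‖ = 1 ∧ ‖ν0 - e‖ ≤ 1/4 ∧
      ∀ (y' : ((ℝ ∙ e)ᗮ : Submodule ℝ (E N))) (t' : ℝ), Fpt u ((y' : E N) + t' • e) → |t'| ≤ η → ‖y' - y‖ ≤ 1/10 →
      31/32 ≤ ⟪ν0, e⟫ ∧ |t' - g0 y| ≤ ‖y' - y‖ ∧ |(t' - g0 y) + ⟪((y' - y : ((ℝ ∙ e)ᗮ : Submodule ℝ (E N))) : E N), ν0⟫ / ⟪ν0, e⟫| ≤ 2 * ‖y' - y‖ ^ (1 + β) := fun y => by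
    by_cases hy : ‖y‖ < 5/8
    · obtain ⟨g1, g2⟩ := hg0 y hy
      obtain ⟨ν0, n1, n2, n3⟩ := hP _ (by
        rw [mem_ball_zero_iff]
        refine (norm_add_le _ _).trans_lt ?_
        rw [norm_smul, he, mul_one, Real.norm_eq_abs, ← Submodule.coe_norm]; linarith) g1
      refine ⟨ν0, fun _ => ⟨n1, n2, fun y' t' hf ht' hd => ?_⟩⟩
      have hw : (y' : E N) + t' • e - ((y : E N) + g0 y • e) = ((y' - y : ((ℝ ∙ e)ᗮ : Submodule ℝ (E N))) : E N) + (t' - g0 y) • e := by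
        rw [sub_smul, Submodule.coe_sub]; abel
      have hw8 : ‖(y' : E N) + t' • e - ((y : E N) + g0 y • e)‖ ≤ 1/8 := by
        rw [hw]
        refine (norm_add_le _ _).trans ?_
        rw [norm_smul, he, mul_one, Real.norm_eq_abs, ← Submodule.coe_norm]
        have := abs_sub t' (g0 y)
        linarith
      exact key_ineq hβ hβ1 he n1 n2 (hVe (y' - y)) (Submodule.coe_norm _) hw hw8 (n3 _ hf hw8)
    · exact ⟨0, fun h => absurd h hy⟩
  choose ν hν using hν
  obtain ⟨g, d1, ⟨K, d2⟩, d3⟩ := glob (V := ((ℝ ∙ e)ᗮ : Submodule ℝ (E N))) (g0 := g0)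
    (a := fun y => -((⟪ν y, e⟫)⁻¹ • Submodule.orthogonalProjectionOnto (ℝ ∙ e)ᗮ (ν y))) hβ hβ1 (by
      intro y y' hy hy' hd
      obtain ⟨-, -, h3⟩ := (hν y hy).2.2 y' (g0 y') (hg0 y' hy').1 (hg0 y' hy').2 hd
      beta_reduce
      rw [inner_neg_left, real_inner_smul_left, Submodule.inner_orthogonalProjectionOnto_eq_of_mem_right, real_inner_comm (((y' - y : ((ℝ ∙ e)ᗮ : Submodule ℝ (E N))) : E N)) (ν y), sub_neg_eq_add, inv_mul_eq_div]
      exact h3) (by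
      intro y hy
      obtain ⟨n1, n2, n3⟩ := hν y hy
      obtain ⟨h1, -, -⟩ := n3 y (g0 y) (hg0 y hy).1 (hg0 y hy).2 (by rw [sub_self, norm_zero]; norm_num)
      rw [norm_neg, norm_smul, Real.norm_of_nonneg (by rw [inv_nonneg]; linarith)]
      have hp : Submodule.orthogonalProjectionOnto (ℝ ∙ e)ᗮ (ν y) = Submodule.orthogonalProjectionOnto (ℝ ∙ e)ᗮ (ν y - e) := by
        rw [map_sub, Submodule.orthogonalProjectionOnto_orthogonalComplement_singleton_eq_zero, sub_zero]
      rw [hp, inv_mul_le_iff₀ (by linarith)]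
      have := Submodule.norm_orthogonalProjectionOnto_apply_le (ℝ ∙ e)ᗮ (ν y - e)
      linarith) (by
      intro y hy
      linarith [(hg0 y hy).2])
  refine ⟨e, he, g, d1, ⟨K, fun y z => ?_⟩, ?_⟩
  · have := d2 y z
    rwa [Submodule.coe_norm, Submodule.coe_sub] at this
  ext x
  have hdec : ((Submodule.orthogonalProjectionOnto (ℝ ∙ e)ᗮ x : ((ℝ ∙ e)ᗮ : Submodule ℝ (E N))) : E N) + ⟪x, e⟫ • e = x := by
    have h1 := Submodule.starProjection_unit_singleton ℝ he x
    have h2 := Submodule.starProjection_add_starProjection_orthogonal (K := (ℝ ∙ e)) x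
    rw [h1, real_inner_comm] at h2
    rw [Submodule.coe_orthogonalProjectionOnto_apply, add_comm]; exact h2
  have hsub : ball (0 : E N) (1/2) ⊆ ball (0 : E N) 1 := ball_subset_ball (by norm_num)
  have hpn := Submodule.norm_orthogonalProjectionOnto_apply_le (ℝ ∙ e)ᗮ x
  obtain ⟨p, hp⟩ : ∃ p, p = Submodule.orthogonalProjectionOnto (ℝ ∙ e)ᗮ x := ⟨_, rfl⟩
  simp only [mem_inter_iff, mem_setOf_eq]
  rw [← hp] at hdec hpn ⊢
  constructor
  · rintro ⟨hS, hB⟩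
    refine ⟨hB, ?_⟩
    have hB' := mem_ball_zero_iff.1 hB
    have hfx := (fb_iff hc hn (hsub hB)).1 hS
    rw [d3 p (by linarith)]
    have := ((hν p (by linarith)).2.2 p ⟪x, e⟫ (by rw [hdec]; exact hfx) (hflat x (hsub hB) hfx) (by rw [sub_self, norm_zero]; norm_num)).2.1
    rw [sub_self, norm_zero] at this
    exact sub_eq_zero.1 (abs_nonpos_iff.1 this)
  · rintro ⟨hB, hx⟩
    refine ⟨?_, hB⟩
    have hB' := mem_ball_zero_iff.1 hB
    rw [d3 p (by linarith)] at hx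
    have := (hg0 p (by linarith)).1
    rw [← hx, hdec] at this
    exact (fb_iff hc hn (hsub hB)).2 this
end Fin2

/-- Theorem 1.1: flat free boundaries are `C^{1,β}`.
`eₙ`-flatness plus smallness of `‖f‖_∞` and of the `α`-Hölder seminorm of `Q`
imply that the free boundary is a `C^{1,β}` graph in `B_{1/2}`. -/
theorem flat_free_boundaries_are_C1beta
    (n : ℕ) (μ α : ℝ) (hμ : 0 ≤ μ) (hα : 0 < α) (hα1 : α ≤ 1) :
    ∃ εt β : ℝ, 0 < εt ∧ 0 < β ∧ β < 1 ∧
      ∀ u f Q : E (n + 1) → ℝ,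
        ContinuousOn u (ball (0 : E (n + 1)) 1) →
        (∀ x ∈ ball (0 : E (n + 1)) 1, 0 ≤ u x) →
        ContinuousOn f (ball (0 : E (n + 1)) 1) →
        (∃ M : ℝ, ∀ x ∈ ball (0 : E (n + 1)) 1, |f x| ≤ M) →
        ContinuousOn Q (ball (0 : E (n + 1)) 1) →
        (∀ x ∈ ball (0 : E (n + 1)) 1, 0 ≤ Q x) →
        ViscSol μ (ball 0 1) f Q u →
        (0 : E (n + 1)) ∈ freeBdry (ball 0 1) u →
        Q 0 = 1 →
        -- `εt`-flatness of the graph of `u` in `B₁`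
        (∀ x ∈ ball (0 : E (n + 1)) 1,
          max (x (Fin.last n) - εt) 0 ≤ u x ∧ u x ≤ max (x (Fin.last n) + εt) 0) →
        -- `‖f‖_{L^∞(B₁)} ≤ εt`
        (∀ x ∈ ball (0 : E (n + 1)) 1, |f x| ≤ εt) →
        -- `[Q]_{C^{0,α}(B₁)} ≤ εt`
        (∀ x ∈ ball (0 : E (n + 1)) 1, ∀ y ∈ ball (0 : E (n + 1)) 1,
          |Q x - Q y| ≤ εt * ‖x - y‖ ^ α) →
        IsC1GraphIn β (freeBdry (ball 0 1) u) (ball 0 (1 / 2)) := by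

  obtain ⟨εt, β, ht0, ht1, hβ0, hβ1, hPT⟩ := PT (N := n + 1) (Nat.succ_pos n) hμ hα
  refine ⟨εt, β, ht0, hβ0, hβ1, ?_⟩
  intro u f Q hc hn hfc hfM hQc hQn hV h0 hQ0 hflat hf hQ
  obtain ⟨e, hed⟩ : ∃ e : E (n + 1), e = EuclideanSpace.single (Fin.last n) 1 := ⟨_, rfl⟩
  have he : ‖e‖ = 1 := by rw [hed]; simp
  have hie : ∀ x : E (n + 1), ⟪x, e⟫ = x (Fin.last n) := fun x => by
    rw [hed, EuclideanSpace.inner_single_right]; simp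
  have hF : Flat e (-εt) εt 0 1 u := fun x hx => by
    rw [hie, ← sub_eq_add_neg]; exact hflat x hx
  refine graph he ht0 ht1 hβ0 hβ1 hc hn hF (hPT u e he hF ?_)
  intro x0 hx0
  refine ⟨Q x0, ?_, fun σ hσ hb => ?_⟩
  · have h1 := hQ x0 hx0 0 (mem_ball_self one_pos)
    rw [hQ0, sub_zero] at h1
    have h2 : ‖x0‖ ^ α ≤ 1 := Real.rpow_le_one (norm_nonneg _) (mem_ball_zero_iff.1 hx0).le hα.le
    exact h1.trans (mul_le_of_le_one_right ht0.le h2)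
  have hQs : ∀ x ∈ ball x0 σ, |Q x - Q x0| ≤ εt * σ ^ α := fun x hx => by
    refine (hQ x (hb hx) x0 hx0).trans ?_
    have : ‖x - x0‖ ^ α ≤ σ ^ α := Real.rpow_le_rpow (norm_nonneg _) (by
      rw [mem_ball, dist_eq_norm] at hx; exact hx.le) hα.le
    gcongr
  exact {
    cont := hc.mono hb
    nn := fun x hx => hn x (hb hx)
    below := fun φ hφ x hx hu ht => ((hV.1 φ hφ x ⟨hb hx, hu⟩).1 ht).trans (abs_le.1 (hf x (hb hx))).2
    above := fun φ hφ x hx hu ht => (abs_le.1 (hf x (hb hx))).1.trans ((hV.1 φ hφ x ⟨hb hx, hu⟩).2 ht)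
    fbelow := fun φ hφ x hx hfp hg ht => by
      have h1 := (hV.2 φ hφ x ((fb_iff hc hn (hb hx)).2 hfp) hg).1 ht
      have h2 := (abs_le.1 (hQs x hx)).2
      linarith
    fabove := fun φ hφ x hx hfp hg ht => by
      have h1 := (hV.2 φ hφ x ((fb_iff hc hn (hb hx)).2 hfp) hg).2 ht
      have h2 := (abs_le.1 (hQs x hx)).1
      linarith }
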